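/- Assume the nondegeneracy and curvature conditions and the auxiliary hypothesis. Then for any σ > 0 there exist c, C ∈ (0,∞) with the following property: for every 0 < ε ≤ 1 and every triple f = (f₁,f₂,f₃) of Lebesgue measurable functions with ‖f_j‖_{L∞} ≤ 2 for each j, either |S(f,ε)| ≤ C·ε^c, or there exist functions f_j* : ℝ → ℝ (j = 1,2,3) that are constant on intervals of length ε, and a measurable set S ⊆ S(f,ε), satisfying |S| ≥ c·|S(f,ε)|^C and |f_j*(φ_j(x)) − f_j(φ_j(x))| ≤ C·ε^{1−σ} for every x ∈ S and every j ∈ {1,2,3}. -/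

import Mathlib

open MeasureTheory Set
open scoped ENNReal

noncomputable section

/-- `g` is constant on the intervals of a partition of `ℝ` into intervals of length `δ`. -/
def ConstOnIntervals (g : ℝ → ℝ) (δ : ℝ) : Prop :=
  ∃ b : ℝ, ∀ n : ℤ, ∃ c : ℝ,
    ∀ y ∈ Set.Ico (b + (n : ℝ) * δ) (b + ((n : ℝ) + 1) * δ), g y = c

open scoped NNReal

/-- One-dimensional sublevel estimate. -/
theorem sublevel_one (k : ℕ) : ∃ C : ℝ, 0 ≤ C ∧ ∀ (I : Set ℝ), I.OrdConnected →
    ∀ (G : ℕ → ℝ → ℝ), (∀ i < k, ∀ t ∈ I, HasDerivAt (G i) (G (i+1) t) t) →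
    ∀ lam : ℝ, 0 < lam → (∀ t ∈ I, lam ≤ G k t) → ∀ q : ℝ, 0 < q → q ≤ 1 →
    volume {t ∈ I | |G 0 t| < lam * q ^ (2 ^ k)} ≤ ENNReal.ofReal (C * q) := by
  induction k with
  | zero =>
    refine ⟨0, le_refl _, fun I _ G _ lam hl hG q hq hq1 => ?_⟩
    have : {t ∈ I | |G 0 t| < lam * q ^ (2 ^ 0)} = ∅ := by
      ext t
      simp only [mem_setOf_eq, mem_empty_iff_false, iff_false, not_and, not_lt]
      intro ht
      have h1 := hG t ht
      have h2 := le_abs_self (G 0 t)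
      have : lam * q ^ (2^0) ≤ lam := by
        simpa using mul_le_of_le_one_right hl.le hq1
      linarith
    rw [this]; simp
  | succ k ih =>
    obtain ⟨C, hC, ih⟩ := ih
    refine ⟨2 + 2 * C, by positivity, fun I hI G hG lam hl hGl q hq hq1 => ?_⟩
    set s := lam * q ^ (2 ^ k) with hs
    have hs0 : 0 < s := by positivity
    have hqk : q ^ (2 ^ k) ≤ q := pow_le_of_le_one hq.le hq1 (by positivity)
    have e1 : lam * q ^ (2 ^ (k+1)) = s * q ^ (2 ^ k) := by
      rw [hs, mul_assoc, ← pow_add, pow_succ, mul_two]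
    -- slope
    have slope : ∀ a ∈ I, ∀ b ∈ I, a ≤ b → lam * (b - a) ≤ G k b - G k a := by
      intro a ha b hb hab
      rcases hab.eq_or_lt with rfl | hab
      · simp
      have hsub : Icc a b ⊆ I := hI.out ha hb
      obtain ⟨c, hc, hc'⟩ := exists_hasDerivAt_eq_slope (G k) (G (k+1)) hab
        (fun t ht => ((hG k (by omega) t (hsub ht)).continuousAt).continuousWithinAt)
        (fun t ht => hG k (by omega) t (hsub (Ioo_subset_Icc_self ht)))
      have h1 := hGl c (hsub (Ioo_subset_Icc_self hc))
      rw [hc', le_div_iff₀ (by linarith)] at h1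
      exact h1
    have mono : ∀ a ∈ I, ∀ b ∈ I, a ≤ b → G k a ≤ G k b := by
      intro a ha b hb hab
      have := slope a ha b hb hab
      have : 0 ≤ lam * (b - a) := mul_nonneg hl.le (by linarith)
      linarith
    have hcover : {t ∈ I | |G 0 t| < lam * q ^ (2 ^ (k+1))} ⊆
        {t ∈ I | |G k t| < s} ∪ ({t ∈ {t ∈ I | s ≤ G k t} | |G 0 t| < s * q ^ (2 ^ k)} ∪
          {t ∈ {t ∈ I | s ≤ - G k t} | |- G 0 t| < s * q ^ (2 ^ k)}) := by
      rintro t ⟨ht, ht2⟩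
      rw [e1] at ht2
      rcases lt_or_ge (|G k t|) s with h | h
      · exact Or.inl ⟨ht, h⟩
      · rcases le_abs.1 h with h | h
        · exact Or.inr (Or.inl ⟨⟨ht, h⟩, ht2⟩)
        · exact Or.inr (Or.inr ⟨⟨ht, h⟩, by rwa [abs_neg]⟩)
    have hmid : volume {t ∈ I | |G k t| < s} ≤ ENNReal.ofReal (2 * q) := by
      refine (Real.volume_le_diam _).trans ?_
      refine Metric.ediam_le ?_
      rintro a ⟨ha, ha2⟩ b ⟨hb, hb2⟩
      rw [edist_dist]
      apply ENNReal.ofReal_le_ofReal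
      rw [abs_lt] at ha2 hb2
      have key : ∀ a ∈ I, ∀ b ∈ I, a ≤ b → G k b < s → -s < G k a → b - a ≤ 2 * q := by
        intro a ha b hb hab h1 h2
        have h3 := slope a ha b hb hab
        have h4 : lam * (b - a) ≤ lam * (2 * q ^ (2^k)) := by nlinarith
        have := le_of_mul_le_mul_left h4 hl
        linarith
      rw [Real.dist_eq]
      rcases le_total a b with h | h
      · rw [abs_sub_comm, abs_of_nonneg (by linarith)]
        exact key a ha b hb h hb2.2 ha2.1
      · rw [abs_of_nonneg (by linarith)]
        exact key b hb a ha h ha2.2 hb2.1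
    have h1 := ih {t ∈ I | s ≤ G k t} ⟨fun a ha b hb t ht => by
        have := hI.out ha.1 hb.1 ht
        exact ⟨this, ha.2.trans (mono _ ha.1 _ this ht.1)⟩⟩ G
        (fun i hi t ht => hG i (by omega) t ht.1) s hs0 (fun t ht => ht.2) q hq hq1
    have h2 := ih {t ∈ I | s ≤ - G k t} ⟨fun a ha b hb t ht => by
        have := hI.out ha.1 hb.1 ht
        refine ⟨this, hb.2.trans ?_⟩
        have := (mono _ this _ hb.1 ht.2)
        linarith⟩ (fun i t => - G i t)
        (fun i hi t ht => (hG i (by omega) t ht.1).neg) s hs0 (fun t ht => ht.2) q hq hq1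
    calc _ ≤ _ := measure_mono hcover
      _ ≤ ENNReal.ofReal (2 * q) + (ENNReal.ofReal (C * q) + ENNReal.ofReal (C * q)) := by
        refine (measure_union_le _ _).trans (add_le_add hmid ?_)
        exact (measure_union_le _ _).trans (add_le_add h1 h2)
      _ = _ := by
        rw [← ENNReal.ofReal_add (by positivity) (by positivity),
          ← ENNReal.ofReal_add (by positivity) (by positivity)]
        congr 1; ring

/-- Iterated directional derivatives. -/
def dirD {E : Type*} [NormedAddCommGroup E] [NormedSpace ℝ E] (v : E) (F : E → ℝ) : ℕ → E → ℝ
  | 0 => F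
  | (i+1) => fun p => fderiv ℝ (dirD v F i) p v

theorem exists_dirD_ne {E : Type*} [NormedAddCommGroup E] [NormedSpace ℝ E]
    (F : E → ℝ) (p0 : E) (hF : AnalyticAt ℝ F p0)
    (hne : ¬ ∀ᶠ p in nhds p0, F p = 0) :
    ∃ R > 0, ∃ (v : E) (k : ℕ), (∀ i, AnalyticOnNhd ℝ (dirD v F i) (Metric.ball p0 R)) ∧
      dirD v F k p0 ≠ 0 := by
  obtain ⟨R, hR, hRa⟩ := Metric.eventually_nhds_iff_ball.1 hF.eventually_analyticAt
  have : ∃ p1 ∈ Metric.ball p0 R, F p1 ≠ 0 := by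
    by_contra! h
    exact hne (Metric.eventually_nhds_iff_ball.2 ⟨R, hR, h⟩)
  obtain ⟨p1, hp1, hp1ne⟩ := this
  set v := p1 - p0 with hv
  have hA : ∀ i, AnalyticOnNhd ℝ (dirD v F i) (Metric.ball p0 R) := by
    intro i
    induction i with
    | zero => exact fun p hp => hRa p hp
    | succ i ih =>
      intro p hp
      have h1 : AnalyticAt ℝ (fderiv ℝ (dirD v F i)) p := (ih p hp).fderiv
      exact ((ContinuousLinearMap.apply ℝ ℝ v).analyticAt _).comp h1
  refine ⟨R, hR, v, ?_⟩
  by_contra! hcon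
  have hz : ∀ k, dirD v F k p0 = 0 := fun k => hcon k hA
  set g : ℝ → ℝ := fun t => F (p0 + t • v) with hg
  have hline : ∀ t : ℝ, AnalyticAt ℝ (fun t : ℝ => p0 + t • v) t := fun t => by fun_prop
  have hmem : ∀ t ∈ Icc (0:ℝ) 1, p0 + t • v ∈ Metric.ball p0 R := by
    intro t ht
    have h1 : dist p1 p0 < R := hp1
    rw [dist_eq_norm] at h1
    rw [Metric.mem_ball, dist_eq_norm, add_sub_cancel_left, norm_smul, Real.norm_eq_abs,
      abs_of_nonneg ht.1]
    calc t * ‖v‖ ≤ 1 * ‖v‖ := by gcongr; exact ht.2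
      _ < R := by rwa [one_mul]
  have hgA : AnalyticOnNhd ℝ g (Icc 0 1) := by
    intro t ht
    exact AnalyticAt.comp (g := F) (f := fun t : ℝ => p0 + t • v) (hRa _ (hmem t ht)) (hline t)
  have h0mem : (0:ℝ) ∈ Icc (0:ℝ) 1 := by simp
  have hit : ∀ i, iteratedDeriv i g =ᶠ[nhds 0] fun t => dirD v F i (p0 + t • v) := by
    intro i
    have hcont : ∀ᶠ t in nhds (0:ℝ), p0 + t • v ∈ Metric.ball p0 R :=
      ((hline 0).continuousAt).eventually_mem (Metric.isOpen_ball.mem_nhds (hmem 0 h0mem))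
    induction i with
    | zero => simp [hg, dirD]
    | succ i ih =>
      rw [iteratedDeriv_succ]
      filter_upwards [ih.deriv, hcont] with t ht hc
      rw [ht]
      have h1 : HasFDerivAt (dirD v F i) (fderiv ℝ (dirD v F i) (p0 + t • v)) (p0 + t • v) :=
        (hA i _ hc).differentiableAt.hasFDerivAt
      have h2 : HasDerivAt (fun t : ℝ => p0 + t • v) v t := by
        simpa using ((hasDerivAt_id t).smul_const v).const_add p0
      exact (h1.comp_hasDerivAt t h2).deriv
  have hord : analyticOrderAt g 0 = ⊤ := by
    rw [ENat.eq_top_iff_forall_ge]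
    intro n
    rw [natCast_le_analyticOrderAt_iff_iteratedDeriv_eq_zero (hgA 0 h0mem)]
    intro i _
    rw [(hit i).self_of_nhds]
    simpa using hz i
  rw [analyticOrderAt_eq_top] at hord
  have := hgA.eqOn_zero_of_preconnected_of_eventuallyEq_zero isPreconnected_Icc h0mem hord
    (show (1:ℝ) ∈ Icc (0:ℝ) 1 by simp)
  apply hp1ne
  simpa [hg, hv] using this

theorem sublevel_local {E : Type*} [NormedAddCommGroup E] [NormedSpace ℝ E]
    [FiniteDimensional ℝ E] [MeasurableSpace E] [BorelSpace E] (μ : Measure E)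
    [μ.IsAddHaarMeasure] (F : E → ℝ) (p0 : E) (hF : AnalyticAt ℝ F p0)
    (hne : ¬ ∀ᶠ p in nhds p0, F p = 0) :
    ∃ r > 0, ∃ lam > 0, ∃ (N : ℕ) (C : ℝ), 0 ≤ C ∧ ∀ q : ℝ, 0 < q → q ≤ 1 →
      μ {p ∈ Metric.ball p0 r | |F p| < lam * q ^ N} ≤ ENNReal.ofReal (C * q) := by
  obtain ⟨R, hR, v, k, hA, hk⟩ := exists_dirD_ne F p0 hF hne
  set H := dirD v F with hH
  obtain ⟨s, hs, hsk⟩ : ∃ s : ℝ, |s| = 1 ∧ 0 < s * H k p0 := by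
    rcases lt_or_gt_of_ne hk with h | h
    · exact ⟨-1, by simp, by linarith⟩
    · exact ⟨1, by simp, by linarith⟩
  set lam := s * H k p0 / 2 with hlam
  have hlam0 : 0 < lam := by positivity
  have hcontk : ContinuousAt (H k) p0 := (hA k p0 (Metric.mem_ball_self hR)).continuousAt
  have hev : ∀ᶠ p in nhds p0, lam < s * H k p :=
    (continuousAt_const.mul hcontk).eventually_const_lt (by show lam < s * H k p0; simp only [hlam]; linarith)
  obtain ⟨R', hR', hRl⟩ := Metric.eventually_nhds_iff_ball.1 hev
  set ρ := min R R' with hρ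
  have hρ0 : 0 < ρ := lt_min hR hR'
  obtain ⟨C, hC, hsub⟩ := sublevel_one k
  set b : ℝ := ρ / 2 / (‖v‖ + 1) with hb
  have hb0 : 0 < b := by positivity
  have hbv : ∀ t ∈ Icc (-b) b, ‖t • v‖ < ρ / 2 := by
    intro t ht
    rw [norm_smul, Real.norm_eq_abs]
    have h1 : |t| ≤ b := abs_le.2 ht
    calc |t| * ‖v‖ ≤ b * ‖v‖ := by gcongr
      _ < b * (‖v‖ + 1) := by gcongr; linarith
      _ = ρ / 2 := by rw [hb]; field_simp
  refine ⟨ρ/2, by positivity, lam, hlam0, 2 ^ k, C * (μ (Metric.ball p0 ρ)).toReal / (2 * b),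
    by positivity, fun q hq hq1 => ?_⟩
  set A := {p ∈ Metric.ball p0 (ρ/2) | |F p| < lam * q ^ (2 ^ k)} with hAdef
  have hFc : ContinuousOn F (Metric.ball p0 (ρ/2)) := by
    intro p hp
    refine (hA 0 p ?_).continuousAt.continuousWithinAt
    exact Metric.ball_subset_ball (by linarith [min_le_left R R']) hp
  have hAo : IsOpen A := by
    have := hFc.abs.isOpen_inter_preimage Metric.isOpen_ball (isOpen_Iio (a := lam * q ^ (2 ^ k)))
    exact this
  have hAm : MeasurableSet A := hAo.measurableSet
  set Bs : Set (E × ℝ) := {pt | pt.2 ∈ Icc (-b) b ∧ pt.1 + pt.2 • v ∈ A} with hBs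
  have hBm : MeasurableSet Bs := by
    refine MeasurableSet.inter (measurable_snd measurableSet_Icc) ?_
    have : Continuous fun pt : E × ℝ => pt.1 + pt.2 • v := by fun_prop
    exact (hAo.preimage this).measurableSet
  have hle1 : μ A * ENNReal.ofReal (2 * b) ≤ (μ.prod volume) Bs := by
    rw [Measure.prod_apply_symm hBm]
    calc μ A * ENNReal.ofReal (2*b) = ∫⁻ t in Icc (-b) b, μ A := by
          rw [setLIntegral_const, Real.volume_Icc]; congr 2; ring
      _ ≤ ∫⁻ t in Icc (-b) b, μ ((fun x => (x, t)) ⁻¹' Bs) := by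
          refine setLIntegral_mono' measurableSet_Icc fun t ht => ?_
          have : (fun x => (x, t)) ⁻¹' Bs = (fun x => x + t • v) ⁻¹' A := by
            ext x; simp [hBs, ht.1, ht.2]
          rw [this, measure_preimage_add_right]
      _ ≤ _ := setLIntegral_le_lintegral _ _
  have hle2 : (μ.prod volume) Bs ≤ ENNReal.ofReal (C * q) * μ (Metric.ball p0 ρ) := by
    rw [Measure.prod_apply hBm]
    calc ∫⁻ p, volume (Prod.mk p ⁻¹' Bs) ∂μ
        ≤ ∫⁻ p, (Metric.ball p0 ρ).indicator (fun _ => ENNReal.ofReal (C * q)) p ∂μ := by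
          refine lintegral_mono fun p => ?_
          by_cases hp : p ∈ Metric.ball p0 ρ
          · rw [indicator_of_mem hp]
            set I := {t : ℝ | p + t • v ∈ Metric.ball p0 ρ} with hI
            have hIc : I.OrdConnected := by
              have h1 : Convex ℝ ((AffineMap.lineMap p (p + v) : ℝ →ᵃ[ℝ] E) ⁻¹' Metric.ball p0 ρ) :=
                (convex_ball p0 ρ).affine_preimage _
              have h2 : I = (AffineMap.lineMap p (p + v) : ℝ →ᵃ[ℝ] E) ⁻¹' Metric.ball p0 ρ := by
                ext t; simp [hI, AffineMap.lineMap_apply, add_comm]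
              rw [h2]; exact h1.ordConnected
            refine le_trans (measure_mono ?_) (hsub I hIc (fun i t => s * H i (p + t • v)) ?_ lam hlam0 ?_ q hq hq1)
            · rintro t ⟨_, ht2, ht3⟩
              refine ⟨Metric.ball_subset_ball (by linarith) ht2, ?_⟩
              show |s * F (p + t • v)| < _
              rw [abs_mul, hs, one_mul]
              exact ht3
            · intro i _ t ht
              have hc : p + t • v ∈ Metric.ball p0 R :=
                Metric.ball_subset_ball (min_le_left _ _) ht
              have h1 : HasFDerivAt (H i) (fderiv ℝ (H i) (p + t • v)) (p + t • v) :=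
                (hA i _ hc).differentiableAt.hasFDerivAt
              have h2 : HasDerivAt (fun t : ℝ => p + t • v) v t := by
                simpa using ((hasDerivAt_id t).smul_const v).const_add p
              exact (h1.comp_hasDerivAt t h2).const_mul s
            · intro t ht
              exact (hRl _ (Metric.ball_subset_ball (min_le_right _ _) ht)).le
          · rw [indicator_of_notMem hp]
            have : Prod.mk p ⁻¹' Bs = ∅ := by
              ext t
              simp only [mem_preimage, mem_empty_iff_false, iff_false]
              rintro ⟨ht1, ht2, _⟩
              apply hp
              have h1 := hbv t ht1
              simp only [] at ht2
              rw [Metric.mem_ball, dist_eq_norm] at ht2 ⊢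
              have : p - p0 = (p + t • v - p0) - t • v := by abel
              rw [this]
              linarith [norm_sub_le (p + t • v - p0) (t • v)]
            rw [this]; simp
      _ = _ := by rw [lintegral_indicator Metric.isOpen_ball.measurableSet, setLIntegral_const]
  have hfin : μ (Metric.ball p0 ρ) ≠ ⊤ := measure_ball_lt_top.ne
  have h3 := hle1.trans hle2
  rw [← ENNReal.le_div_iff_mul_le (by left; simpa using hb0) (by left; exact ENNReal.ofReal_ne_top)] at h3
  refine h3.trans (le_of_eq ?_)
  rw [← ENNReal.ofReal_toReal hfin, ← ENNReal.ofReal_mul (by positivity),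
    ← ENNReal.ofReal_div_of_pos (by positivity)]
  congr 1
  rw [ENNReal.toReal_ofReal (by positivity)]
  ring

theorem lip_measure {E F : Type*} [NormedAddCommGroup E] [NormedSpace ℝ E]
    [FiniteDimensional ℝ E] [MeasurableSpace E] [BorelSpace E] (μ : Measure E)
    [μ.IsAddHaarMeasure] [NormedAddCommGroup F] [NormedSpace ℝ F]
    [FiniteDimensional ℝ F] [MeasurableSpace F] [BorelSpace F] (ν : Measure F)
    [ν.IsAddHaarMeasure] (hd : Module.finrank ℝ E = Module.finrank ℝ F) :
    ∃ C : ℝ, 0 < C ∧ ∀ (K : ℝ≥0) (f : E → F) (s : Set E), LipschitzOnWith K f s →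
      ν (f '' s) ≤ ENNReal.ofReal (C * K ^ (Module.finrank ℝ E)) * μ s := by
  set n := Module.finrank ℝ E with hn
  have h1 : Measure.IsAddHaarMeasure (Measure.hausdorffMeasure (X := E) (n : ℝ)) :=
    MeasureTheory.isAddHaarMeasure_hausdorffMeasure
  have h2 : Measure.IsAddHaarMeasure (Measure.hausdorffMeasure (X := F) (n : ℝ)) := by
    rw [hd]; exact MeasureTheory.isAddHaarMeasure_hausdorffMeasure
  obtain ⟨c1, hc1⟩ : ∃ c1 : ℝ≥0, ν = c1 • Measure.hausdorffMeasure (X := F) (n : ℝ) :=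
    ⟨_, Measure.isAddLeftInvariant_eq_smul _ _⟩
  obtain ⟨c2, hc2⟩ : ∃ c2 : ℝ≥0, Measure.hausdorffMeasure (X := E) (n : ℝ) = c2 • μ :=
    ⟨_, Measure.isAddLeftInvariant_eq_smul _ _⟩
  refine ⟨c1 * c2 + 1, by positivity, fun K f s hf => ?_⟩
  have h3 := hf.hausdorffMeasure_image_le (d := (n:ℝ)) (by positivity)
  rw [hc2] at h3
  rw [hc1, Measure.smul_apply]
  calc c1 • Measure.hausdorffMeasure (n:ℝ) (f '' s)
      ≤ c1 • ((K:ℝ≥0∞) ^ (n:ℝ) * (c2 • μ) s) := by gcongr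
    _ = ENNReal.ofReal (c1 * c2 * K ^ n) * μ s := by
      rw [Measure.smul_apply, ENNReal.smul_def, ENNReal.smul_def, smul_eq_mul, smul_eq_mul,
        ENNReal.rpow_natCast, ENNReal.ofReal_mul (by positivity), ENNReal.ofReal_mul (by positivity),
        ENNReal.ofReal_pow (by positivity)]
      simp only [ENNReal.ofReal_coe_nnreal]
      ring
    _ ≤ _ := by
      gcongr
      linarith

theorem antilip_measure {E F : Type*} [NormedAddCommGroup E] [NormedSpace ℝ E]
    [FiniteDimensional ℝ E] [MeasurableSpace E] [BorelSpace E] (μ : Measure E)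
    [μ.IsAddHaarMeasure] [NormedAddCommGroup F] [NormedSpace ℝ F]
    [FiniteDimensional ℝ F] [MeasurableSpace F] [BorelSpace F] (ν : Measure F)
    [ν.IsAddHaarMeasure] (hd : Module.finrank ℝ E = Module.finrank ℝ F) :
    ∃ C : ℝ, 0 < C ∧ ∀ (K : ℝ) (g : E → F) (s : Set E), 0 ≤ K →
      (∀ p ∈ s, ∀ q ∈ s, dist p q ≤ K * dist (g p) (g q)) →
      μ s ≤ ENNReal.ofReal (C * K ^ (Module.finrank ℝ E)) * ν (g '' s) := by
  obtain ⟨C, hC, h⟩ := lip_measure ν μ hd.symm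
  refine ⟨C, hC, fun K g s hK hg => ?_⟩
  rcases s.eq_empty_or_nonempty with rfl | ⟨p0, hp0⟩
  · simp
  have hinj : InjOn g s := by
    intro p hp q hq hpq
    have := hg p hp q hq
    rw [hpq, dist_self, mul_zero] at this
    exact dist_le_zero.1 this
  have : Nonempty E := ⟨p0⟩
  set f := Function.invFunOn g s with hf
  have hinv : ∀ p ∈ s, f (g p) = p := fun p hp => hinj.leftInvOn_invFunOn hp
  have himg : f '' (g '' s) = s := by
    rw [image_image]
    ext p; constructor
    · rintro ⟨q, hq, rfl⟩; show f (g q) ∈ s; rw [hinv q hq]; exact hq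
    · intro hp; exact ⟨p, hp, hinv p hp⟩
  have hl : LipschitzOnWith (⟨K, hK⟩ : ℝ≥0) f (g '' s) := by
    apply LipschitzOnWith.of_dist_le_mul
    rintro _ ⟨p, hp, rfl⟩ _ ⟨q, hq, rfl⟩
    rw [hinv p hp, hinv q hq]
    exact hg p hp q hq
  have := h ⟨K, hK⟩ f (g '' s) hl
  rw [himg, ← hd] at this
  exact this

theorem prod_ge_of_slices {X Z : Type*} [MeasurableSpace X] [MeasurableSpace Z] (μ : Measure X)
    (ζ : Measure Z) [SFinite ζ] (A : Set (X × Z)) (hA : MeasurableSet A) (B : Set X)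
    (hB : MeasurableSet B) (h : ℝ≥0∞) (hh : ∀ p ∈ B, h ≤ ζ {z | (p, z) ∈ A}) :
    h * μ B ≤ (μ.prod ζ) A := by
  rw [Measure.prod_apply hA]
  calc h * μ B = ∫⁻ _ in B, h ∂μ := by rw [setLIntegral_const]
    _ ≤ ∫⁻ p in B, ζ (Prod.mk p ⁻¹' A) ∂μ := setLIntegral_mono' hB fun p hp => hh p hp
    _ ≤ _ := setLIntegral_le_lintegral _ _

theorem prod_le_of_slices {X Z : Type*} [MeasurableSpace X] [MeasurableSpace Z] (μ : Measure X)
    (ζ : Measure Z) [SFinite ζ] (A : Set (X × Z)) (hA : MeasurableSet A) (B : Set X)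
    (hB : MeasurableSet B) (h : ℝ≥0∞) (hAB : ∀ p ∈ A, p.1 ∈ B)
    (hh : ∀ p ∈ B, ζ {z | (p, z) ∈ A} ≤ h) :
    (μ.prod ζ) A ≤ h * μ B := by
  rw [Measure.prod_apply hA]
  calc ∫⁻ p, ζ (Prod.mk p ⁻¹' A) ∂μ ≤ ∫⁻ p, B.indicator (fun _ => h) p ∂μ := by
        refine lintegral_mono fun p => ?_
        by_cases hp : p ∈ B
        · rw [indicator_of_mem hp]; exact hh p hp
        · rw [indicator_of_notMem hp]
          have : Prod.mk p ⁻¹' A = ∅ := by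
            ext z; simp only [mem_preimage, mem_empty_iff_false, iff_false]
            exact fun hz => hp (hAB _ hz)
          rw [this]; simp
    _ = _ := by rw [lintegral_indicator hB, setLIntegral_const]

/-- measurability of sets cut out by the size of slices -/
theorem measurable_slice {X Z : Type*} [MeasurableSpace X] [MeasurableSpace Z]
    (ζ : Measure Z) [SFinite ζ] (A : Set (X × Z)) (hA : MeasurableSet A) :
    Measurable fun p => ζ {z | (p, z) ∈ A} := measurable_measure_prodMk_left hA

theorem trim_slices {X Z : Type*} [MeasurableSpace X] [MeasurableSpace Z] (μ : Measure X)
    (ζ : Measure Z) [SFinite ζ] (A : Set (X × Z)) (hA : MeasurableSet A) (B : Set X)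
    (hB : MeasurableSet B) (h : ℝ≥0∞) (hAB : ∀ p ∈ A, p.1 ∈ B) :
    (μ.prod ζ) {p ∈ A | ζ {z | (p.1, z) ∈ A} < h} ≤ h * μ B := by
  have hm := measurable_slice ζ A hA
  refine prod_le_of_slices μ ζ _ ?_ B hB h (fun p hp => hAB p hp.1) ?_
  · exact hA.inter (measurableSet_lt (hm.comp measurable_fst) measurable_const)
  · intro p _
    by_cases hp : ζ {z | (p, z) ∈ A} < h
    · exact (measure_mono fun z hz => hz.1).trans hp.le
    · have : {z | (p, z) ∈ {p ∈ A | ζ {z | (p.1, z) ∈ A} < h}} = ∅ := by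
        ext z; simp only [mem_ofPred_eq, mem_empty_iff_false, iff_false]
        exact fun hz => hp hz.2
      rw [this]; simp

theorem path_lemma (E : Set ((ℝ × ℝ) × ℝ)) (hE : MeasurableSet E)
    (Φ Ξ : (ℝ × ℝ) × ℝ → ℝ × ℝ) (hΦ : Measurable Φ) (hΞ : Measurable Ξ)
    (X0 Y0 : Set (ℝ × ℝ)) (Z0 : Set ℝ) (hX0 : MeasurableSet X0) (hY0 : MeasurableSet Y0)
    (hEX : ∀ p ∈ E, p.1 ∈ X0) (hEY : ∀ p ∈ E, Φ p ∈ Y0) (hEZ : ∀ p ∈ E, p.2 ∈ Z0)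
    (K h : ℝ≥0∞)
    (hK : ∀ A ⊆ E, MeasurableSet A → volume A ≤
      K * volume {q : (ℝ × ℝ) × ℝ | (Ξ q, q.2) ∈ A ∧ Φ (Ξ q, q.2) = q.1}) :
    ∃ P ⊆ X0, MeasurableSet P ∧
      volume E ≤ h * volume X0 + K * (h * volume Y0) + h * volume X0 + volume Z0 * volume P ∧
      ∀ p ∈ P, h ^ 3 ≤ volume {z : (ℝ × ℝ) × ℝ | (p, z.1.1) ∈ E ∧
        (Ξ (Φ (p, z.1.1), z.1.2), z.1.2) ∈ E ∧
        Φ (Ξ (Φ (p, z.1.1), z.1.2), z.1.2) = Φ (p, z.1.1) ∧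
        (Ξ (Φ (p, z.1.1), z.1.2), z.2) ∈ E} := by
  have eqm : ∀ {α : Type} [MeasurableSpace α] (f g : α → ℝ × ℝ), Measurable f → Measurable g →
    MeasurableSet {a | f a = g a} := fun f g hf hg => measurableSet_eq_fun hf hg
  set E1 := {p ∈ E | h ≤ volume {z | (p.1, z) ∈ E}} with hE1
  have hE1m : MeasurableSet E1 := hE.inter (measurableSet_le measurable_const
    ((measurable_slice volume E hE).comp measurable_fst))
  set F1 := {q : (ℝ × ℝ) × ℝ | (Ξ q, q.2) ∈ E1 ∧ Φ (Ξ q, q.2) = q.1} with hF1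
  have hΞ2 : Measurable fun q : (ℝ × ℝ) × ℝ => (Ξ q, q.2) := hΞ.prodMk measurable_snd
  have hΦ2 : Measurable fun q : (ℝ × ℝ) × ℝ => (Φ q, q.2) := hΦ.prodMk measurable_snd
  have hF1m : MeasurableSet F1 := (hΞ2 hE1m).inter (eqm _ _ (hΦ.comp hΞ2) measurable_fst)
  set E2 := {p ∈ E1 | h ≤ volume {z | (Φ p, z) ∈ F1}} with hE2
  have hE2m : MeasurableSet E2 := hE1m.inter (measurableSet_le measurable_const
    ((measurable_slice volume F1 hF1m).comp hΦ))
  set P := X0 ∩ {p | h ≤ volume {z | (p, z) ∈ E2}} with hP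
  have hPm : MeasurableSet P := hX0.inter (measurableSet_le measurable_const
    (measurable_slice volume E2 hE2m))
  refine ⟨P, inter_subset_left, hPm, ?_, ?_⟩
  · have hcov : E ⊆ {p ∈ E | volume {z | (p.1, z) ∈ E} < h} ∪
        ({p ∈ E1 | volume {z | (Φ p, z) ∈ F1} < h} ∪
        ({p ∈ E2 | volume {z | (p.1, z) ∈ E2} < h} ∪ {p ∈ E2 | p.1 ∈ P})) := by
      intro p hp
      by_cases h1 : p ∈ E1
      · right
        by_cases h2 : p ∈ E2
        · right
          by_cases h3 : volume {z | (p.1, z) ∈ E2} < h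
          · left; exact ⟨h2, h3⟩
          · right; exact ⟨h2, hEX p hp, not_lt.1 h3⟩
        · left
          refine ⟨h1, ?_⟩
          by_contra h3; exact h2 ⟨h1, not_lt.1 h3⟩
      · left; refine ⟨hp, ?_⟩
        by_contra h3; exact h1 ⟨hp, not_lt.1 h3⟩
    have b1 := trim_slices volume volume E hE X0 hX0 h hEX
    have b2 : volume {p ∈ E1 | volume {z | (Φ p, z) ∈ F1} < h} ≤ K * (h * volume Y0) := by
      refine (hK _ (fun p hp => hp.1.1) ?_).trans ?_
      · exact hE1m.inter (measurableSet_lt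
          ((measurable_slice volume F1 hF1m).comp hΦ) measurable_const)
      gcongr
      refine le_trans (measure_mono ?_) (trim_slices volume volume F1 hF1m Y0 hY0 h ?_)
      · rintro q ⟨⟨hq1, hq2⟩, hq3⟩
        refine ⟨⟨hq1, hq3⟩, ?_⟩
        rw [hq3] at hq2
        exact hq2
      · rintro q ⟨hq1, hq2⟩
        rw [← hq2]; exact hEY _ hq1.1
    have b3 := trim_slices volume volume E2 hE2m X0 hX0 h (fun p hp => hEX p hp.1.1)
    have b4 : volume {p ∈ E2 | p.1 ∈ P} ≤ volume Z0 * volume P := by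
      refine prod_le_of_slices volume volume _ (hE2m.inter (measurable_fst hPm)) P hPm _
        (fun p hp => hp.2) (fun p hp => measure_mono ?_)
      intro z hz
      exact hEZ _ hz.1.1.1
    calc volume E ≤ _ := measure_mono hcov
      _ ≤ h * volume X0 + (K * (h * volume Y0) + (h * volume X0 + volume Z0 * volume P)) := by
        refine (measure_union_le _ _).trans (add_le_add b1 ?_)
        refine (measure_union_le _ _).trans (add_le_add b2 ?_)
        exact (measure_union_le _ _).trans (add_le_add b3 b4)
      _ = _ := by ring
  · rintro p ⟨_, hp⟩
    have m1 : Measurable fun z : ℝ × ℝ => (Φ (p, z.1), z.2) := by fun_prop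
    set Q1 : Set ℝ := {z | (p, z) ∈ E2} with hQ1
    have hQ1m : MeasurableSet Q1 := measurable_prodMk_left hE2m
    set Q2 : Set (ℝ × ℝ) := {z | z.1 ∈ Q1 ∧ (Φ (p, z.1), z.2) ∈ F1} with hQ2
    have hQ2m : MeasurableSet Q2 := (measurable_fst hQ1m).inter (m1 hF1m)
    have c1 : h * h ≤ volume Q2 := by
      refine le_trans ?_ (prod_ge_of_slices volume volume Q2 hQ2m Q1 hQ1m h ?_)
      · gcongr
        exact hp
      · intro z hz
        refine hz.2.trans (measure_mono ?_)
        intro z2 hz2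
        exact ⟨hz, hz2⟩
    have m2 : Measurable fun z : (ℝ × ℝ) × ℝ => (p, z.1.1) := by fun_prop
    have m3 : Measurable fun z : (ℝ × ℝ) × ℝ => (Ξ (Φ (p, z.1.1), z.1.2), z.1.2) := by fun_prop
    have m4 : Measurable fun z : (ℝ × ℝ) × ℝ => (Ξ (Φ (p, z.1.1), z.1.2), z.2) := by fun_prop
    calc h ^ 3 = h * (h * h) := by ring
      _ ≤ h * volume Q2 := by gcongr
      _ ≤ _ := by
        refine prod_ge_of_slices volume volume _ ?_ Q2 hQ2m h ?_
        · exact (m2 hE).inter ((m3 hE).inter ((eqm _ _ (hΦ.comp m3) (hΦ.comp m2)).inter (m4 hE)))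
        · rintro ⟨z1, z2⟩ ⟨hz1, hz2⟩
          refine hz2.1.2.trans (measure_mono ?_)
          intro z3 hz3
          exact ⟨hz1.1.1, hz2.1.1, hz2.2, hz3⟩

theorem measurable_cell (ε : ℝ) : Measurable fun x : ℝ => ⌊x / ε⌋ :=
  Int.measurable_floor.comp (measurable_id.div_const ε)

theorem cell_one (ε : ℝ) (hε : 0 < ε) (hε1 : ε ≤ 1) (a b : ℝ) (hab : b ≤ a + 1) (B : Set ℝ)
    (hB : MeasurableSet B) (hBI : B ⊆ Icc a b) (θ : ℝ≥0∞) :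
    θ * volume B ≤ θ * (ENNReal.ofReal (3 / ε) * θ) +
      volume {p : ℝ × ℝ | p.1 ∈ B ∧ p.2 ∈ B ∧ ⌊p.1 / ε⌋ = ⌊p.2 / ε⌋} := by
  set A := {p : ℝ × ℝ | p.1 ∈ B ∧ p.2 ∈ B ∧ ⌊p.1 / ε⌋ = ⌊p.2 / ε⌋} with hA
  have hAm : MeasurableSet A := (measurable_fst hB).inter ((measurable_snd hB).inter
    (measurableSet_eq_fun ((measurable_cell ε).comp measurable_fst)
      ((measurable_cell ε).comp measurable_snd)))
  set good := {x ∈ B | θ ≤ volume {x' | (x, x') ∈ A}} with hgood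
  have hgm : MeasurableSet good := hB.inter (measurableSet_le measurable_const
    (measurable_slice volume A hAm))
  have h1 : θ * volume good ≤ volume A :=
    prod_ge_of_slices volume volume A hAm good hgm θ fun p hp => hp.2
  set N := Finset.Icc ⌊a / ε⌋ ⌊b / ε⌋ with hN
  have hcov : B ⊆ good ∪ ⋃ n ∈ N, {x ∈ B | ⌊x / ε⌋ = n ∧ volume {x' | (x, x') ∈ A} < θ} := by
    intro x hx
    by_cases h : θ ≤ volume {x' | (x, x') ∈ A}
    · left; exact ⟨hx, h⟩
    · right
      simp only [mem_iUnion]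
      refine ⟨⌊x/ε⌋, ?_, hx, rfl, not_le.1 h⟩
      rw [hN, Finset.mem_Icc]
      exact ⟨Int.floor_le_floor (div_le_div_of_nonneg_right (hBI hx).1 hε.le),
        Int.floor_le_floor (div_le_div_of_nonneg_right (hBI hx).2 hε.le)⟩
  have hcard : ((N.card : ℕ) : ℝ≥0∞) ≤ ENNReal.ofReal (3 / ε) := by
    rw [← ENNReal.ofReal_natCast]
    apply ENNReal.ofReal_le_ofReal
    rw [hN, Int.card_Icc]
    have h1 := Int.floor_le (b / ε)
    have h2 := Int.lt_floor_add_one (a / ε)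
    have h3 : b / ε ≤ a / ε + 1 / ε := by rw [← add_div]; gcongr
    have h4 : 1 ≤ 1 / ε := by rw [le_div_iff₀ hε]; linarith
    have h5 : (3:ℝ) / ε = 3 * (1 / ε) := by ring
    have h6 : (((⌊b / ε⌋ + 1 - ⌊a / ε⌋).toNat : ℤ) : ℝ) ≤ 3 / ε := by
      rw [Int.toNat_eq_max, Int.cast_max]
      push_cast
      apply max_le
      · linarith
      · positivity
    exact_mod_cast h6
  have h2 : volume (⋃ n ∈ N, {x ∈ B | ⌊x / ε⌋ = n ∧ volume {x' | (x, x') ∈ A} < θ}) ≤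
      ENNReal.ofReal (3 / ε) * θ := by
    calc _ ≤ ∑ n ∈ N, volume {x ∈ B | ⌊x / ε⌋ = n ∧ volume {x' | (x, x') ∈ A} < θ} :=
          measure_biUnion_finset_le _ _
      _ ≤ ∑ n ∈ N, θ := by
        refine Finset.sum_le_sum fun n _ => ?_
        rcases eq_empty_or_nonempty
          {x ∈ B | ⌊x / ε⌋ = n ∧ volume {x' | (x, x') ∈ A} < θ} with h | ⟨x0, hx0⟩
        · rw [h]; simp
        · refine (measure_mono ?_).trans hx0.2.2.le
          intro x hx
          exact ⟨hx0.1, hx.1, hx0.2.1.trans hx.2.1.symm⟩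
      _ = N.card * θ := by rw [Finset.sum_const, nsmul_eq_mul]
      _ ≤ _ := by gcongr
  calc θ * volume B ≤ θ * (volume good + ENNReal.ofReal (3 / ε) * θ) := by
        gcongr
        refine (measure_mono hcov).trans ((measure_union_le _ _).trans ?_)
        gcongr
    _ = θ * (ENNReal.ofReal (3 / ε) * θ) + θ * volume good := by ring
    _ ≤ _ := by gcongr

theorem cell_two (ε : ℝ) (hε : 0 < ε) (hε1 : ε ≤ 1) (a b : ℝ) (hab : b ≤ a + 1)
    (Z0 : Set ℝ) (hZ0 : MeasurableSet Z0) (T : Set (ℝ × ℝ))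
    (hT : MeasurableSet T) (hTI : ∀ p ∈ T, p.1 ∈ Icc a b) (hTZ : ∀ p ∈ T, p.2 ∈ Z0) (θ : ℝ≥0∞) :
    θ * volume T ≤ θ * (ENNReal.ofReal (3 / ε) * θ) * volume Z0 +
      volume {p : (ℝ × ℝ) × ℝ | (p.1.1, p.2) ∈ T ∧ (p.1.2, p.2) ∈ T ∧
        ⌊p.1.1 / ε⌋ = ⌊p.1.2 / ε⌋} := by
  set E := {p : (ℝ × ℝ) × ℝ | (p.1.1, p.2) ∈ T ∧ (p.1.2, p.2) ∈ T ∧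
        ⌊p.1.1 / ε⌋ = ⌊p.1.2 / ε⌋} with hE
  have m1 : Measurable fun p : (ℝ × ℝ) × ℝ => (p.1.1, p.2) := by fun_prop
  have m2 : Measurable fun p : (ℝ × ℝ) × ℝ => (p.1.2, p.2) := by fun_prop
  have hEm : MeasurableSet E := (m1 hT).inter ((m2 hT).inter
    (measurableSet_eq_fun ((measurable_cell ε).comp (measurable_fst.comp measurable_fst))
      ((measurable_cell ε).comp (measurable_snd.comp measurable_fst))))
  have e1 : volume T = ∫⁻ z, volume ((fun x => (x, z)) ⁻¹' T) :=
    Measure.prod_apply_symm hT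
  have e2 : volume E = ∫⁻ z, volume ((fun x => (x, z)) ⁻¹' E) :=
    Measure.prod_apply_symm hEm
  have mT : Measurable fun z => volume ((fun x => (x, z)) ⁻¹' T) :=
    measurable_measure_prodMk_right hT
  rw [e1, e2, ← lintegral_const_mul _ mT]
  calc _ ≤ ∫⁻ z, (Z0.indicator (fun _ => θ * (ENNReal.ofReal (3 / ε) * θ)) z +
        volume ((fun x => (x, z)) ⁻¹' E)) := by
        refine lintegral_mono fun z => ?_
        by_cases hz : z ∈ Z0
        · rw [indicator_of_mem hz]
          exact cell_one ε hε hε1 a b hab _ (measurable_prodMk_right hT) (fun x hx => hTI _ hx) θ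
        · have : (fun x => (x, z)) ⁻¹' T = ∅ := by
            ext x; simp only [mem_preimage, mem_empty_iff_false, iff_false]
            exact fun h => hz (hTZ _ h)
          rw [this]; simp
    _ = _ := by
      rw [lintegral_add_left (measurable_const.indicator hZ0), lintegral_indicator hZ0,
        setLIntegral_const]

theorem cell_eq (ε : ℝ) (hε : 0 < ε) (n : ℤ) :
    {x : ℝ | ⌊x / ε⌋ = n} = Ico ((n:ℝ) * ε) (((n:ℝ) + 1) * ε) := by
  ext x
  show ⌊x / ε⌋ = n ↔ _
  rw [Int.floor_eq_iff, mem_Ico, le_div_iff₀ hε, div_lt_iff₀ hε]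

theorem cell_volume (ε : ℝ) (hε : 0 < ε) (n : ℤ) :
    volume {x : ℝ | ⌊x / ε⌋ = n} = ENNReal.ofReal ε := by
  rw [cell_eq ε hε, Real.volume_Ico]
  congr 1; ring

theorem select_cells (ε : ℝ) (hε : 0 < ε) (Gd : Set (ℝ × ℝ)) (hG : MeasurableSet Gd)
    (hcell : ∀ p ∈ Gd, ⌊p.1 / ε⌋ = ⌊p.2 / ε⌋) (f : ℝ → ℝ) :
    ∃ (fstar : ℝ → ℝ) (E1 : Set ℝ), ConstOnIntervals fstar ε ∧ MeasurableSet E1 ∧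
      volume Gd ≤ ENNReal.ofReal ε * volume E1 ∧
      ∀ x ∈ E1, ∃ x', (x', x) ∈ Gd ∧ fstar x = f x' := by
  have hIm : ∀ n : ℤ, MeasurableSet {x : ℝ | ⌊x / ε⌋ = n} := fun n =>
    (measurable_cell ε) (measurableSet_singleton n)
  have hε0 : ENNReal.ofReal ε ≠ 0 := by simpa using hε
  have hx : ∀ n : ℤ, ∃ x : ℝ, ⌊x / ε⌋ = n ∧
      volume {p ∈ Gd | ⌊p.1 / ε⌋ = n} ≤ ENNReal.ofReal ε * volume {x' | (x, x') ∈ Gd} := by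
    intro n
    set A := {p ∈ Gd | ⌊p.1 / ε⌋ = n} with hA
    have hAm : MeasurableSet A := hG.inter (measurable_fst (hIm n))
    set g : ℝ → ℝ≥0∞ := fun x => volume {x' | (x, x') ∈ Gd} with hg
    by_cases hfin : ∫⁻ x in {x : ℝ | ⌊x / ε⌋ = n}, g x = ⊤
    · exfalso
      have : ∫⁻ x in {x : ℝ | ⌊x / ε⌋ = n}, g x ≤
          ∫⁻ x in {x : ℝ | ⌊x / ε⌋ = n}, ENNReal.ofReal ε := by
        refine setLIntegral_mono' (hIm n) fun x hx => ?_
        rw [← cell_volume ε hε n]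
        refine measure_mono fun x' hx' => ?_
        exact (hcell _ hx').symm.trans hx
      rw [hfin, setLIntegral_const, cell_volume ε hε] at this
      exact absurd this (by rw [not_le]; exact ENNReal.mul_lt_top (by simp) (by simp))
    obtain ⟨x, hxn, hxa⟩ := exists_setLAverage_le (μ := volume) (f := g)
      (s := {x : ℝ | ⌊x / ε⌋ = n}) (by rw [cell_volume ε hε]; exact hε0)
      (hIm n).nullMeasurableSet hfin
    refine ⟨x, hxn, ?_⟩
    have h2 : volume A ≤ ∫⁻ x in {x : ℝ | ⌊x / ε⌋ = n}, g x := by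
      rw [show volume A = _ from Measure.prod_apply hAm, ← lintegral_indicator (hIm n)]
      refine lintegral_mono fun x => ?_
      by_cases hx : x ∈ {x : ℝ | ⌊x / ε⌋ = n}
      · rw [indicator_of_mem hx]
        exact measure_mono fun x' hx' => hx'.1
      · rw [indicator_of_notMem hx]
        have : Prod.mk x ⁻¹' A = ∅ := by
          ext z; simp only [mem_preimage, mem_empty_iff_false, iff_false]
          exact fun hz => hx hz.2
        rw [this]; simp
    refine h2.trans ?_
    rw [← measure_mul_setLAverage g (by rw [cell_volume ε hε]; simp), cell_volume ε hε]
    gcongr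
  choose xs hxs hxs2 using hx
  set E1 : Set ℝ := ⋃ n : ℤ, {x' | (xs n, x') ∈ Gd} with hE1
  have hsl : ∀ n, MeasurableSet {x' | (xs n, x') ∈ Gd} := fun n => measurable_prodMk_left hG
  refine ⟨fun x => f (xs ⌊x / ε⌋), E1, ?_, MeasurableSet.iUnion hsl, ?_, ?_⟩
  · refine ⟨0, fun n => ⟨f (xs n), fun y hy => ?_⟩⟩
    have : y ∈ {x : ℝ | ⌊x / ε⌋ = n} := by
      rw [cell_eq ε hε]; simpa using hy
    show f (xs ⌊y / ε⌋) = _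
    rw [show ⌊y/ε⌋ = n from this]
  · rw [hE1, measure_iUnion _ hsl, ← ENNReal.tsum_mul_left]
    · calc volume Gd ≤ volume (⋃ n : ℤ, {p ∈ Gd | ⌊p.1 / ε⌋ = n}) := by
            refine measure_mono fun p hp => ?_
            simp only [mem_iUnion]
            exact ⟨_, hp, rfl⟩
        _ ≤ ∑' n : ℤ, volume {p ∈ Gd | ⌊p.1 / ε⌋ = n} := measure_iUnion_le _
        _ ≤ _ := ENNReal.tsum_le_tsum hxs2
    · intro m n hmn
      rw [Function.onFun, Set.disjoint_left]
      intro x hx hx'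
      apply hmn
      have h1 := hcell _ hx
      have h2 := hcell _ hx'
      simp only [hxs] at h1 h2
      rw [h1, h2]
  · intro x hx
    obtain ⟨n, hn⟩ := mem_iUnion.1 hx
    have h1 := hcell _ hn
    simp only [hxs] at h1
    refine ⟨xs n, hn, ?_⟩
    show f (xs ⌊x/ε⌋) = _
    rw [← h1]

theorem card_cells (ε : ℝ) (hε : 0 < ε) (hε1 : ε ≤ 1) (a b : ℝ) (hab : b ≤ a + 1) :
    (((Finset.Icc ⌊a / ε⌋ ⌊b / ε⌋).card : ℕ) : ℝ≥0∞) ≤ ENNReal.ofReal (3 / ε) := by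
  rw [← ENNReal.ofReal_natCast]
  apply ENNReal.ofReal_le_ofReal
  rw [Int.card_Icc]
  have h1 := Int.floor_le (b / ε)
  have h2 := Int.lt_floor_add_one (a / ε)
  have h3 : b / ε ≤ a / ε + 1 / ε := by rw [← add_div]; gcongr
  have h4 : 1 ≤ 1 / ε := by rw [le_div_iff₀ hε]; linarith
  have h5 : (3:ℝ) / ε = 3 * (1 / ε) := by ring
  have h6 : (((⌊b / ε⌋ + 1 - ⌊a / ε⌋).toNat : ℤ) : ℝ) ≤ 3 / ε := by
    rw [Int.toNat_eq_max, Int.cast_max]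
    push_cast
    apply max_le
    · linarith
    · positivity
  exact_mod_cast h6

theorem same_cell_dist (ε : ℝ) (hε : 0 < ε) (x y : ℝ) (h : ⌊x / ε⌋ = ⌊y / ε⌋) : |x - y| ≤ ε := by
  have h1 : x ∈ {t : ℝ | ⌊t / ε⌋ = ⌊y / ε⌋} := h
  have h2 : y ∈ {t : ℝ | ⌊t / ε⌋ = ⌊y / ε⌋} := rfl
  rw [cell_eq ε hε] at h1 h2
  rw [abs_le]
  constructor <;> nlinarith [h1.1, h1.2, h2.1, h2.2]

/-- planar lemma -/
theorem planar_lemma : ∃ C : ℝ, 0 < C ∧ ∀ (Ψ : ℝ × ℝ → ℝ × ℝ) (Z : Set (ℝ × ℝ))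
    (A M lam ρ a1 b1 a2 b2 : ℝ), MeasurableSet Z → ContinuousOn Ψ Z → 0 ≤ A → 0 ≤ M → 0 ≤ lam →
    0 < ρ → ρ ≤ 1 → b1 ≤ a1 + 1 → b2 ≤ a2 + 1 →
    (∀ p ∈ Z, p.1 ∈ Icc a1 b1 ∧ p.2 ∈ Icc a2 b2) →
    (∀ p ∈ Z, |(Ψ p).1| ≤ M) →
    (∀ p ∈ Z, ∀ q ∈ Z, dist p q ≤ ρ → dist p q ≤ A * dist (Ψ p) (Ψ q)) →
    (∀ p ∈ Z, ∀ q ∈ Z, (Ψ p).1 = (Ψ q).1 → |(Ψ p).2 - (Ψ q).2| ≤ lam) →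
    volume Z ≤ ENNReal.ofReal (C * A ^ 2 * M * lam / ρ ^ 2) := by
  obtain ⟨C, hC, hanti⟩ := antilip_measure (volume : Measure (ℝ × ℝ)) (volume : Measure (ℝ × ℝ)) rfl
  have hfr : Module.finrank ℝ (ℝ × ℝ) = 2 := by simp
  refine ⟨18 * C, by positivity, fun Ψ Z A M lam ρ a1 b1 a2 b2 hZ hΨ hA hM hlam hρ hρ1 h1 h2 hbox
    hΨM hAL hl => ?_⟩
  set N1 := Finset.Icc ⌊a1 / ρ⌋ ⌊b1 / ρ⌋
  set N2 := Finset.Icc ⌊a2 / ρ⌋ ⌊b2 / ρ⌋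
  set W : ℤ × ℤ → Set (ℝ × ℝ) := fun n => {p ∈ Z | ⌊p.1 / ρ⌋ = n.1 ∧ ⌊p.2 / ρ⌋ = n.2} with hW
  have hcov : Z ⊆ ⋃ n ∈ N1 ×ˢ N2, W n := by
    intro p hp
    simp only [mem_iUnion]
    obtain ⟨k1, k2⟩ := hbox p hp
    refine ⟨(⌊p.1/ρ⌋, ⌊p.2/ρ⌋), ?_, hp, rfl, rfl⟩
    rw [Finset.mem_product, Finset.mem_Icc, Finset.mem_Icc]
    exact ⟨⟨Int.floor_le_floor (div_le_div_of_nonneg_right k1.1 hρ.le),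
        Int.floor_le_floor (div_le_div_of_nonneg_right k1.2 hρ.le)⟩,
        ⟨Int.floor_le_floor (div_le_div_of_nonneg_right k2.1 hρ.le),
        Int.floor_le_floor (div_le_div_of_nonneg_right k2.2 hρ.le)⟩⟩
  have hpiece : ∀ n, volume (W n) ≤ ENNReal.ofReal (C * A ^ 2 * (2 * M * lam)) := by
    intro n
    have hWm : MeasurableSet (W n) := hZ.inter
      (((measurable_cell ρ).comp measurable_fst (measurableSet_singleton n.1)).inter
       ((measurable_cell ρ).comp measurable_snd (measurableSet_singleton n.2)))
    have hAL' : ∀ p ∈ W n, ∀ q ∈ W n, dist p q ≤ A * dist (Ψ p) (Ψ q) := by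
      intro p hp q hq
      refine hAL p hp.1 q hq.1 ?_
      rw [Prod.dist_eq, Real.dist_eq, Real.dist_eq]
      exact max_le (same_cell_dist ρ hρ _ _ (hp.2.1.trans hq.2.1.symm))
        (same_cell_dist ρ hρ _ _ (hp.2.2.trans hq.2.2.symm))
    have hinj : InjOn Ψ (W n) := by
      intro p hp q hq hpq
      have := hAL' p hp q hq
      rw [hpq, dist_self, mul_zero] at this
      exact dist_le_zero.1 this
    have him : MeasurableSet (Ψ '' W n) :=
      hWm.image_of_continuousOn_injOn (hΨ.mono fun p hp => hp.1) hinj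
    have hvol : volume (Ψ '' W n) ≤ ENNReal.ofReal lam * volume (Icc (-M) M) := by
      refine prod_le_of_slices volume volume _ him (Icc (-M) M) measurableSet_Icc _ ?_ ?_
      · rintro _ ⟨p, hp, rfl⟩
        exact abs_le.1 (hΨM p hp.1)
      · intro v _
        refine (Real.volume_le_diam _).trans (Metric.ediam_le ?_)
        rintro s ⟨p, hp, hps⟩ t ⟨q, hq, hqt⟩
        rw [edist_dist]
        apply ENNReal.ofReal_le_ofReal
        have := hl p hp.1 q hq.1 (by rw [hps, hqt])
        rw [hps, hqt] at this
        exact this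
    have := hanti A Ψ (W n) hA hAL'
    rw [hfr] at this
    refine this.trans ?_
    rw [show ENNReal.ofReal (C * A ^ 2 * (2 * M * lam)) =
      ENNReal.ofReal (C * A ^ 2) * ENNReal.ofReal (2 * M * lam) from
        ENNReal.ofReal_mul (by positivity)]
    gcongr
    refine hvol.trans (le_of_eq ?_)
    rw [Real.volume_Icc, ← ENNReal.ofReal_mul hlam]
    congr 1; ring
  calc volume Z ≤ _ := measure_mono hcov
    _ ≤ ∑ n ∈ N1 ×ˢ N2, volume (W n) := measure_biUnion_finset_le _ _
    _ ≤ ∑ n ∈ N1 ×ˢ N2, ENNReal.ofReal (C * A ^ 2 * (2 * M * lam)) :=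
      Finset.sum_le_sum fun n _ => hpiece n
    _ = (N1.card * N2.card) * ENNReal.ofReal (C * A ^ 2 * (2 * M * lam)) := by
      rw [Finset.sum_const, nsmul_eq_mul, Finset.card_product]; push_cast; rfl
    _ ≤ (ENNReal.ofReal (3/ρ) * ENNReal.ofReal (3/ρ)) *
        ENNReal.ofReal (C * A ^ 2 * (2 * M * lam)) := by
      gcongr
      · exact card_cells ρ hρ hρ1 _ _ h1
      · exact card_cells ρ hρ hρ1 _ _ h2
    _ = _ := by
      rw [← ENNReal.ofReal_mul (by positivity), ← ENNReal.ofReal_mul (by positivity)]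
      congr 1; field_simp; ring

theorem second_order {E : Type*} [NormedAddCommGroup E] [NormedSpace ℝ E]
    (F : E → ℝ) (p0 : E) (hF : AnalyticAt ℝ F p0) :
    ∃ R > 0, ∃ K : ℝ, 0 < K ∧ (∀ P ∈ Metric.ball p0 R, AnalyticAt ℝ F P ∧ |F P| ≤ K ∧
      ‖fderiv ℝ F P‖ ≤ K) ∧
      (∀ P ∈ Metric.ball p0 R, ∀ Q ∈ Metric.ball p0 R, |F P - F Q| ≤ K * ‖P - Q‖) ∧
      ∀ P ∈ Metric.ball p0 R, ∀ Q ∈ Metric.ball p0 R, ∀ Q0 ∈ Metric.ball p0 R, ∀ m : ℝ,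
        dist P Q0 ≤ m → dist Q Q0 ≤ m →
        |F P - F Q - fderiv ℝ F Q0 (P - Q)| ≤ K * m * ‖P - Q‖ := by
  have hd : AnalyticAt ℝ (fderiv ℝ F) p0 := hF.fderiv
  obtain ⟨K1, t, ht, hK1⟩ := ContDiffAt.exists_lipschitzOnWith (hd.contDiffAt (n := 1))
  have h1 : ∀ᶠ P in nhds p0, |F P| < |F p0| + 1 :=
    hF.continuousAt.abs.eventually_lt_const (by linarith)
  have h2 : ∀ᶠ P in nhds p0, ‖fderiv ℝ F P‖ < ‖fderiv ℝ F p0‖ + 1 :=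
    hd.continuousAt.norm.eventually_lt_const (by linarith)
  obtain ⟨R, hR, hball⟩ := Metric.eventually_nhds_iff_ball.1
    (((hF.eventually_analyticAt.and h1).and h2).and (Filter.eventually_mem_set.2 ht))
  refine ⟨R, hR, |F p0| + ‖fderiv ℝ F p0‖ + 1 + K1, by positivity, ?_, ?_, ?_⟩
  · intro P hP
    obtain ⟨⟨⟨a, b⟩, c⟩, d⟩ := hball P hP
    refine ⟨a, ?_, ?_⟩
    · linarith [norm_nonneg (fderiv ℝ F p0), K1.2]
    · linarith [abs_nonneg (F p0), K1.2]
  · intro P hP Q hQ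
    have := (convex_ball p0 R).norm_image_sub_le_of_norm_hasFDerivWithin_le (f := F)
      (f' := fderiv ℝ F) (C := |F p0| + ‖fderiv ℝ F p0‖ + 1 + K1)
      (fun x hx => (hball x hx).1.1.1.differentiableAt.hasFDerivAt.hasFDerivWithinAt)
      (fun x hx => by linarith [(hball x hx).1.2, abs_nonneg (F p0), K1.2]) hQ hP
    exact this
  · intro P hP Q hQ Q0 hQ0 m hm1 hm2
    have hm : 0 ≤ m := dist_nonneg.trans hm1
    have := ((convex_ball p0 R).inter (convex_closedBall Q0 m)).norm_image_sub_le_of_norm_hasFDerivWithin_le' (f := F)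
      (f' := fderiv ℝ F) (φ := fderiv ℝ F Q0) (C := K1 * m)
      (fun x hx => (hball x hx.1).1.1.1.differentiableAt.hasFDerivAt.hasFDerivWithinAt)
      (fun x hx => by
        rw [← dist_eq_norm]
        refine (hK1.dist_le_mul x (hball x hx.1).2 Q0 (hball Q0 hQ0).2).trans ?_
        gcongr
        exact hx.2) ⟨hQ, hm2⟩ ⟨hP, hm1⟩
    rw [Real.norm_eq_abs] at this
    refine this.trans ?_
    gcongr
    linarith [norm_nonneg (fderiv ℝ F p0), abs_nonneg (F p0)]

theorem lin_alg (a b c d K κ u1 u2 : ℝ) (ha : |a| ≤ K) (hb : |b| ≤ K) (hc : |c| ≤ K)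
    (hd : |d| ≤ K) (hJ : κ ≤ |a * d - b * c|) (m : ℝ) (h1 : |a * u1 + b * u2| ≤ m)
    (h2 : |c * u1 + d * u2| ≤ m) : κ * |u1| ≤ 2 * K * m ∧ κ * |u2| ≤ 2 * K * m := by
  have hm : 0 ≤ m := (abs_nonneg _).trans h1
  have hK : 0 ≤ K := (abs_nonneg _).trans ha
  constructor
  · calc κ * |u1| ≤ |a * d - b * c| * |u1| := by gcongr
      _ = |d * (a * u1 + b * u2) - b * (c * u1 + d * u2)| := by rw [← abs_mul]; congr 1; ring
      _ ≤ |d| * |a * u1 + b * u2| + |b| * |c * u1 + d * u2| := by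
        rw [← abs_mul, ← abs_mul]; exact abs_sub _ _
      _ ≤ K * m + K * m := by gcongr
      _ = _ := by ring
  · calc κ * |u2| ≤ |a * d - b * c| * |u2| := by gcongr
      _ = |a * (c * u1 + d * u2) - c * (a * u1 + b * u2)| := by rw [← abs_mul]; congr 1; ring
      _ ≤ |a| * |c * u1 + d * u2| + |c| * |a * u1 + b * u2| := by
        rw [← abs_mul, ← abs_mul]; exact abs_sub _ _
      _ ≤ K * m + K * m := by gcongr
      _ = _ := by ring

theorem mvt_uIcc (g g' : ℝ → ℝ) (a b : ℝ) (h : ∀ t ∈ uIcc a b, HasDerivAt g (g' t) t) :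
    ∃ s ∈ uIcc a b, g b - g a = g' s * (b - a) := by
  rcases lt_trichotomy a b with hab | rfl | hab
  · rw [uIcc_of_le hab.le] at h ⊢
    obtain ⟨c, hc, hc'⟩ := exists_hasDerivAt_eq_slope g g' hab
      (fun t ht => (h t ht).continuousAt.continuousWithinAt)
      (fun t ht => h t (Ioo_subset_Icc_self ht))
    exact ⟨c, Ioo_subset_Icc_self hc, by rw [hc', div_mul_cancel₀ _ (by linarith)]⟩
  · exact ⟨a, by simp, by simp⟩
  · rw [uIcc_of_ge hab.le] at h ⊢
    obtain ⟨c, hc, hc'⟩ := exists_hasDerivAt_eq_slope g g' hab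
      (fun t ht => (h t ht).continuousAt.continuousWithinAt)
      (fun t ht => h t (Ioo_subset_Icc_self ht))
    refine ⟨c, Ioo_subset_Icc_self hc, ?_⟩
    have : a - b ≠ 0 := by linarith
    rw [hc']; field_simp; ring

theorem prod_le_of_slices_symm {X Z : Type*} [MeasurableSpace X] [MeasurableSpace Z]
    (μ : Measure X) [SFinite μ]
    (ζ : Measure Z) [SFinite ζ] (A : Set (X × Z)) (hA : MeasurableSet A) (B : Set Z)
    (hB : MeasurableSet B) (h : ℝ≥0∞) (hAB : ∀ p ∈ A, p.2 ∈ B)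
    (hh : ∀ z ∈ B, μ {p | (p, z) ∈ A} ≤ h) :
    (μ.prod ζ) A ≤ h * ζ B := by
  rw [Measure.prod_apply_symm hA]
  calc ∫⁻ z, μ ((fun x => (x, z)) ⁻¹' A) ∂ζ ≤ ∫⁻ p, B.indicator (fun _ => h) p ∂ζ := by
        refine lintegral_mono fun p => ?_
        by_cases hp : p ∈ B
        · rw [indicator_of_mem hp]; exact hh p hp
        · rw [indicator_of_notMem hp]
          have : (fun x => (x, p)) ⁻¹' A = ∅ := by
            ext z; simp only [mem_preimage, mem_empty_iff_false, iff_false]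
            exact fun hz => hp (hAB _ hz)
          rw [this]; simp
    _ = _ := by rw [lintegral_indicator hB, setLIntegral_const]

abbrev E5 := ℝ × ℝ × ((ℝ × ℝ) × ℝ)

def hV5 (V : E5 → ℝ) (P : E5) : ℝ := fderiv ℝ V P (1, 0, 0)

def J5 (V e : E5 → ℝ) (P : E5) : ℝ :=
  fderiv ℝ (hV5 V) P (0, 0, ((1, 0), 0)) * fderiv ℝ e P (0, 0, ((0, 1), 0)) -
  fderiv ℝ (hV5 V) P (0, 0, ((0, 1), 0)) * fderiv ℝ e P (0, 0, ((1, 0), 0))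

theorem hV5_analytic (V : E5 → ℝ) (b : E5) (h : AnalyticAt ℝ V b) : AnalyticAt ℝ (hV5 V) b :=
  ((ContinuousLinearMap.apply ℝ ℝ ((1, 0, 0) : E5)).analyticAt _).comp h.fderiv

theorem clm_split (L : E5 →L[ℝ] ℝ) (u1 u2 : ℝ) :
    L (0, 0, ((u1, u2), 0)) = L (0, 0, ((1, 0), 0)) * u1 + L (0, 0, ((0, 1), 0)) * u2 := by
  have : ((0, 0, ((u1, u2), 0)) : E5) = u1 • ((0, 0, ((1, 0), 0)) : E5) + u2 • ((0, 0, ((0, 1), 0)) : E5) := by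
    simp
  rw [this, map_add, map_smul, map_smul, smul_eq_mul, smul_eq_mul]; ring

theorem mem_ball5 (b : E5) (R s x y1 x2 y : ℝ) : ((s, x, ((y1, x2), y)) : E5) ∈ Metric.ball b R ↔
    |s - b.1| < R ∧ |x - b.2.1| < R ∧ |y1 - b.2.2.1.1| < R ∧ |x2 - b.2.2.1.2| < R ∧
    |y - b.2.2.2| < R := by
  simp [Metric.mem_ball, Prod.dist_eq, Real.dist_eq, and_assoc]

set_option maxHeartbeats 1600000 in
theorem lemmaD (V e : E5 → ℝ) (u0 v0 : ℝ) (hV : AnalyticAt ℝ V (u0, u0, ((v0, u0), v0)))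
    (he : AnalyticAt ℝ e (u0, u0, ((v0, u0), v0)))
    (hdiag : ∀ᶠ w in nhds ((u0, ((v0, u0), v0)) : ℝ × ((ℝ × ℝ) × ℝ)), V (w.1, w.1, w.2) = w.2.2) :
    ∃ R > 0, ∃ C > 0, ∀ κ : ℝ, 0 < κ → κ ≤ 1 → ∀ ε : ℝ, 0 < ε → ε ≤ κ / C →
      ∀ x x' : ℝ, |x - u0| < R → |x' - u0| < R → |x - x'| ≤ ε → x ≠ x' →
      ∀ (G : ℝ) (hh : ℝ → ℝ → ℝ) (K1 : ℝ), 0 ≤ K1 → ∀ Z : Set ((ℝ × ℝ) × ℝ), MeasurableSet Z →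
      (∀ p ∈ Z, |p.1.1 - v0| < R ∧ |p.1.2 - u0| < R ∧ |p.2 - v0| < R) →
      (∀ p ∈ Z, κ ≤ |J5 V e (x, x, p)|) →
      (∀ p ∈ Z, |G - e (x, x, p) * hh p.2 (V (x', x, p))| ≤ K1 * ε) →
      ENNReal.ofReal |G| * volume Z ≤ ENNReal.ofReal (C * K1 * ε / κ ^ 4) := by
  obtain ⟨R1, hR1, Ka, hKa, ha1, ha2, ha3⟩ := second_order (hV5 V) _ (hV5_analytic V _ hV)
  obtain ⟨R2, hR2, Kb, hKb, hb1, hb2, hb3⟩ := second_order e _ he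
  obtain ⟨R3, hR3, hd⟩ := Metric.eventually_nhds_iff_ball.1 hdiag
  obtain ⟨R4, hR4, hVa⟩ := Metric.eventually_nhds_iff_ball.1 hV.eventually_analyticAt
  obtain ⟨Cp, hCp, planar⟩ := planar_lemma
  set R := min (min R1 R2) (min (min R3 R4) (1/2)) with hR
  have hR0 : 0 < R := by positivity
  have hRR1 : R ≤ R1 := (min_le_left _ _).trans (min_le_left _ _)
  have hRR2 : R ≤ R2 := (min_le_left _ _).trans (min_le_right _ _)
  have hRR3 : R ≤ R3 := (min_le_right _ _).trans ((min_le_left _ _).trans (min_le_left _ _))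
  have hRR4 : R ≤ R4 := (min_le_right _ _).trans ((min_le_left _ _).trans (min_le_right _ _))
  have hRR5 : R ≤ 1/2 := (min_le_right _ _).trans (min_le_right _ _)
  set K := Ka + Kb + 1 with hK
  have hK1 : 1 ≤ K := by linarith
  have hK0 : 0 < K := by linarith
  refine ⟨R, hR0, Cp * (4 * K)^2 * K * (2 * K) * (4*K^2)^2 + 4 * K^2, by positivity, ?_⟩
  intro κ hκ hκ1 ε hε hεκ x x' hx hx' hxx hne G hh K1 hK1' Z hZ hZb hZJ hZG
  have hεκ' : ε ≤ κ / (4 * K^2) := by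
    refine hεκ.trans ?_
    gcongr
    have : 0 ≤ Cp * (4 * K)^2 * K * (2 * K) * (4*K^2)^2 := by positivity
    linarith
  by_cases hG : G = 0
  · simp [hG]
  have hG0 : 0 < |G| := abs_pos.2 hG
  set ρ := κ / (4 * K^2) with hρ
  have hρ0 : 0 < ρ := by positivity
  have hρ1 : ρ ≤ 1 := by
    rw [hρ, div_le_one (by positivity)]; nlinarith
  set lam := 2 * K1 * ε * K / |G| with hlam
  have hmem : ∀ s y1 x2 y : ℝ, |s - u0| < R → |y1 - v0| < R → |x2 - u0| < R → |y - v0| < R →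
      ∀ R' ≥ R, ((s, x, ((y1, x2), y)) : E5) ∈ Metric.ball ((u0, u0, ((v0, u0), v0)) : E5) R' := by
    intro s y1 x2 y h1 h2 h3 h4 R' hR'
    exact Metric.ball_subset_ball hR' ((mem_ball5 _ _ _ _ _ _ _).2 ⟨h1, hx, h2, h3, h4⟩)
  have hseg : ∀ s ∈ uIcc x x', |s - u0| < R ∧ |s - x| ≤ ε := by
    intro s hs
    rw [mem_uIcc] at hs
    rw [abs_lt] at hx hx' ⊢
    rw [abs_le] at hxx ⊢
    rcases hs with hs | hs
    · exact ⟨⟨by linarith, by linarith⟩, by linarith, by linarith⟩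
    · exact ⟨⟨by linarith, by linarith⟩, by linarith, by linarith⟩
  have hderiv : ∀ s y1 x2 y : ℝ, |s - u0| < R → |y1 - v0| < R → |x2 - u0| < R → |y - v0| < R →
      HasDerivAt (fun t => V (t, x, ((y1, x2), y))) (hV5 V (s, x, ((y1, x2), y))) s := by
    intro s y1 x2 y h1 h2 h3 h4
    have hf := (hVa _ (hmem s y1 x2 y h1 h2 h3 h4 R4 hRR4)).differentiableAt.hasFDerivAt
    have hl : HasDerivAt (fun t : ℝ => ((t, x, ((y1, x2), y)) : E5)) (1, 0, 0) s :=
      (hasDerivAt_id s).prodMk (hasDerivAt_const s _)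
    exact hf.comp_hasDerivAt s hl
  have hxd : x' - x ≠ 0 := sub_ne_zero.2 (Ne.symm hne)
  have hVd : ∀ y1 x2 y : ℝ, |y1 - v0| < R → |x2 - u0| < R → |y - v0| < R →
      V (x, x, ((y1, x2), y)) = y := by
    intro y1 x2 y h1 h2 h3
    refine hd (x, ((y1, x2), y)) (Metric.ball_subset_ball hRR3 ?_)
    simp [Metric.mem_ball, Prod.dist_eq, Real.dist_eq]
    exact ⟨hx, ⟨h1, h2⟩, h3⟩
  have hslice : ∀ y ∈ Icc (v0 - R) (v0 + R), volume {p : ℝ × ℝ | (p, y) ∈ Z} ≤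
      ENNReal.ofReal (Cp * (4 * K / κ) ^ 2 * K * lam / ρ ^ 2) := by
    intro y _
    set v : ℝ × ℝ → ℝ := fun p => (V (x', x, (p, y)) - y) / (x' - x) with hv
    refine planar (fun p => (v p, e (x, x, (p, y)))) {p : ℝ × ℝ | (p, y) ∈ Z} (4 * K / κ) K lam ρ
      (v0 - R) (v0 + R) (u0 - R) (u0 + R) (measurable_prodMk_right hZ) ?_ (by positivity) (by positivity)
      (by positivity) hρ0 hρ1 (by linarith) (by linarith) ?_ ?_ ?_ ?_
    · rintro ⟨y1, x2⟩ hp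
      obtain ⟨b1, b2, b3⟩ := hZb _ hp
      apply ContinuousAt.continuousWithinAt
      have c1 : ContinuousAt (fun p : ℝ × ℝ => V (x', x, (p, y))) (y1, x2) :=
        ContinuousAt.comp (g := V) (f := fun p : ℝ × ℝ => ((x', x, (p, y)) : E5))
          (hVa _ (hmem x' y1 x2 y hx' b1 b2 b3 R4 hRR4)).continuousAt (by fun_prop)
      have c2 : ContinuousAt (fun p : ℝ × ℝ => e (x, x, (p, y))) (y1, x2) :=
        ContinuousAt.comp (g := e) (f := fun p : ℝ × ℝ => ((x, x, (p, y)) : E5))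
          (hb1 _ (hmem x y1 x2 y hx b1 b2 b3 R2 hRR2)).1.continuousAt (by fun_prop)
      exact ((c1.sub continuousAt_const).div_const _).prodMk c2
    · rintro ⟨y1, x2⟩ hp
      obtain ⟨b1, b2, b3⟩ := hZb _ hp
      rw [abs_lt] at b1 b2
      simp only [] at b1 b2 ⊢
      exact ⟨⟨by linarith, by linarith⟩, ⟨by linarith, by linarith⟩⟩
    · rintro ⟨y1, x2⟩ hp
      obtain ⟨b1, b2, b3⟩ := hZb _ hp
      obtain ⟨s, hs, hs2⟩ := mvt_uIcc (fun t => V (t, x, ((y1, x2), y)))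
        (fun t => hV5 V (t, x, ((y1, x2), y))) x x'
        (fun t ht => hderiv t y1 x2 y (hseg t ht).1 b1 b2 b3)
      simp only [hVd y1 x2 y b1 b2 b3] at hs2
      simp only [hv]
      rw [hs2, mul_div_cancel_right₀ _ hxd]
      have := (ha1 _ (hmem s y1 x2 y (hseg s hs).1 b1 b2 b3 R1 hRR1)).2.1
      linarith
    · rintro ⟨y1, x2⟩ hp ⟨y1', x2'⟩ hq hpq
      obtain ⟨b1, b2, b3⟩ := hZb _ hp
      obtain ⟨c1, c2, c3⟩ := hZb _ hq
      simp only [] at b1 b2 b3 c1 c2 c3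
      obtain ⟨s, hs, hs2⟩ := mvt_uIcc
        (fun t => V (t, x, ((y1, x2), y)) - V (t, x, ((y1', x2'), y)))
        (fun t => hV5 V (t, x, ((y1, x2), y)) - hV5 V (t, x, ((y1', x2'), y))) x x'
        (fun t ht => (hderiv t y1 x2 y (hseg t ht).1 b1 b2 b3).sub
          (hderiv t y1' x2' y (hseg t ht).1 c1 c2 c3))
      simp only [hVd y1 x2 y b1 b2 b3, hVd y1' x2' y c1 c2 c3] at hs2
      have hvv : v (y1, x2) - v (y1', x2') =
          hV5 V (s, x, ((y1, x2), y)) - hV5 V (s, x, ((y1', x2'), y)) := by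
        simp only [hv]
        rw [← sub_div, div_eq_iff hxd, ← hs2]; ring
      set u := dist ((y1, x2) : ℝ × ℝ) (y1', x2') with hu
      have hu0 : 0 ≤ u := dist_nonneg
      have hsu := hseg s hs
      have hu1 : |y1 - y1'| ≤ u := by
        rw [hu, Prod.dist_eq, ← Real.dist_eq]; exact le_max_left _ _
      have hu2 : |x2 - x2'| ≤ u := by
        rw [hu, Prod.dist_eq, ← Real.dist_eq]; exact le_max_right _ _
      have hum : u = max |y1 - y1'| |x2 - x2'| := by
        rw [hu, Prod.dist_eq, ← Real.dist_eq, ← Real.dist_eq]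
      have nrm : ∀ s : ℝ, ‖((s, x, ((y1, x2), y)) : E5) - (s, x, ((y1', x2'), y))‖ = u := by
        intro s
        rw [hu]
        simp [Prod.norm_def, Prod.dist_eq, Real.dist_eq]
      have dsub : ∀ s : ℝ, ((s, x, ((y1, x2), y)) : E5) - (s, x, ((y1', x2'), y)) =
          (0, 0, ((y1 - y1', x2 - x2'), 0)) := by intro s; simp
      have d1 : dist ((s, x, ((y1, x2), y)) : E5) (x, x, ((y1, x2), y)) ≤ ρ := by
        simp [Prod.dist_eq, Real.dist_eq]
        exact hsu.2.trans hεκ'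
      have d2 : ∀ s, |s - x| ≤ ε → dist ((s, x, ((y1', x2'), y)) : E5) (x, x, ((y1, x2), y)) ≤ ρ := by
        intro s hs
        have h1 : |y1' - y1| ≤ ρ := by rw [abs_sub_comm]; linarith
        have h2 : |x2' - x2| ≤ ρ := by rw [abs_sub_comm]; linarith
        simp [Prod.dist_eq, Real.dist_eq]
        exact ⟨hs.trans hεκ', h1, h2⟩
      set Q0 : E5 := (x, x, ((y1, x2), y)) with hQ0
      have k1 := ha3 _ (hmem s y1 x2 y hsu.1 b1 b2 b3 R1 hRR1) _
        (hmem s y1' x2' y hsu.1 c1 c2 c3 R1 hRR1) Q0 (hmem x y1 x2 y hx b1 b2 b3 R1 hRR1) ρ d1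
        (d2 s hsu.2)
      have k2 := hb3 Q0 (hmem x y1 x2 y hx b1 b2 b3 R2 hRR2) _
        (hmem x y1' x2' y hx c1 c2 c3 R2 hRR2) Q0 (hmem x y1 x2 y hx b1 b2 b3 R2 hRR2) ρ
        (by rw [dist_self]; exact hρ0.le) (d2 x (by simpa using hε.le))
      rw [hQ0, nrm, dsub, clm_split] at k2
      rw [nrm, dsub, clm_split, ← hvv] at k1
      rw [← hQ0] at k2
      set D := dist ((v (y1, x2), e (x, x, ((y1, x2), y))) : ℝ × ℝ)
        (v (y1', x2'), e (x, x, ((y1', x2'), y))) with hD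
      have hD1 : |v (y1, x2) - v (y1', x2')| ≤ D := by
        rw [hD, Prod.dist_eq, ← Real.dist_eq]; exact le_max_left _ _
      have hD2 : |e Q0 - e (x, x, ((y1', x2'), y))| ≤ D := by
        rw [hD, Prod.dist_eq, ← Real.dist_eq]; exact le_max_right _ _
      have hcoef : ∀ (L : E5 →L[ℝ] ℝ) (w : E5), ‖w‖ ≤ 1 → ∀ k, ‖L‖ ≤ k → |L w| ≤ k := by
        intro L w hw k hk
        have := L.le_opNorm w
        rw [Real.norm_eq_abs] at this
        calc |L w| ≤ ‖L‖ * ‖w‖ := this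
          _ ≤ ‖L‖ * 1 := by gcongr
          _ ≤ k := by rwa [mul_one]
      have n1 : ‖((0, 0, ((1, 0), 0)) : E5)‖ ≤ 1 := by simp [Prod.norm_def]
      have n2 : ‖((0, 0, ((0, 1), 0)) : E5)‖ ≤ 1 := by simp [Prod.norm_def]
      have oa := (ha1 Q0 (hmem x y1 x2 y hx b1 b2 b3 R1 hRR1)).2.2
      have ob := (hb1 Q0 (hmem x y1 x2 y hx b1 b2 b3 R2 hRR2)).2.2
      have oa' : ‖fderiv ℝ (hV5 V) Q0‖ ≤ K := by linarith
      have ob' : ‖fderiv ℝ e Q0‖ ≤ K := by linarith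
      have hm1 : |fderiv ℝ (hV5 V) Q0 (0, 0, ((1, 0), 0)) * (y1 - y1') +
          fderiv ℝ (hV5 V) Q0 (0, 0, ((0, 1), 0)) * (x2 - x2')| ≤ D + K * ρ * u := by
        have : Ka * ρ * u ≤ K * ρ * u := by gcongr; linarith
        rw [abs_le] at k1 hD1 ⊢
        constructor <;> linarith [k1.1, k1.2, hD1.1, hD1.2]
      have hm2 : |fderiv ℝ e Q0 (0, 0, ((1, 0), 0)) * (y1 - y1') +
          fderiv ℝ e Q0 (0, 0, ((0, 1), 0)) * (x2 - x2')| ≤ D + K * ρ * u := by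
        have : Kb * ρ * u ≤ K * ρ * u := by gcongr; linarith
        rw [abs_le] at k2 hD2 ⊢
        constructor <;> linarith [k2.1, k2.2, hD2.1, hD2.2]
      obtain ⟨f1, f2⟩ := lin_alg _ _ _ _ K κ _ _ (hcoef _ _ n1 K oa') (hcoef _ _ n2 K oa')
        (hcoef _ _ n1 K ob') (hcoef _ _ n2 K ob') (hZJ _ hp) _ hm1 hm2
      have f3 : κ * u ≤ 2 * K * (D + K * ρ * u) := by
        rcases max_cases |y1 - y1'| |x2 - x2'| with h | h
        · rw [← h.1, ← hum] at f1; exact f1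
        · rw [← h.1, ← hum] at f2; exact f2
      have f4 : 2 * K * (K * ρ * u) = κ / 2 * u := by rw [hρ]; field_simp; ring
      have f5 : κ * u ≤ 4 * K * D := by nlinarith
      rw [div_mul_eq_mul_div, le_div_iff₀ hκ]
      linarith
    · rintro ⟨y1, x2⟩ hp ⟨y1', x2'⟩ hq hpq
      obtain ⟨b1, b2, b3⟩ := hZb _ hp
      obtain ⟨c1, c2, c3⟩ := hZb _ hq
      simp only [] at b1 b2 b3 c1 c2 c3
      have hVV : V (x', x, ((y1, x2), y)) = V (x', x, ((y1', x2'), y)) := by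
        simp only [hv] at hpq
        rw [div_left_inj' hxd] at hpq
        linarith
      have g1 := hZG _ hp
      have g2 := hZG _ hq
      simp only [hVV] at g1 g2
      set H := hh y (V (x', x, ((y1', x2'), y)))
      have e1 := (hb1 _ (hmem x y1 x2 y hx b1 b2 b3 R2 hRR2)).2.1
      have e2 := (hb1 _ (hmem x y1' x2' y hx c1 c2 c3 R2 hRR2)).2.1
      set ep := e (x, x, ((y1, x2), y))
      set eq := e (x, x, ((y1', x2'), y))
      show |ep - eq| ≤ lam
      rw [hlam, le_div_iff₀ hG0]
      calc |ep - eq| * |G| = |ep * (G - eq * H) - eq * (G - ep * H)| := by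
            rw [← abs_mul]; congr 1; ring
        _ ≤ |ep| * |G - eq * H| + |eq| * |G - ep * H| := by
            rw [← abs_mul, ← abs_mul]; exact abs_sub _ _
        _ ≤ K * (K1 * ε) + K * (K1 * ε) := by
            gcongr <;> linarith
        _ = _ := by ring
  have hvol : volume Z ≤ ENNReal.ofReal (Cp * (4 * K / κ) ^ 2 * K * lam / ρ ^ 2) *
      volume (Icc (v0 - R) (v0 + R)) := by
    refine prod_le_of_slices_symm volume volume Z hZ _ measurableSet_Icc _ ?_ hslice
    intro p hp
    have := abs_lt.1 (hZb p hp).2.2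
    exact ⟨by linarith, by linarith⟩
  calc ENNReal.ofReal |G| * volume Z ≤
      ENNReal.ofReal |G| * (ENNReal.ofReal (Cp * (4 * K / κ) ^ 2 * K * lam / ρ ^ 2) * 1) := by
        gcongr
        refine hvol.trans ?_
        gcongr
        rw [Real.volume_Icc, ENNReal.ofReal_le_one]
        linarith
    _ = ENNReal.ofReal (Cp * (4 * K)^2 * K * (2 * K) * (4*K^2)^2 * K1 * ε / κ ^ 4) := by
      rw [mul_one, ← ENNReal.ofReal_mul hG0.le]
      congr 1
      rw [hlam, hρ]
      field_simp
    _ ≤ _ := by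
      apply ENNReal.ofReal_le_ofReal
      gcongr
      have : 0 ≤ 4 * K^2 := by positivity
      linarith

/-- open box -/
def bx (a b R : ℝ) : Set (ℝ × ℝ) := {p | |p.1 - a| < R ∧ |p.2 - b| < R}

theorem bx_eq (a b R : ℝ) : bx a b R = Metric.ball (a, b) R := by
  ext p
  simp [bx, Metric.mem_ball, Prod.dist_eq, Real.dist_eq]

structure LocData (η ξ φh αh : ℝ × ℝ → ℝ) (u0 v0 w0 R K : ℝ) : Prop where
  Rpos : 0 < R
  Rle : R ≤ 1 / 4
  K1 : 1 ≤ K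
  inv1 : ∀ x z, |x - u0| < R → |z - w0| < R → ξ (η (x, z), z) = x
  inv2 : ∀ y z, |y - v0| < R → |z - w0| < R → η (ξ (y, z), z) = y
  inv3 : ∀ x z, |x - u0| < R → |z - w0| < R → φh (x, η (x, z)) = z
  inv4 : ∀ x y, |x - u0| < R → |y - v0| < R → η (x, φh (x, y)) = y
  lipη : ∀ p ∈ bx u0 w0 R, ∀ q ∈ bx u0 w0 R, |η p - η q| ≤ K * dist p q
  lipξ : ∀ p ∈ bx v0 w0 R, ∀ q ∈ bx v0 w0 R, |ξ p - ξ q| ≤ K * dist p q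
  lipφ : ∀ p ∈ bx u0 v0 R, ∀ q ∈ bx u0 v0 R, |φh p - φh q| ≤ K * dist p q
  αup : ∀ p ∈ bx u0 w0 R, |αh p| ≤ K
  αlow : ∀ p ∈ bx u0 w0 R, 1 ≤ K * |αh p|

theorem bx_mono (a b : ℝ) {R R' : ℝ} (h : R ≤ R') : bx a b R ⊆ bx a b R' :=
  fun _ hp => ⟨hp.1.trans_le h, hp.2.trans_le h⟩

theorem exists_locData (η ξ φh αh : ℝ × ℝ → ℝ) (u0 v0 w0 : ℝ)
    (hη : AnalyticAt ℝ η (u0, w0)) (hξ : AnalyticAt ℝ ξ (v0, w0)) (hφ : AnalyticAt ℝ φh (u0, v0))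
    (hα : AnalyticAt ℝ αh (u0, w0)) (hα0 : αh (u0, w0) ≠ 0)
    (h1 : ∀ᶠ p in nhds (u0, w0), ξ (η p, p.2) = p.1)
    (h2 : ∀ᶠ p in nhds (v0, w0), η (ξ p, p.2) = p.1)
    (h3 : ∀ᶠ p in nhds (u0, w0), φh (p.1, η p) = p.2)
    (h4 : ∀ᶠ p in nhds (u0, v0), η (p.1, φh p) = p.2) :
    ∃ R1 > 0, ∃ K, ∀ R, 0 < R → R ≤ R1 → LocData η ξ φh αh u0 v0 w0 R K := by
  obtain ⟨Ra, hRa, Ka, hKa, -, la, -⟩ := second_order η _ hη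
  obtain ⟨Rb, hRb, Kb, hKb, -, lb, -⟩ := second_order ξ _ hξ
  obtain ⟨Rc, hRc, Kc, hKc, -, lc, -⟩ := second_order φh _ hφ
  have h5 : ∀ᶠ p in nhds (u0, w0), |αh p| < |αh (u0, w0)| + 1 :=
    hα.continuousAt.abs.eventually_lt_const (by linarith)
  have h6 : ∀ᶠ p in nhds (u0, w0), |αh (u0, w0)| / 2 < |αh p| :=
    hα.continuousAt.abs.eventually_const_lt (by
      have := abs_pos.2 hα0
      linarith)
  obtain ⟨Rd, hRd, hd⟩ := Metric.eventually_nhds_iff_ball.1 ((h1.and h3).and (h5.and h6))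
  obtain ⟨Re, hRe, he⟩ := Metric.eventually_nhds_iff_ball.1 h2
  obtain ⟨Rf, hRf, hf⟩ := Metric.eventually_nhds_iff_ball.1 h4
  simp only [← bx_eq] at la lb lc hd he hf
  have hα0' := abs_pos.2 hα0
  refine ⟨min (min (min Ra Rb) (min Rc Rd)) (min (min Re Rf) (1/4)), by positivity,
    Ka + Kb + Kc + (|αh (u0, w0)| + 1) + 2 / |αh (u0, w0)|, fun R hR hRle => ?_⟩
  simp only [le_min_iff] at hRle
  obtain ⟨⟨⟨ra, rb⟩, rc, rd⟩, ⟨re, rf⟩, r4⟩ := hRle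
  have hq : 0 < 2 / |αh (u0, w0)| := by positivity
  refine ⟨hR, r4, ?_, ?_, ?_, ?_, ?_, ?_, ?_, ?_, ?_, ?_⟩
  · linarith
  · intro x z hx hz
    exact (hd (x, z) (bx_mono _ _ rd ⟨hx, hz⟩)).1.1
  · intro x z hx hz
    exact (he (x, z) (bx_mono _ _ re ⟨hx, hz⟩))
  · intro x z hx hz
    exact (hd (x, z) (bx_mono _ _ rd ⟨hx, hz⟩)).1.2
  · intro x z hx hz
    exact (hf (x, z) (bx_mono _ _ rf ⟨hx, hz⟩))
  · intro p hp q hq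
    refine (la p (bx_mono _ _ ra hp) q (bx_mono _ _ ra hq)).trans ?_
    rw [← dist_eq_norm]; gcongr; linarith
  · intro p hp q hq
    refine (lb p (bx_mono _ _ rb hp) q (bx_mono _ _ rb hq)).trans ?_
    rw [← dist_eq_norm]; gcongr; linarith
  · intro p hp q hq
    refine (lc p (bx_mono _ _ rc hp) q (bx_mono _ _ rc hq)).trans ?_
    rw [← dist_eq_norm]; gcongr; linarith
  · intro p hp
    have := (hd p (bx_mono _ _ rd hp)).2.1
    linarith
  · intro p hp
    have := (hd p (bx_mono _ _ rd hp)).2.2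
    have h7 : 1 ≤ 2 / |αh (u0, w0)| * |αh p| := by
      rw [div_mul_eq_mul_div, le_div_iff₀ hα0']; linarith
    refine h7.trans ?_
    gcongr
    linarith

theorem measurable_ext (g : ℝ × ℝ → ℝ) (a b R K : ℝ)
    (hg : ∀ p ∈ bx a b R, ∀ q ∈ bx a b R, |g p - g q| ≤ K * dist p q) :
    ∃ g' : ℝ × ℝ → ℝ, Measurable g' ∧ ∀ p ∈ bx a b R, g' p = g p := by
  classical
  have hm : MeasurableSet (bx a b R) := by rw [bx_eq]; exact measurableSet_ball
  have hc : ContinuousOn g (bx a b R) := by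
    have : LipschitzOnWith (Real.toNNReal K) g (bx a b R) := by
      apply LipschitzOnWith.of_dist_le_mul
      intro p hp q hq
      rw [Real.dist_eq]
      refine (hg p hp q hq).trans ?_
      gcongr
      exact Real.le_coe_toNNReal K
    exact this.continuousOn
  refine ⟨(bx a b R).piecewise g (fun _ => 0), ?_, fun p hp => piecewise_eq_of_mem _ _ _ hp⟩
  exact hc.measurable_piecewise continuousOn_const hm

theorem strip_volume (a r t : ℝ) (hr : 0 ≤ r) (ht : 0 ≤ t) :
    volume {p : ℝ × ℝ | |p.1 - a| ≤ r ∧ |p.1 - p.2| ≤ t} ≤ ENNReal.ofReal (4 * r * t) := by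
  have hm : MeasurableSet {p : ℝ × ℝ | |p.1 - a| ≤ r ∧ |p.1 - p.2| ≤ t} := by
    apply IsClosed.measurableSet
    apply IsClosed.inter
    · exact isClosed_le (f := fun p : ℝ × ℝ => |p.1 - a|) (g := fun _ => r) (by fun_prop) continuous_const
    · exact isClosed_le (f := fun p : ℝ × ℝ => |p.1 - p.2|) (g := fun _ => t) (by fun_prop) continuous_const
  refine (prod_le_of_slices volume volume _ hm (Icc (a - r) (a + r)) measurableSet_Icc
    (ENNReal.ofReal (2 * t)) ?_ ?_).trans ?_
  · intro p hp
    have := abs_le.1 hp.1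
    exact ⟨by linarith, by linarith⟩
  · intro x _
    calc _ ≤ volume (Icc (x - t) (x + t)) := by
          refine measure_mono fun x' hx' => ?_
          have := abs_le.1 hx'.2
          simp only [] at this
          exact ⟨by linarith, by linarith⟩
      _ = _ := by rw [Real.volume_Icc]; congr 1; ring
  · rw [Real.volume_Icc, ← ENNReal.ofReal_mul (by positivity)]
    apply ENNReal.ofReal_le_ofReal
    apply le_of_eq; ring

/-- fibrewise volume transport bound -/
theorem transport_bound (η ξ φh αh : ℝ × ℝ → ℝ) (u0 v0 w0 R K : ℝ)
    (D : LocData η ξ φh αh u0 v0 w0 R K) :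
    ∃ C : ℝ, 0 < C ∧ ∀ (Φ Ξ : (ℝ × ℝ) × ℝ → ℝ × ℝ), Measurable Φ → Measurable Ξ →
      (∀ x x' z, |x - u0| < R → |x' - u0| < R → |z - w0| < R →
        Φ ((x, x'), z) = (η (x, z), η (x', z))) →
      (∀ y y' z, |y - v0| < R → |y' - v0| < R → |z - w0| < R →
        Ξ ((y, y'), z) = (ξ (y, z), ξ (y', z))) →
      ∀ A : Set ((ℝ × ℝ) × ℝ), MeasurableSet A →
      (∀ p ∈ A, |p.1.1 - u0| < R ∧ |p.1.2 - u0| < R ∧ |p.2 - w0| < R ∧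
        |η (p.1.1, p.2) - v0| < R ∧ |η (p.1.2, p.2) - v0| < R) →
      volume A ≤ ENNReal.ofReal C *
        volume {q : (ℝ × ℝ) × ℝ | (Ξ q, q.2) ∈ A ∧ Φ (Ξ q, q.2) = q.1} := by
  obtain ⟨C, hC, hanti⟩ := antilip_measure (E := ℝ × ℝ) (F := ℝ × ℝ) volume volume rfl
  have hK := D.K1
  refine ⟨C * K ^ (Module.finrank ℝ (ℝ × ℝ)), by positivity, ?_⟩
  intro Φ Ξ mΦ mΞ hΦ hΞ A hA hAb
  have hB : MeasurableSet {q : (ℝ × ℝ) × ℝ | (Ξ q, q.2) ∈ A ∧ Φ (Ξ q, q.2) = q.1} := by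
    have m1 : Measurable fun q : (ℝ × ℝ) × ℝ => (Ξ q, q.2) := mΞ.prodMk measurable_snd
    exact (m1 hA).inter (measurableSet_eq_fun (mΦ.comp m1) measurable_fst)
  change (volume.prod volume) A ≤ _ * (volume.prod volume) _
  rw [Measure.prod_apply_symm hA, Measure.prod_apply_symm hB,
    ← lintegral_const_mul _ (measurable_measure_prodMk_right hB)]
  apply lintegral_mono
  intro z
  refine (hanti K (fun p => Φ (p, z)) _ (by linarith) ?_).trans ?_
  · rintro ⟨x, x'⟩ hp ⟨t, t'⟩ hq
    obtain ⟨h1, h2, h3, h4, h5⟩ := hAb _ hp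
    obtain ⟨g1, g2, g3, g4, g5⟩ := hAb _ hq
    simp only at h1 h2 h3 h4 h5 g1 g2 g3 g4 g5
    simp only [hΦ x x' z h1 h2 h3, hΦ t t' z g1 g2 g3]
    have e1 := D.lipξ (η (x, z), z) ⟨h4, h3⟩ (η (t, z), z) ⟨g4, h3⟩
    have e2 := D.lipξ (η (x', z), z) ⟨h5, h3⟩ (η (t', z), z) ⟨g5, h3⟩
    rw [D.inv1 _ _ h1 h3, D.inv1 _ _ g1 h3] at e1
    rw [D.inv1 _ _ h2 h3, D.inv1 _ _ g2 h3] at e2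
    simp only [Prod.dist_eq, Real.dist_eq, sub_self, abs_zero] at e1 e2 ⊢
    rw [max_eq_left (abs_nonneg _)] at e1 e2
    refine max_le (e1.trans ?_) (e2.trans ?_)
    · gcongr; exact le_max_left _ _
    · gcongr; exact le_max_right _ _
  · refine mul_le_mul_right (measure_mono ?_) _
    rintro _ ⟨⟨x, x'⟩, hp, rfl⟩
    obtain ⟨h1, h2, h3, h4, h5⟩ := hAb _ hp
    simp only at h1 h2 h3 h4 h5
    have : Ξ (Φ ((x, x'), z), z) = (x, x') := by
      rw [hΦ x x' z h1 h2 h3, hΞ _ _ z h4 h5 h3, D.inv1 _ _ h1 h3, D.inv1 _ _ h2 h3]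
    simp only [mem_preimage, mem_ofPred_eq, this, and_true]
    exact hp

theorem path_change (η ξ φh αh : ℝ × ℝ → ℝ) (u0 v0 w0 R K : ℝ)
    (D : LocData η ξ φh αh u0 v0 w0 R K) (φt : ℝ × ℝ → ℝ) (mφ : Measurable φt)
    (hφt : ∀ p ∈ bx u0 v0 R, φt p = φh p) :
    ∃ C : ℝ, 0 < C ∧ ∀ x, |x - u0| < R → ∀ Zz : Set ((ℝ × ℝ) × ℝ), MeasurableSet Zz →
      (∀ z ∈ Zz, ∃ y1 x2 y, |y1 - v0| < R ∧ |x2 - u0| < R ∧ |y - v0| < R ∧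
        φh (x, y1) = z.1.1 ∧ φh (x2, y1) = z.1.2 ∧ φh (x2, y) = z.2) →
      ∃ Z : Set ((ℝ × ℝ) × ℝ), MeasurableSet Z ∧ volume Zz ≤ ENNReal.ofReal C * volume Z ∧
        ∀ q ∈ Z, |q.1.1 - v0| < R ∧ |q.1.2 - u0| < R ∧ |q.2 - v0| < R ∧
          ((φh (x, q.1.1), φh (q.1.2, q.1.1)), φh (q.1.2, q.2)) ∈ Zz := by
  have : (volume : Measure ((ℝ × ℝ) × ℝ)).IsAddHaarMeasure := Measure.prod.instIsAddHaarMeasure _ _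
  obtain ⟨C, hC, hlip⟩ := lip_measure (E := (ℝ × ℝ) × ℝ) (F := (ℝ × ℝ) × ℝ) volume volume rfl
  have hK := D.K1
  refine ⟨C * (Real.toNNReal K : ℝ) ^ (Module.finrank ℝ ((ℝ × ℝ) × ℝ)), ?_, ?_⟩
  · have : (0:ℝ) < Real.toNNReal K := by
      rw [Real.coe_toNNReal K (by linarith)]; linarith
    positivity
  intro x hx Zz hZ hcov
  set A : (ℝ × ℝ) × ℝ → (ℝ × ℝ) × ℝ := fun q =>
    ((φt (x, q.1.1), φt (q.1.2, q.1.1)), φt (q.1.2, q.2)) with hA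
  have mA : Measurable A := by fun_prop
  set Bq : Set ((ℝ × ℝ) × ℝ) := {q | |q.1.1 - v0| < R ∧ |q.1.2 - u0| < R ∧ |q.2 - v0| < R} with hBq
  have mB : MeasurableSet Bq := by
    have e1 : MeasurableSet {q : (ℝ × ℝ) × ℝ | |q.1.1 - v0| < R} :=
      (isOpen_lt (by fun_prop) continuous_const).measurableSet
    have e2 : MeasurableSet {q : (ℝ × ℝ) × ℝ | |q.1.2 - u0| < R} :=
      (isOpen_lt (by fun_prop) continuous_const).measurableSet
    have e3 : MeasurableSet {q : (ℝ × ℝ) × ℝ | |q.2 - v0| < R} :=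
      (isOpen_lt (by fun_prop) continuous_const).measurableSet
    exact e1.inter (e2.inter e3)
  have hAq : ∀ q ∈ Bq, A q = ((φh (x, q.1.1), φh (q.1.2, q.1.1)), φh (q.1.2, q.2)) := by
    rintro q ⟨h1, h2, h3⟩
    simp only [hA]
    rw [hφt (x, q.1.1) ⟨hx, h1⟩, hφt (q.1.2, q.1.1) ⟨h2, h1⟩, hφt (q.1.2, q.2) ⟨h2, h3⟩]
  refine ⟨Bq ∩ A ⁻¹' Zz, mB.inter (mA hZ), ?_, ?_⟩
  · refine le_trans (measure_mono ?_) (hlip (Real.toNNReal K) A (Bq ∩ A ⁻¹' Zz) ?_)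
    · intro z hz
      obtain ⟨y1, x2, y, h1, h2, h3, e1, e2, e3⟩ := hcov z hz
      have hq : ((y1, x2), y) ∈ Bq := ⟨h1, h2, h3⟩
      have : A ((y1, x2), y) = z := by
        rw [hAq _ hq]; simp only [e1, e2, e3]
      exact ⟨_, ⟨hq, by rw [mem_preimage, this]; exact hz⟩, this⟩
    · apply LipschitzOnWith.of_dist_le_mul
      rintro p ⟨hp, -⟩ q ⟨hq, -⟩
      rw [hAq p hp, hAq q hq, Real.coe_toNNReal K (by linarith)]
      obtain ⟨h1, h2, h3⟩ := hp
      obtain ⟨g1, g2, g3⟩ := hq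
      have e1 := D.lipφ (x, p.1.1) ⟨hx, h1⟩ (x, q.1.1) ⟨hx, g1⟩
      have e2 := D.lipφ (p.1.2, p.1.1) ⟨h2, h1⟩ (q.1.2, q.1.1) ⟨g2, g1⟩
      have e3 := D.lipφ (p.1.2, p.2) ⟨h2, h3⟩ (q.1.2, q.2) ⟨g2, g3⟩
      simp only [Prod.dist_eq, Real.dist_eq, sub_self, abs_zero] at e1 e2 e3 ⊢
      refine max_le (max_le (e1.trans ?_) (e2.trans ?_)) (e3.trans ?_)
      all_goals
        refine mul_le_mul_of_nonneg_left ?_ (by linarith)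
        have := abs_nonneg (p.1.1 - q.1.1)
        refine max_le ?_ ?_ <;> grind
  · rintro q ⟨hq, hq2⟩
    refine ⟨hq.1, hq.2.1, hq.2.2, ?_⟩
    rw [← hAq q hq]; exact hq2

theorem model_path (η ξ φh αh : ℝ × ℝ → ℝ) (u0 v0 w0 R K r : ℝ)
    (D : LocData η ξ φh αh u0 v0 w0 R K) (hr : 0 < r) (hrR : r ≤ R / 2)
    (hηr : ∀ x z, |x - u0| ≤ r → |z - w0| ≤ r → |η (x, z) - v0| < R) :
    ∃ c1 : ℝ, 0 < c1 ∧ c1 ≤ 1 ∧ ∀ ε : ℝ, 0 < ε → ε ≤ 1 → ∀ T1 : Set (ℝ × ℝ), MeasurableSet T1 →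
      (∀ p ∈ T1, |p.1 - u0| ≤ r ∧ |p.2 - w0| ≤ r) → ∀ d : ℝ, 0 < d →
      ENNReal.ofReal d ≤ volume T1 →
      ∃ P : Set (ℝ × ℝ), MeasurableSet P ∧ ENNReal.ofReal (c1 * ε * d ^ 2) ≤ volume P ∧
      ∀ x x', (x, x') ∈ P → |x - u0| ≤ r ∧ |x' - u0| ≤ r ∧ ⌊x / ε⌋ = ⌊x' / ε⌋ ∧
        (∃ z, (x, z) ∈ T1) ∧ (∃ z, (x', z) ∈ T1) ∧
        ∃ Z : Set ((ℝ × ℝ) × ℝ), MeasurableSet Z ∧ ENNReal.ofReal (c1 * d ^ 6) ≤ volume Z ∧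
        ∀ y1 x2 y, ((y1, x2), y) ∈ Z → |y1 - v0| < R ∧ |x2 - u0| < R ∧ |y - v0| < R ∧
          ∀ z1 z2 z3 y1' x2', z1 = φh (x, y1) → z2 = φh (x2, y1) → z3 = φh (x2, y) →
          y1' = η (x', z1) → x2' = ξ (y1', z2) →
          (x, z1) ∈ T1 ∧ (x', z1) ∈ T1 ∧ (x2, z2) ∈ T1 ∧ (x2', z2) ∈ T1 ∧ (x2, z3) ∈ T1 ∧
          (x2', z3) ∈ T1 ∧ ⌊x2 / ε⌋ = ⌊x2' / ε⌋ ∧ η (x2', z2) = y1' := by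
  have hK := D.K1
  have hR := D.Rpos
  have hR4 := D.Rle
  obtain ⟨Ct, hCt, htr⟩ := transport_bound η ξ φh αh u0 v0 w0 R K D
  obtain ⟨ηt, mη, hηt⟩ := measurable_ext η u0 w0 R K D.lipη
  obtain ⟨ξt, mξ, hξt⟩ := measurable_ext ξ v0 w0 R K D.lipξ
  obtain ⟨φt, mφ, hφt⟩ := measurable_ext φh u0 v0 R K D.lipφ
  obtain ⟨Cp, hCp, hpc⟩ := path_change η ξ φh αh u0 v0 w0 R K D φt mφ hφt
  set c : ℝ := 1 / (24 * (2 + Ct * K)) with hc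
  have hCtK : 0 < Ct * K := by positivity
  have hc0 : 0 < c := by positivity
  refine ⟨min (1 / 24) (c ^ 3 / Cp), by positivity, (min_le_left _ _).trans (by norm_num), ?_⟩
  intro ε hε hε1 T1 mT hT d hd hdT
  -- the edge set
  set E : Set ((ℝ × ℝ) × ℝ) := {p | (p.1.1, p.2) ∈ T1 ∧ (p.1.2, p.2) ∈ T1 ∧
    ⌊p.1.1 / ε⌋ = ⌊p.1.2 / ε⌋} with hEdef
  have mE : MeasurableSet E := by
    have m1 : Measurable fun p : (ℝ × ℝ) × ℝ => (p.1.1, p.2) := by fun_prop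
    have m2 : Measurable fun p : (ℝ × ℝ) × ℝ => (p.1.2, p.2) := by fun_prop
    refine (m1 mT).inter ((m2 mT).inter ?_)
    exact measurableSet_eq_fun ((measurable_cell ε).comp (measurable_fst.comp measurable_fst))
      ((measurable_cell ε).comp (measurable_snd.comp measurable_fst))
  have vZ0 : volume (Icc (w0 - r) (w0 + r)) ≤ 1 := by
    rw [Real.volume_Icc, ← ENNReal.ofReal_one]
    exact ENNReal.ofReal_le_ofReal (by linarith)
  have hEvol : ENNReal.ofReal (ε * d ^ 2 / 12) ≤ volume E := by
    have := cell_two ε hε hε1 (u0 - r) (u0 + r) (by linarith) (Icc (w0 - r) (w0 + r))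
      measurableSet_Icc T1 mT (fun p hp => by
        have := abs_le.1 (hT p hp).1
        exact ⟨by linarith, by linarith⟩) (fun p hp => by
        have := abs_le.1 (hT p hp).2
        exact ⟨by linarith, by linarith⟩) (ENNReal.ofReal (ε * d / 6))
    have h1 : ENNReal.ofReal (ε * d ^ 2 / 6) ≤ ENNReal.ofReal (ε * d / 6) * volume T1 := by
      calc _ = ENNReal.ofReal (ε * d / 6) * ENNReal.ofReal d := by
            rw [← ENNReal.ofReal_mul (by positivity)]; congr 1; ring
        _ ≤ _ := by gcongr
    have h2 : ENNReal.ofReal (ε * d / 6) * (ENNReal.ofReal (3 / ε) * ENNReal.ofReal (ε * d / 6)) *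
        volume (Icc (w0 - r) (w0 + r)) ≤ ENNReal.ofReal (ε * d ^ 2 / 12) := by
      calc _ ≤ ENNReal.ofReal (ε * d / 6) * (ENNReal.ofReal (3 / ε) * ENNReal.ofReal (ε * d / 6)) * 1 := by
            gcongr
        _ = _ := by
            rw [mul_one, ← ENNReal.ofReal_mul (by positivity), ← ENNReal.ofReal_mul (by positivity)]
            congr 1; field_simp; ring
    have h3 : ENNReal.ofReal (ε * d ^ 2 / 6) =
        ENNReal.ofReal (ε * d ^ 2 / 12) + ENNReal.ofReal (ε * d ^ 2 / 12) := by
      rw [← ENNReal.ofReal_add (by positivity) (by positivity)]; congr 1; ring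
    have h4 := h1.trans (this.trans (add_le_add_left h2 _))
    rw [h3] at h4
    exact (ENNReal.add_le_add_iff_left ENNReal.ofReal_ne_top).1 h4
  set Φ : (ℝ × ℝ) × ℝ → ℝ × ℝ := fun p => (ηt (p.1.1, p.2), ηt (p.1.2, p.2)) with hΦ
  set Ξ : (ℝ × ℝ) × ℝ → ℝ × ℝ := fun p => (ξt (p.1.1, p.2), ξt (p.1.2, p.2)) with hΞ
  have mΦ : Measurable Φ := by fun_prop
  have mΞ : Measurable Ξ := by fun_prop
  have eΦ : ∀ x x' z, |x - u0| < R → |x' - u0| < R → |z - w0| < R →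
      Φ ((x, x'), z) = (η (x, z), η (x', z)) := by
    intro x x' z h1 h2 h3
    simp only [hΦ]
    rw [hηt (x, z) ⟨h1, h3⟩, hηt (x', z) ⟨h2, h3⟩]
  have eΞ : ∀ y y' z, |y - v0| < R → |y' - v0| < R → |z - w0| < R →
      Ξ ((y, y'), z) = (ξ (y, z), ξ (y', z)) := by
    intro x x' z h1 h2 h3
    simp only [hΞ]
    rw [hξt (x, z) ⟨h1, h3⟩, hξt (x', z) ⟨h2, h3⟩]
  have hEb : ∀ p ∈ E, |p.1.1 - u0| < R ∧ |p.1.2 - u0| < R ∧ |p.2 - w0| < R ∧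
        |η (p.1.1, p.2) - v0| < R ∧ |η (p.1.2, p.2) - v0| < R := by
    rintro p ⟨h1, h2, -⟩
    have a1 := hT _ h1
    have a2 := hT _ h2
    simp only at a1 a2
    exact ⟨by linarith, by linarith, by linarith, hηr _ _ a1.1 a1.2, hηr _ _ a2.1 a2.2⟩
  obtain ⟨P, hPX, mP, hPvol, hPath⟩ := path_lemma E mE Φ Ξ mΦ mΞ
    {p : ℝ × ℝ | |p.1 - u0| ≤ r ∧ |p.1 - p.2| ≤ ε}
    {p : ℝ × ℝ | |p.1 - v0| ≤ R ∧ |p.1 - p.2| ≤ K * ε} (Icc (w0 - r) (w0 + r))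
    (by
      refine MeasurableSet.inter (measurableSet_le (f := fun p : ℝ × ℝ => |p.1 - u0|) (g := fun _ => r) ?_ ?_)
        (measurableSet_le (f := fun p : ℝ × ℝ => |p.1 - p.2|) (g := fun _ => ε) ?_ ?_) <;> fun_prop)
    (by
      refine MeasurableSet.inter (measurableSet_le (f := fun p : ℝ × ℝ => |p.1 - v0|) (g := fun _ => R) ?_ ?_)
        (measurableSet_le (f := fun p : ℝ × ℝ => |p.1 - p.2|) (g := fun _ => K * ε) ?_ ?_) <;> fun_prop)
    (by
      rintro p ⟨h1, h2, h3⟩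
      exact ⟨(hT _ h1).1, same_cell_dist ε hε _ _ h3⟩)
    (by
      rintro p hp
      obtain ⟨a1, a2, a3, a4, a5⟩ := hEb p hp
      have : Φ p = (η (p.1.1, p.2), η (p.1.2, p.2)) := eΦ p.1.1 p.1.2 p.2 a1 a2 a3
      rw [this]
      refine ⟨a4.le, ?_⟩
      refine (D.lipη (p.1.1, p.2) ⟨a1, a3⟩ (p.1.2, p.2) ⟨a2, a3⟩).trans ?_
      refine mul_le_mul_of_nonneg_left ?_ (by linarith)
      have := same_cell_dist ε hε _ _ hp.2.2
      simp only [Prod.dist_eq, Real.dist_eq, sub_self, abs_zero]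
      exact max_le this hε.le)
    (by
      rintro p ⟨h1, h2, h3⟩
      have := abs_le.1 (hT _ h1).2
      simp only at this
      exact ⟨by linarith, by linarith⟩)
    (ENNReal.ofReal Ct) (ENNReal.ofReal (c * d ^ 2))
    (fun A hA mA => htr Φ Ξ mΦ mΞ eΦ eΞ A mA (fun p hp => hEb p (hA hp)))
  refine ⟨P, mP, ?_, ?_⟩
  · have vX : volume {p : ℝ × ℝ | |p.1 - u0| ≤ r ∧ |p.1 - p.2| ≤ ε} ≤ ENNReal.ofReal ε :=
      (strip_volume u0 r ε hr.le hε.le).trans (ENNReal.ofReal_le_ofReal (by nlinarith))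
    have vY : volume {p : ℝ × ℝ | |p.1 - v0| ≤ R ∧ |p.1 - p.2| ≤ K * ε} ≤ ENNReal.ofReal (K * ε) :=
      (strip_volume v0 R (K * ε) hR.le (by positivity)).trans (ENNReal.ofReal_le_ofReal (by
        have : 0 < K * ε := by positivity
        nlinarith))
    have h1 : volume E ≤ ENNReal.ofReal (ε * d ^ 2 / 24) + volume P := by
      refine hPvol.trans ?_
      calc _ ≤ ENNReal.ofReal (c * d ^ 2) * ENNReal.ofReal ε +
            ENNReal.ofReal Ct * (ENNReal.ofReal (c * d ^ 2) * ENNReal.ofReal (K * ε)) +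
            ENNReal.ofReal (c * d ^ 2) * ENNReal.ofReal ε + 1 * volume P := by gcongr
        _ = _ := by
            rw [one_mul, ← ENNReal.ofReal_mul (by positivity), ← ENNReal.ofReal_mul (by positivity),
              ← ENNReal.ofReal_mul (by positivity), ← ENNReal.ofReal_add (by positivity) (by positivity),
              ← ENNReal.ofReal_add (by positivity) (by positivity)]
            congr 2
            rw [hc]; field_simp; ring
    have h3 : ENNReal.ofReal (ε * d ^ 2 / 12) =
        ENNReal.ofReal (ε * d ^ 2 / 24) + ENNReal.ofReal (ε * d ^ 2 / 24) := by
      rw [← ENNReal.ofReal_add (by positivity) (by positivity)]; congr 1; ring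
    have h4 := hEvol.trans h1
    rw [h3] at h4
    have h5 := (ENNReal.add_le_add_iff_left ENNReal.ofReal_ne_top).1 h4
    refine le_trans (ENNReal.ofReal_le_ofReal ?_) h5
    have : min (1 / 24) (c ^ 3 / Cp) ≤ 1 / 24 := min_le_left _ _
    have h6 : 0 < ε * d ^ 2 := by positivity
    nlinarith
  · intro x x' hxx
    have hp3 := hPath _ hxx
    set Zz : Set ((ℝ × ℝ) × ℝ) := {z : (ℝ × ℝ) × ℝ | ((x, x'), z.1.1) ∈ E ∧
        (Ξ (Φ ((x, x'), z.1.1), z.1.2), z.1.2) ∈ E ∧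
        Φ (Ξ (Φ ((x, x'), z.1.1), z.1.2), z.1.2) = Φ ((x, x'), z.1.1) ∧
        (Ξ (Φ ((x, x'), z.1.1), z.1.2), z.2) ∈ E} with hZz
    have mZz : MeasurableSet Zz := by
      have m1 : Measurable fun z : (ℝ × ℝ) × ℝ => ((x, x'), z.1.1) := by fun_prop
      have m2 : Measurable fun z : (ℝ × ℝ) × ℝ => (Ξ (Φ ((x, x'), z.1.1), z.1.2), z.1.2) := by fun_prop
      have m3 : Measurable fun z : (ℝ × ℝ) × ℝ => (Ξ (Φ ((x, x'), z.1.1), z.1.2), z.2) := by fun_prop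
      exact (m1 mE).inter ((m2 mE).inter ((measurableSet_eq_fun (mΦ.comp m2) (mΦ.comp m1)).inter (m3 mE)))
    have hZzf : ∀ z1 z2 z3, ((z1, z2), z3) ∈ Zz → ∃ y1 y1' x2 x2', y1 = η (x, z1) ∧ y1' = η (x', z1) ∧
        x2 = ξ (y1, z2) ∧ x2' = ξ (y1', z2) ∧ ((x, x'), z1) ∈ E ∧ ((x2, x2'), z2) ∈ E ∧
        ((x2, x2'), z3) ∈ E ∧ η (x2, z2) = y1 ∧ η (x2', z2) = y1' := by
      rintro z1 z2 z3 ⟨h1, h2, h3, h4⟩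
      simp only at h1 h2 h3 h4
      obtain ⟨a1, a2, a3, a4, a5⟩ := hEb _ h1
      simp only at a1 a2 a3 a4 a5
      have b3 := (hEb _ h2).2.2.1
      simp only at b3
      rw [eΦ x x' z1 a1 a2 a3, eΞ _ _ z2 a4 a5 b3] at h2 h3 h4
      obtain ⟨b1, b2, -, b4, b5⟩ := hEb _ h2
      rw [eΦ _ _ z2 b1 b2 b3] at h3
      rw [Prod.mk.injEq] at h3
      exact ⟨_, _, _, _, rfl, rfl, rfl, rfl, h1, h2, h4, h3.1, h3.2⟩
    have hpos : 0 < volume Zz := lt_of_lt_of_le (by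
      apply pos_iff_ne_zero.2
      apply pow_ne_zero
      rw [Ne, ENNReal.ofReal_eq_zero, not_le]
      positivity) hp3
    obtain ⟨z0, hz0⟩ := nonempty_of_measure_ne_zero hpos.ne'
    have hE0 : ((x, x'), z0.1.1) ∈ E := hz0.1
    have hx0 := (hT _ hE0.1).1
    have hx0' := (hT _ hE0.2.1).1
    simp only at hx0 hx0'
    refine ⟨hx0, hx0', hE0.2.2, ⟨_, hE0.1⟩, ⟨_, hE0.2.1⟩, ?_⟩
    obtain ⟨Z, mZ, hZvol, hZ⟩ := hpc x (by linarith) Zz mZz (by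
      rintro ⟨⟨z1, z2⟩, z3⟩ hz
      obtain ⟨y1, y1', x2, x2', rfl, rfl, hx2, hx2', e1, e2, e3, e4, e5⟩ := hZzf z1 z2 z3 hz
      obtain ⟨a1, a2, a3, a4, a5⟩ := hEb _ e1
      obtain ⟨b1, b2, b3, b4, b5⟩ := hEb _ e2
      obtain ⟨c1, c2, c3, c4, c5⟩ := hEb _ e3
      refine ⟨η (x, z1), x2, η (x2, z3), a4, b1, c4, D.inv3 _ _ a1 a3, ?_, D.inv3 _ _ c1 c3⟩
      rw [← e4]
      exact D.inv3 _ _ b1 b3)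
    refine ⟨Z, mZ, ?_, ?_⟩
    · have h1 : ENNReal.ofReal (c ^ 3 * d ^ 6) ≤ ENNReal.ofReal Cp * volume Z := by
        refine le_trans (le_of_eq ?_) (hp3.trans hZvol)
        rw [← ENNReal.ofReal_pow (by positivity)]
        congr 1; ring
      have h2 : ENNReal.ofReal (c ^ 3 / Cp * d ^ 6) ≤ volume Z := by
        have : ENNReal.ofReal (c ^ 3 * d ^ 6) = ENNReal.ofReal Cp * ENNReal.ofReal (c ^ 3 / Cp * d ^ 6) := by
          rw [← ENNReal.ofReal_mul hCp.le]; congr 1; field_simp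
        rw [this] at h1
        exact (ENNReal.mul_le_mul_iff_right (by simpa using hCp) ENNReal.ofReal_ne_top).1 h1
      refine le_trans (ENNReal.ofReal_le_ofReal ?_) h2
      gcongr
      exact min_le_right _ _
    · intro y1 x2 y hq
      obtain ⟨h1, h2, h3, h4⟩ := hZ _ hq
      simp only at h1 h2 h3 h4
      refine ⟨h1, h2, h3, ?_⟩
      rintro z1 z2 z3 y1' x2' rfl rfl rfl hy1' hx2'
      obtain ⟨y1a, y1a', x2a, x2a', ha1, ha2, ha3, ha4, e1, e2, e3, e4, e5⟩ := hZzf _ _ _ h4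
      have hy : y1a = y1 := by rw [ha1, D.inv4 _ _ (by linarith) h1]
      have hy' : y1a' = y1' := by rw [ha2, hy1']
      have b3 := (hEb _ e2).2.2.1
      simp only at b3
      have hx2a : x2a = x2 := by
        rw [ha3, hy]
        have h5 := D.inv4 _ _ h2 h1
        have h6 := D.inv1 x2 (φh (x2, y1)) h2 b3
        rwa [h5] at h6
      have hx2a' : x2a' = x2' := by rw [ha4, hx2', hy']
      rw [hx2a, hx2a'] at e2 e3
      exact ⟨e1.1, e1.2.1, e2.1, e2.2.1, e3.1, e3.2.1, e2.2.2, by rw [← hx2a', e5, hy']⟩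

theorem bad_x (F : ℝ × ((ℝ × ℝ) × ℝ) → ℝ) (u0 v0 : ℝ) (hF : AnalyticAt ℝ F (u0, ((v0, u0), v0)))
    (hne : ¬ ∀ᶠ p in nhds (u0, ((v0, u0), v0)), F p = 0) :
    ∃ R > 0, ∃ lam > 0, lam ≤ 1 ∧ ∃ (N : ℕ) (C : ℝ), 1 ≤ C ∧ ∀ q : ℝ, 0 < q → q ≤ 1 →
      ∀ θ : ℝ, 0 < θ → ∃ Bx : Set ℝ, MeasurableSet Bx ∧
        ENNReal.ofReal θ * volume Bx ≤ ENNReal.ofReal (C * q) ∧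
        ∀ x, |x - u0| < R → x ∉ Bx → ∀ Z : Set ((ℝ × ℝ) × ℝ), MeasurableSet Z →
          (∀ p ∈ Z, |p.1.1 - v0| < R ∧ |p.1.2 - u0| < R ∧ |p.2 - v0| < R) →
          ENNReal.ofReal (2 * θ) ≤ volume Z →
          ∃ Z' ⊆ Z, MeasurableSet Z' ∧ (∀ p ∈ Z', lam * q ^ N ≤ |F (x, p)|) ∧
            ENNReal.ofReal θ ≤ volume Z' := by
  have i1 : (volume : Measure ((ℝ × ℝ) × ℝ)).IsAddHaarMeasure := Measure.prod.instIsAddHaarMeasure _ _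
  have i2 : (volume : Measure (ℝ × ((ℝ × ℝ) × ℝ))).IsAddHaarMeasure :=
    Measure.prod.instIsAddHaarMeasure _ _
  obtain ⟨r, hr, lam, hlam, N, C, hC, hsub⟩ := sublevel_local volume F _ hF hne
  obtain ⟨r2, hr2, han⟩ := Metric.eventually_nhds_iff_ball.1 hF.eventually_analyticAt
  refine ⟨min r r2, by positivity, min lam 1, by positivity, min_le_right _ _, N, C + 1,
    by linarith, ?_⟩
  intro q hq hq1 θ hθ
  set Bl := Metric.ball ((u0, ((v0, u0), v0)) : ℝ × ((ℝ × ℝ) × ℝ)) (min r r2) with hBl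
  set A : Set (ℝ × ((ℝ × ℝ) × ℝ)) := Bl ∩ F ⁻¹' {t | |t| < min lam 1 * q ^ N} with hA
  have hAo : IsOpen A := by
    apply ContinuousOn.isOpen_inter_preimage
    · intro p hp
      exact (han p (Metric.ball_subset_ball (min_le_right _ _) hp)).continuousAt.continuousWithinAt
    · exact Metric.isOpen_ball
    · exact isOpen_lt continuous_abs continuous_const
  have hAv : volume A ≤ ENNReal.ofReal ((C + 1) * q) := by
    refine (measure_mono ?_).trans ((hsub q hq hq1).trans (ENNReal.ofReal_le_ofReal (by nlinarith)))
    rintro p ⟨h1, h2⟩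
    refine ⟨Metric.ball_subset_ball (min_le_left _ _) h1, lt_of_lt_of_le h2 ?_⟩
    gcongr
    exact min_le_left _ _
  refine ⟨{x | ENNReal.ofReal θ ≤ volume {z | (x, z) ∈ A}},
    measurableSet_le measurable_const (measurable_slice volume A hAo.measurableSet), ?_, ?_⟩
  · refine le_trans ?_ hAv
    exact prod_ge_of_slices volume volume A hAo.measurableSet _
      (measurableSet_le measurable_const (measurable_slice volume A hAo.measurableSet)) _
      (fun p hp => hp)
  · intro x hx hxB Z mZ hZ hZv
    have hxB' : volume {z | (x, z) ∈ A} < ENNReal.ofReal θ := not_le.1 hxB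
    have mS : MeasurableSet {z | (x, z) ∈ A} := hAo.measurableSet.preimage measurable_prodMk_left
    refine ⟨Z \ {z | (x, z) ∈ A}, sdiff_subset, mZ.diff mS, ?_, ?_⟩
    · rintro p ⟨hp, hpA⟩
      by_contra hlt
      apply hpA
      refine ⟨?_, not_le.1 hlt⟩
      obtain ⟨h1, h2, h3⟩ := hZ p hp
      rw [hBl, Metric.mem_ball]
      simp only [Prod.dist_eq, Real.dist_eq, max_lt_iff]
      exact ⟨hx, ⟨h1, h2⟩, h3⟩
    · have h1 : volume Z ≤ volume (Z \ {z | (x, z) ∈ A}) + volume {z | (x, z) ∈ A} := by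
        refine (measure_mono ?_).trans (measure_union_le _ _)
        intro p hp
        by_cases h : p ∈ {z | (x, z) ∈ A}
        · exact Or.inr h
        · exact Or.inl ⟨hp, h⟩
      have h2 : ENNReal.ofReal θ + ENNReal.ofReal θ ≤
          volume (Z \ {z | (x, z) ∈ A}) + ENNReal.ofReal θ := by
        rw [← ENNReal.ofReal_add hθ.le hθ.le, ← two_mul]
        exact hZv.trans (h1.trans (by gcongr))
      exact (ENNReal.add_le_add_iff_right ENNReal.ofReal_ne_top).1 h2

attribute [fun_prop] analyticAt_fst analyticAt_snd

def Vf (η ξ φh : ℝ × ℝ → ℝ) (P : E5) : ℝ :=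
  η (ξ (η (P.1, φh (P.2.1, P.2.2.1.1)), φh (P.2.2.1.2, P.2.2.1.1)), φh (P.2.2.1.2, P.2.2.2))

def ef (φh αh : ℝ × ℝ → ℝ) (P : E5) : ℝ :=
  αh (P.2.1, φh (P.2.1, P.2.2.1.1)) * αh (P.2.2.1.2, φh (P.2.2.1.2, P.2.2.2)) /
    αh (P.2.2.1.2, φh (P.2.2.1.2, P.2.2.1.1))

theorem Vf_analytic (η ξ φh : ℝ × ℝ → ℝ) (u0 v0 w0 : ℝ)
    (hη : AnalyticAt ℝ η (u0, w0)) (hξ : AnalyticAt ℝ ξ (v0, w0)) (hφ : AnalyticAt ℝ φh (u0, v0))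
    (e1 : η (u0, w0) = v0) (e2 : ξ (v0, w0) = u0) (e3 : φh (u0, v0) = w0) :
    AnalyticAt ℝ (Vf η ξ φh) (u0, u0, ((v0, u0), v0)) := by
  have a1 : AnalyticAt ℝ (fun P : E5 => φh (P.2.1, P.2.2.1.1)) (u0, u0, ((v0, u0), v0)) :=
    AnalyticAt.comp (g := φh) (f := fun P : E5 => (P.2.1, P.2.2.1.1)) hφ (by fun_prop)
  have a2 : AnalyticAt ℝ (fun P : E5 => φh (P.2.2.1.2, P.2.2.1.1)) (u0, u0, ((v0, u0), v0)) :=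
    AnalyticAt.comp (g := φh) (f := fun P : E5 => (P.2.2.1.2, P.2.2.1.1)) hφ (by fun_prop)
  have a3 : AnalyticAt ℝ (fun P : E5 => φh (P.2.2.1.2, P.2.2.2)) (u0, u0, ((v0, u0), v0)) :=
    AnalyticAt.comp (g := φh) (f := fun P : E5 => (P.2.2.1.2, P.2.2.2)) hφ (by fun_prop)
  have a0 : AnalyticAt ℝ (fun P : E5 => P.1) (u0, u0, ((v0, u0), v0)) := by fun_prop
  have b1 : AnalyticAt ℝ (fun P : E5 => η (P.1, φh (P.2.1, P.2.2.1.1))) (u0, u0, ((v0, u0), v0)) :=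
    AnalyticAt.comp (g := η) (f := fun P : E5 => (P.1, φh (P.2.1, P.2.2.1.1)))
      (by simpa only [e3] using hη) (a0.prod a1)
  have b2 : AnalyticAt ℝ (fun P : E5 => ξ (η (P.1, φh (P.2.1, P.2.2.1.1)), φh (P.2.2.1.2, P.2.2.1.1)))
      (u0, u0, ((v0, u0), v0)) :=
    AnalyticAt.comp (g := ξ) (f := fun P : E5 => (η (P.1, φh (P.2.1, P.2.2.1.1)), φh (P.2.2.1.2, P.2.2.1.1)))
      (by simpa only [e3, e1] using hξ) (b1.prod a2)
  exact AnalyticAt.comp (g := η) (f := fun P : E5 =>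
    (ξ (η (P.1, φh (P.2.1, P.2.2.1.1)), φh (P.2.2.1.2, P.2.2.1.1)), φh (P.2.2.1.2, P.2.2.2)))
      (by simpa only [e3, e1, e2] using hη) (b2.prod a3)

theorem ef_analytic (φh αh : ℝ × ℝ → ℝ) (u0 v0 w0 : ℝ)
    (hφ : AnalyticAt ℝ φh (u0, v0)) (hα : AnalyticAt ℝ αh (u0, w0)) (hα0 : αh (u0, w0) ≠ 0)
    (e3 : φh (u0, v0) = w0) :
    AnalyticAt ℝ (ef φh αh) (u0, u0, ((v0, u0), v0)) := by
  have a1 : AnalyticAt ℝ (fun P : E5 => φh (P.2.1, P.2.2.1.1)) (u0, u0, ((v0, u0), v0)) :=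
    AnalyticAt.comp (g := φh) (f := fun P : E5 => (P.2.1, P.2.2.1.1)) hφ (by fun_prop)
  have a2 : AnalyticAt ℝ (fun P : E5 => φh (P.2.2.1.2, P.2.2.1.1)) (u0, u0, ((v0, u0), v0)) :=
    AnalyticAt.comp (g := φh) (f := fun P : E5 => (P.2.2.1.2, P.2.2.1.1)) hφ (by fun_prop)
  have a3 : AnalyticAt ℝ (fun P : E5 => φh (P.2.2.1.2, P.2.2.2)) (u0, u0, ((v0, u0), v0)) :=
    AnalyticAt.comp (g := φh) (f := fun P : E5 => (P.2.2.1.2, P.2.2.2)) hφ (by fun_prop)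
  have a4 : AnalyticAt ℝ (fun P : E5 => P.2.1) (u0, u0, ((v0, u0), v0)) := by fun_prop
  have a5 : AnalyticAt ℝ (fun P : E5 => P.2.2.1.2) (u0, u0, ((v0, u0), v0)) := by fun_prop
  have b1 : AnalyticAt ℝ (fun P : E5 => αh (P.2.1, φh (P.2.1, P.2.2.1.1))) (u0, u0, ((v0, u0), v0)) :=
    AnalyticAt.comp (g := αh) (f := fun P : E5 => (P.2.1, φh (P.2.1, P.2.2.1.1)))
      (by simpa only [e3] using hα) (a4.prod a1)
  have b2 : AnalyticAt ℝ (fun P : E5 => αh (P.2.2.1.2, φh (P.2.2.1.2, P.2.2.1.1))) (u0, u0, ((v0, u0), v0)) :=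
    AnalyticAt.comp (g := αh) (f := fun P : E5 => (P.2.2.1.2, φh (P.2.2.1.2, P.2.2.1.1)))
      (by simpa only [e3] using hα) (a5.prod a2)
  have b3 : AnalyticAt ℝ (fun P : E5 => αh (P.2.2.1.2, φh (P.2.2.1.2, P.2.2.2))) (u0, u0, ((v0, u0), v0)) :=
    AnalyticAt.comp (g := αh) (f := fun P : E5 => (P.2.2.1.2, φh (P.2.2.1.2, P.2.2.2)))
      (by simpa only [e3] using hα) (a5.prod a3)
  exact (b1.mul b3).div b2 (by simpa only [e3] using hα0)

theorem Vf_diag (η ξ φh αh : ℝ × ℝ → ℝ) (u0 v0 w0 R K : ℝ) (D : LocData η ξ φh αh u0 v0 w0 R K)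
    (hφ : ContinuousAt φh (u0, v0)) (e3 : φh (u0, v0) = w0) :
    ∀ᶠ w in nhds ((u0, ((v0, u0), v0)) : ℝ × ((ℝ × ℝ) × ℝ)),
      Vf η ξ φh (w.1, w.1, w.2) = w.2.2 := by
  have c2 : ContinuousAt (fun w : ℝ × ((ℝ × ℝ) × ℝ) => φh (w.2.1.2, w.2.1.1)) (u0, ((v0, u0), v0)) :=
    ContinuousAt.comp (g := φh) (f := fun w : ℝ × ((ℝ × ℝ) × ℝ) => (w.2.1.2, w.2.1.1)) hφ (by fun_prop)
  have n2 : ∀ᶠ w in nhds ((u0, ((v0, u0), v0)) : ℝ × ((ℝ × ℝ) × ℝ)), |φh (w.2.1.2, w.2.1.1) - w0| < R := by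
    have : ContinuousAt (fun w : ℝ × ((ℝ × ℝ) × ℝ) => |φh (w.2.1.2, w.2.1.1) - w0|) (u0, ((v0, u0), v0)) :=
      (c2.sub continuousAt_const).abs
    exact this.eventually_lt_const (by simp [e3, D.Rpos])
  filter_upwards [n2, Metric.ball_mem_nhds _ D.Rpos] with w h2 hb
  obtain ⟨x, ⟨⟨y1, x2⟩, y⟩⟩ := w
  rw [Metric.mem_ball] at hb
  simp only [Prod.dist_eq, Real.dist_eq, max_lt_iff] at hb
  obtain ⟨hx, ⟨hy1, hx2⟩, hy⟩ := hb
  simp only at h2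
  simp only [Vf]
  rw [D.inv4 x y1 hx hy1]
  have h6 := D.inv1 x2 (φh (x2, y1)) hx2 h2
  rw [D.inv4 x2 y1 hx2 hy1] at h6
  rw [h6, D.inv4 x2 y hx2 hy]

theorem J5_analytic (V e : E5 → ℝ) (b : E5) (hV : AnalyticAt ℝ V b) (he : AnalyticAt ℝ e b) :
    AnalyticAt ℝ (J5 V e) b := by
  have h1 := hV5_analytic V b hV
  have d : ∀ (F : E5 → ℝ) (v : E5), AnalyticAt ℝ F b → AnalyticAt ℝ (fun P => fderiv ℝ F P v) b :=
    fun F v h => ((ContinuousLinearMap.apply ℝ ℝ v).analyticAt _).comp h.fderiv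
  exact ((d _ _ h1).mul (d _ _ he)).sub ((d _ _ h1).mul (d _ _ he))

theorem edge_combine (K K0 ε G a1 a2 a3 A B H Q : ℝ) (hK0 : 0 ≤ K0) (hε : 0 ≤ ε) (hK : 1 ≤ K)
    (ha1 : |a1| ≤ K) (ha2 : 1 ≤ K * |a2|)
    (e1 : |G - a1 * A| ≤ K0 * ε) (e2 : |H - a2 * A| ≤ K0 * ε) (e3 : |H - a3 * B| ≤ K0 * ε)
    (hQ : Q = a1 * a3 / a2) :
    |G - Q * B| ≤ (K0 * (1 + 2 * K ^ 2)) * ε := by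
  have ha2' : 0 < |a2| := by
    by_contra h
    have : |a2| = 0 := le_antisymm (not_lt.1 h) (abs_nonneg _)
    rw [this] at ha2; linarith
  have h2 : a2 ≠ 0 := abs_pos.1 ha2'
  have hd : |a2 * A - a3 * B| ≤ 2 * (K0 * ε) := by
    have : a2 * A - a3 * B = (H - a3 * B) - (H - a2 * A) := by ring
    rw [this]
    exact (abs_sub _ _).trans (by linarith)
  have hq : |a1 / a2| ≤ K ^ 2 := by
    rw [abs_div, div_le_iff₀ ha2']
    nlinarith
  have : G - Q * B = (G - a1 * A) + (a1 / a2) * (a2 * A - a3 * B) := by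
    rw [hQ]; field_simp; ring
  rw [this]
  refine (abs_add_le _ _).trans ?_
  rw [abs_mul]
  have h3 : |a1 / a2| * |a2 * A - a3 * B| ≤ K ^ 2 * (2 * (K0 * ε)) := by gcongr
  nlinarith

set_option maxHeartbeats 1600000 in
theorem model (η ξ φh αh : ℝ × ℝ → ℝ) (u0 v0 w0 : ℝ)
    (hη : AnalyticAt ℝ η (u0, w0)) (hξ : AnalyticAt ℝ ξ (v0, w0)) (hφ : AnalyticAt ℝ φh (u0, v0))
    (hα : AnalyticAt ℝ αh (u0, w0)) (hα0 : αh (u0, w0) ≠ 0)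
    (h1 : ∀ᶠ p in nhds (u0, w0), ξ (η p, p.2) = p.1)
    (h2 : ∀ᶠ p in nhds (v0, w0), η (ξ p, p.2) = p.1)
    (h3 : ∀ᶠ p in nhds (u0, w0), φh (p.1, η p) = p.2)
    (h4 : ∀ᶠ p in nhds (u0, v0), η (p.1, φh p) = p.2)
    (e1 : η (u0, w0) = v0) (e2 : ξ (v0, w0) = u0) (e3 : φh (u0, v0) = w0)
    (hJ : ¬ ∀ᶠ w in nhds ((u0, ((v0, u0), v0)) : ℝ × ((ℝ × ℝ) × ℝ)),
      J5 (Vf η ξ φh) (ef φh αh) (w.1, w.1, w.2) = 0) :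
    ∃ r > 0, ∀ K0 : ℝ, 0 ≤ K0 → ∃ c0 > 0, ∃ C0 > 0, ∃ n : ℕ, ∀ ε : ℝ, 0 < ε → ε ≤ 1 →
      ∀ (f1 f2 : ℝ → ℝ) (T : Set (ℝ × ℝ)), MeasurableSet T →
      (∀ p ∈ T, |p.1 - u0| ≤ r ∧ |p.2 - w0| ≤ r) →
      (∀ x x' z, (x, z) ∈ T → (x', z) ∈ T → |x - x'| ≤ ε →
        |(f1 x' - f1 x) - αh (x, z) * (f2 (η (x', z)) - f2 (η (x, z)))| ≤ K0 * ε) →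
      ∀ δ : ℝ, 0 < δ → ENNReal.ofReal δ ≤ volume T → ε ≤ c0 * δ ^ n →
      ∃ (fstar : ℝ → ℝ) (E1 : Set ℝ), ConstOnIntervals fstar ε ∧ MeasurableSet E1 ∧
        ENNReal.ofReal (c0 * δ ^ n) ≤ volume (T ∩ E1 ×ˢ univ) ∧
        ∀ x ∈ E1, |fstar x - f1 x| ≤ C0 * ε / δ ^ n := by
  obtain ⟨R1, hR1, K, hLoc⟩ := exists_locData η ξ φh αh u0 v0 w0 hη hξ hφ hα hα0 h1 h2 h3 h4
  have hVa := Vf_analytic η ξ φh u0 v0 w0 hη hξ hφ e1 e2 e3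
  have hea := ef_analytic φh αh u0 v0 w0 hφ hα hα0 e3
  have hdiag := Vf_diag η ξ φh αh u0 v0 w0 R1 K (hLoc R1 hR1 le_rfl) hφ.continuousAt e3
  obtain ⟨RD, hRD, CD, hCD, hlemD⟩ := lemmaD (Vf η ξ φh) (ef φh αh) u0 v0 hVa hea hdiag
  have hFa : AnalyticAt ℝ (fun w : ℝ × ((ℝ × ℝ) × ℝ) => J5 (Vf η ξ φh) (ef φh αh) (w.1, w.1, w.2))
      (u0, ((v0, u0), v0)) :=
    AnalyticAt.comp (g := J5 (Vf η ξ φh) (ef φh αh))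
      (f := fun w : ℝ × ((ℝ × ℝ) × ℝ) => ((w.1, w.1, w.2) : E5)) (J5_analytic _ _ _ hVa hea) (by fun_prop)
  obtain ⟨R2, hR2, lam, hlam, hlam1, N, Cb, hCb, hbad⟩ := bad_x _ u0 v0 hFa hJ
  set R := min R1 (min RD R2) with hRdef
  have hR : 0 < R := by positivity
  have rD : R ≤ RD := (min_le_right _ _).trans (min_le_left _ _)
  have r2 : R ≤ R2 := (min_le_right _ _).trans (min_le_right _ _)
  have D := hLoc R hR (min_le_left _ _)
  have hK := D.K1
  have hR4 := D.Rle
  obtain ⟨rη, hrη, hcη⟩ : ∃ rη > 0, ∀ x z, |x - u0| ≤ rη → |z - w0| ≤ rη → |η (x, z) - v0| < R := by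
    have : ∀ᶠ p in nhds (u0, w0), |η p - v0| < R :=
      (hη.continuousAt.sub continuousAt_const).abs.eventually_lt_const (by simp [e1, hR])
    obtain ⟨ρ, hρ, hb⟩ := Metric.eventually_nhds_iff_ball.1 this
    rw [← bx_eq] at hb
    exact ⟨ρ / 2, by positivity, fun x z hx hz => hb (x, z) ⟨by linarith, by linarith⟩⟩
  set r := min rη (R / 2) with hrdef
  have hr : 0 < r := by positivity
  have hrR : r ≤ R / 2 := min_le_right _ _
  have hηr : ∀ x z, |x - u0| ≤ r → |z - w0| ≤ r → |η (x, z) - v0| < R := fun x z hx hz =>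
    hcη x z (hx.trans (min_le_left _ _)) (hz.trans (min_le_left _ _))
  obtain ⟨c1, hc1, hc11, hpath⟩ := model_path η ξ φh αh u0 v0 w0 R K r D hr hrR hηr
  refine ⟨r, hr, ?_⟩
  intro K0 hK0
  set k : ℝ := c1 ^ 2 / (2 ^ 11 * Cb) with hk
  have hCb0 : 0 < Cb := by linarith
  have hk0 : 0 < k := by positivity
  set K1 := K0 * (1 + 2 * K ^ 2) with hK1
  have hK10 : 0 ≤ K1 := by positivity
  set C0 : ℝ := CD * K1 / ((lam * k ^ N) ^ 4 * (c1 / 2 ^ 7)) with hC0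
  have hC00 : 0 ≤ C0 := by positivity
  refine ⟨min (lam * k ^ N / CD) (c1 / 16), by positivity, C0 + 1, by positivity, 32 * N + 6, ?_⟩
  intro ε hε hε1 f1 f2 T mT hT hedge δ hδ hδT hεδ
  have vX : volume (Icc (u0 - r) (u0 + r)) ≤ 1 := by
    rw [Real.volume_Icc, ← ENNReal.ofReal_one]
    exact ENNReal.ofReal_le_ofReal (by linarith)
  have hTX : ∀ p ∈ T, p.1 ∈ Icc (u0 - r) (u0 + r) := fun p hp => by
    have := abs_le.1 (hT p hp).1
    exact ⟨by linarith, by linarith⟩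
  -- δ ≤ 1
  have hδ1 : δ ≤ 1 := by
    have : volume T ≤ 1 := by
      have := prod_le_of_slices volume volume T mT (Icc (u0 - r) (u0 + r)) measurableSet_Icc
        (1 : ℝ≥0∞) hTX (fun x _ => by
          refine (measure_mono (t := Icc (w0 - r) (w0 + r)) ?_).trans ?_
          · intro z hz
            have := abs_le.1 (hT _ hz).2
            simp only at this
            exact ⟨by linarith, by linarith⟩
          · rw [Real.volume_Icc, ← ENNReal.ofReal_one]
            exact ENNReal.ofReal_le_ofReal (by linarith))
      refine this.trans ?_
      rw [one_mul]; exact vX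
    have h5 := hδT.trans this
    rwa [← ENNReal.ofReal_one, ENNReal.ofReal_le_ofReal_iff (by norm_num)] at h5
  -- trimming
  set T1 : Set (ℝ × ℝ) := {p ∈ T | ENNReal.ofReal (δ / 2) ≤ volume {z | (p.1, z) ∈ T}} with hT1
  have mT1 : MeasurableSet T1 := mT.inter
    (measurableSet_le measurable_const ((measurable_slice volume T mT).comp measurable_fst))
  have hT1v : ENNReal.ofReal (δ / 2) ≤ volume T1 := by
    have ht := trim_slices volume volume T mT (Icc (u0 - r) (u0 + r)) measurableSet_Icc
      (ENNReal.ofReal (δ / 2)) hTX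
    have ht2 : ENNReal.ofReal (δ / 2) * volume (Icc (u0 - r) (u0 + r)) ≤ ENNReal.ofReal (δ / 2) := by
      calc _ ≤ ENNReal.ofReal (δ / 2) * 1 := by gcongr
        _ = _ := mul_one _
    have h5 : volume T ≤ ENNReal.ofReal (δ / 2) + volume T1 := by
      refine le_trans (measure_mono ?_) ((measure_union_le _ _).trans (add_le_add_left (ht.trans ht2) _))
      intro p hp
      by_cases h : ENNReal.ofReal (δ / 2) ≤ volume {z | (p.1, z) ∈ T}
      · exact Or.inr ⟨hp, h⟩
      · exact Or.inl ⟨hp, not_le.1 h⟩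
    have h6 : ENNReal.ofReal δ = ENNReal.ofReal (δ / 2) + ENNReal.ofReal (δ / 2) := by
      rw [← ENNReal.ofReal_add (by positivity) (by positivity)]; congr 1; ring
    have h7 := hδT.trans h5
    rw [h6] at h7
    exact (ENNReal.add_le_add_iff_left ENNReal.ofReal_ne_top).1 h7
  obtain ⟨P, mP, hPv, hP⟩ := hpath ε hε hε1 T1 mT1 (fun p hp => hT p hp.1) (δ / 2) (by positivity) hT1v
  set θ : ℝ := c1 * (δ / 2) ^ 6 / 2 with hθ
  have hθ0 : 0 < θ := by positivity
  have hkδ : k * δ ^ 8 ≤ 1 := by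
    have : k ≤ 1 := by
      rw [hk, div_le_one (by positivity)]
      nlinarith
    have h8 : δ ^ 8 ≤ 1 := pow_le_one₀ hδ.le hδ1
    nlinarith [pow_pos hδ 8]
  obtain ⟨Bx, mBx, hBxv, hBx⟩ := hbad (k * δ ^ 8) (by positivity) hkδ θ hθ0
  set κ : ℝ := lam * (k * δ ^ 8) ^ N with hκ
  have hκ0 : 0 < κ := by positivity
  have hκ1 : κ ≤ 1 := by
    have : (k * δ ^ 8) ^ N ≤ 1 := pow_le_one₀ (by positivity) hkδ
    nlinarith [pow_pos (show 0 < k * δ ^ 8 by positivity) N]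
  have hεκ : ε ≤ κ / CD := by
    refine hεδ.trans ?_
    calc min (lam * k ^ N / CD) (c1 / 16) * δ ^ (32 * N + 6) ≤ (lam * k ^ N / CD) * δ ^ (8 * N) := by
          refine mul_le_mul (min_le_left _ _) ?_ (by positivity) (by positivity)
          exact pow_le_pow_of_le_one hδ.le hδ1 (by omega)
      _ = κ / CD := by rw [hκ, mul_pow, ← pow_mul]; ring
  have hBxv2 : volume Bx ≤ ENNReal.ofReal (c1 * (δ / 2) ^ 2 / 4) := by
    have : ENNReal.ofReal (Cb * (k * δ ^ 8)) = ENNReal.ofReal θ * ENNReal.ofReal (c1 * (δ / 2) ^ 2 / 4) := by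
      rw [← ENNReal.ofReal_mul hθ0.le]
      congr 1
      rw [hk, hθ]; field_simp; ring
    rw [this] at hBxv
    exact (ENNReal.mul_le_mul_iff_right (by simpa using hθ0) ENNReal.ofReal_ne_top).1 hBxv
  set P' : Set (ℝ × ℝ) := {p ∈ P | p.1 ∉ Bx} with hP'
  have mP' : MeasurableSet P' := mP.inter (measurable_fst mBx).compl
  have hP'v : ENNReal.ofReal (c1 * ε * (δ / 2) ^ 2 / 2) ≤ volume P' := by
    have hbadp : volume (P ∩ {p | p.1 ∈ Bx}) ≤ ENNReal.ofReal (c1 * ε * (δ / 2) ^ 2 / 2) := by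
      refine (prod_le_of_slices volume volume _ (mP.inter (measurable_fst mBx)) Bx mBx
        (ENNReal.ofReal (2 * ε)) (fun p hp => hp.2) (fun x _ => ?_)).trans ?_
      · refine (measure_mono (t := Icc (x - ε) (x + ε)) ?_).trans ?_
        · rintro x' ⟨hx', -⟩
          have := abs_le.1 (same_cell_dist ε hε _ _ (hP x x' hx').2.2.1)
          exact ⟨by linarith, by linarith⟩
        · rw [Real.volume_Icc]
          exact ENNReal.ofReal_le_ofReal (by linarith)
      · calc _ ≤ ENNReal.ofReal (2 * ε) * ENNReal.ofReal (c1 * (δ / 2) ^ 2 / 4) := by gcongr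
          _ = _ := by rw [← ENNReal.ofReal_mul (by positivity)]; congr 1; ring
    have h5 : volume P ≤ ENNReal.ofReal (c1 * ε * (δ / 2) ^ 2 / 2) + volume P' := by
      refine le_trans (measure_mono ?_) ((measure_union_le _ _).trans (add_le_add_left hbadp _))
      intro p hp
      by_cases h : p.1 ∈ Bx
      · exact Or.inl ⟨hp, h⟩
      · exact Or.inr ⟨hp, h⟩
    have h6 : ENNReal.ofReal (c1 * ε * (δ / 2) ^ 2) = ENNReal.ofReal (c1 * ε * (δ / 2) ^ 2 / 2) +
        ENNReal.ofReal (c1 * ε * (δ / 2) ^ 2 / 2) := by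
      rw [← ENNReal.ofReal_add (by positivity) (by positivity)]; congr 1; ring
    have h7 := hPv.trans h5
    rw [h6] at h7
    exact (ENNReal.add_le_add_iff_left ENNReal.ofReal_ne_top).1 h7
  -- main estimate
  have hmain : ∀ x x', (x, x') ∈ P' → |f1 x' - f1 x| ≤ CD * K1 * ε / (κ ^ 4 * θ) := by
    rintro x x' ⟨hxx, hxB⟩
    by_cases hne : x = x'
    · subst hne
      rw [sub_self, abs_zero]; positivity
    obtain ⟨hx, hx', hcell, -, -, Z, mZ, hZv, hZ⟩ := hP x x' hxx
    have hxd := same_cell_dist ε hε _ _ hcell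
    have hZb : ∀ p ∈ Z, |p.1.1 - v0| < R ∧ |p.1.2 - u0| < R ∧ |p.2 - v0| < R := by
      rintro ⟨⟨y1, x2⟩, y⟩ hp
      obtain ⟨a, b, c, -⟩ := hZ _ _ _ hp
      exact ⟨a, b, c⟩
    obtain ⟨Z', hZ'Z, mZ', hZ'κ, hZ'v⟩ := hBx x (by linarith) hxB Z mZ
      (fun p hp => by
        obtain ⟨a, b, c⟩ := hZb p hp
        exact ⟨by linarith, by linarith, by linarith⟩)
      (by
        have : 2 * θ = c1 * (δ / 2) ^ 6 := by rw [hθ]; ring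
        rw [this]; exact hZv)
    have hfin := hlemD κ hκ0 hκ1 ε hε hεκ x x' (by linarith) (by linarith) hxd hne (f1 x' - f1 x)
      (fun y v => f2 v - f2 y) K1 hK10 Z' mZ' (fun p hp => by
        obtain ⟨a, b, c⟩ := hZb p (hZ'Z hp)
        exact ⟨by linarith, by linarith, by linarith⟩) hZ'κ (by
      rintro ⟨⟨y1, x2⟩, y⟩ hp
      obtain ⟨a, b, c, hq⟩ := hZ _ _ _ (hZ'Z hp)
      obtain ⟨q1, q2, q3, q4, q5, q6, q7, q8⟩ := hq _ _ _ _ _ rfl rfl rfl rfl rfl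
      have E1 := hedge _ _ _ q1.1 q2.1 hxd
      have hd2 := same_cell_dist ε hε _ _ q7
      have E2 := hedge _ _ _ q3.1 q4.1 hd2
      have E3 := hedge _ _ _ q5.1 q6.1 hd2
      rw [D.inv4 x y1 (by linarith) a] at E1
      rw [D.inv4 x2 y1 b a, q8] at E2
      rw [D.inv4 x2 y b c] at E3
      have t1 := hT _ q1.1
      have t2 := hT _ q3.1
      simp only at t1 t2
      exact edge_combine K K0 ε _ _ _ _ _ _ _ _ hK0 hε.le hK
        (D.αup _ ⟨by linarith, by linarith⟩) (D.αlow _ ⟨by linarith, by linarith⟩) E1 E2 E3 rfl)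
    have h8 : ENNReal.ofReal (|f1 x' - f1 x| * θ) ≤ ENNReal.ofReal (CD * K1 * ε / κ ^ 4) := by
      rw [ENNReal.ofReal_mul (abs_nonneg _)]
      refine le_trans ?_ hfin
      gcongr
    rw [ENNReal.ofReal_le_ofReal_iff (by positivity)] at h8
    rw [← div_div, le_div_iff₀ hθ0]
    exact h8
  obtain ⟨fstar, E1, hfs, mE1, hE1v, hE1⟩ := select_cells ε hε P' mP'
    (fun p hp => (hP p.1 p.2 hp.1).2.2.1) f1
  refine ⟨fstar, E1, hfs, mE1, ?_, ?_⟩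
  · have hE1v2 : ENNReal.ofReal (c1 * (δ / 2) ^ 2 / 2) ≤ volume E1 := by
      have h5 := hP'v.trans hE1v
      have : ENNReal.ofReal (c1 * ε * (δ / 2) ^ 2 / 2) =
          ENNReal.ofReal ε * ENNReal.ofReal (c1 * (δ / 2) ^ 2 / 2) := by
        rw [← ENNReal.ofReal_mul hε.le]; congr 1; ring
      rw [this] at h5
      exact (ENNReal.mul_le_mul_iff_right (by simpa using hε) ENNReal.ofReal_ne_top).1 h5
    have h5 := prod_ge_of_slices volume volume (T ∩ E1 ×ˢ univ) (mT.inter (mE1.prod MeasurableSet.univ))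
      E1 mE1 (ENNReal.ofReal (δ / 2)) (fun x hx => by
        obtain ⟨x', hx', -⟩ := hE1 x hx
        obtain ⟨z, hz⟩ := (hP x' x hx'.1).2.2.2.2.1
        refine hz.2.trans (measure_mono ?_)
        intro z hz
        exact ⟨hz, hx, mem_univ _⟩)
    refine le_trans ?_ h5
    calc _ ≤ ENNReal.ofReal (δ / 2 * (c1 * (δ / 2) ^ 2 / 2)) := by
          apply ENNReal.ofReal_le_ofReal
          calc min (lam * k ^ N / CD) (c1 / 16) * δ ^ (32 * N + 6) ≤ c1 / 16 * δ ^ 3 := by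
                refine mul_le_mul (min_le_right _ _) ?_ (by positivity) (by positivity)
                exact pow_le_pow_of_le_one hδ.le hδ1 (by omega)
            _ = _ := by ring
      _ = ENNReal.ofReal (δ / 2) * ENNReal.ofReal (c1 * (δ / 2) ^ 2 / 2) :=
          ENNReal.ofReal_mul (by positivity)
      _ ≤ _ := by gcongr
  · intro x hx
    obtain ⟨x', hx', hf⟩ := hE1 x hx
    rw [hf, abs_sub_comm]
    refine (hmain x' x hx').trans ?_
    calc CD * K1 * ε / (κ ^ 4 * θ) = C0 * ε / δ ^ (32 * N + 6) := by
          have : κ ^ 4 * θ = (lam * k ^ N) ^ 4 * (c1 / 2 ^ 7) * δ ^ (32 * N + 6) := by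
            rw [hκ, hθ]; ring
          rw [this, hC0]; field_simp
      _ ≤ (C0 + 1) * ε / δ ^ (32 * N + 6) := by gcongr; linarith

theorem primitive (f : ℝ → ℝ) (t0 : ℝ) (hf : AnalyticAt ℝ f t0) :
    ∃ F : ℝ → ℝ, AnalyticAt ℝ F t0 ∧ ∀ᶠ t in nhds t0, HasDerivAt F (f t) t := by
  obtain ⟨p, hp⟩ := hf
  obtain ⟨C, r, hC, hr, hb⟩ := p.le_mul_pow_of_radius_pos hp.radius_pos
  set b : ℕ → ℝ := fun n => Nat.casesOn n 0 (fun m => p.coeff m / (m + 1)) with hbd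
  set q := FormalMultilinearSeries.ofScalars ℝ b with hq
  have hrad : 0 < q.radius := by
    have : ((Real.toNNReal (1 / (r + 1)) : ℝ≥0) : ℝ≥0∞) ≤ q.radius := by
      apply q.le_radius_of_bound (C / (r+1))
      intro n
      rw [hq, FormalMultilinearSeries.ofScalars_norm, Real.coe_toNNReal _ (by positivity)]
      rcases n with _ | m
      · simp [hbd]; positivity
      · have h1 : ‖b (m+1)‖ ≤ C * r ^ m := by
          simp only [hbd, norm_div]
          have h2 : ‖p.coeff m‖ ≤ C * r ^ m := by
            refine le_trans ?_ (hb m)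
            rw [FormalMultilinearSeries.norm_apply_eq_norm_coef]
          have h3 : (1:ℝ) ≤ ‖(m:ℝ)+1‖ := by
            rw [Real.norm_of_nonneg (by positivity)]
            have : (0:ℝ) ≤ m := by positivity
            linarith
          exact (div_le_self (norm_nonneg _) h3).trans h2
        calc ‖b (m+1)‖ * (1/(r+1))^(m+1) ≤ (C * r^m) * (1/(r+1))^(m+1) := by gcongr
          _ = C / (r+1) * (r/(r+1))^m := by rw [pow_succ, div_pow, div_pow]; ring
          _ ≤ C / (r+1) * 1 := by
            gcongr
            apply pow_le_one₀ (by positivity)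
            rw [div_le_one (by positivity)]; linarith
          _ = C / (r+1) := by ring
    refine lt_of_lt_of_le ?_ this
    simp; positivity
  have h1 := q.hasFPowerSeriesOnBall hrad
  have h2 := h1.comp_sub t0
  rw [zero_add] at h2
  refine ⟨_, h2.analyticAt, ?_⟩
  have h3 := (ContinuousLinearMap.apply ℝ ℝ (1:ℝ)).comp_hasFPowerSeriesOnBall h2.fderiv
  have e1 := hasFPowerSeriesAt_iff'.1 hp
  have e2 := hasFPowerSeriesAt_iff'.1 h3.hasFPowerSeriesAt
  have e3 := h2.analyticAt.eventually_analyticAt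
  filter_upwards [e1, e2, e3] with z k1 k2 k3
  have := k3.differentiableAt.hasDerivAt
  have key : f z = deriv (fun z => q.sum (z - t0)) z := by
    refine k1.unique ?_
    have k2' : HasSum (fun n => (z - t0) ^ n • p.coeff n)
        (((ContinuousLinearMap.apply ℝ ℝ (1:ℝ)) ∘ fderiv ℝ fun z => q.sum (z - t0)) z) := by
      refine k2.congr_fun fun n => ?_
      congr 1
      have h5 : ((ContinuousLinearMap.apply ℝ ℝ (1:ℝ)).compFormalMultilinearSeries
          q.derivSeries).coeff n = q.derivSeries.coeff n 1 := rfl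
      rw [h5, FormalMultilinearSeries.derivSeries_coeff_one, hq,
        FormalMultilinearSeries.coeff_ofScalars]
      simp only [hbd, nsmul_eq_mul]
      push_cast
      field_simp
    exact k2'
  rw [key]; exact this

theorem line_fst (M : ℝ × ℝ → ℝ) (x y : ℝ) (h : AnalyticAt ℝ M (x, y)) :
    HasDerivAt (fun t => M (t, y)) (fderiv ℝ M (x, y) (1, 0)) x := by
  have h1 : HasDerivAt (fun t : ℝ => ((t, y) : ℝ × ℝ)) (1, 0) x :=
    (hasDerivAt_id x).prodMk (hasDerivAt_const x y)
  exact HasFDerivAt.comp_hasDerivAt (l := M) (f := fun t : ℝ => ((t, y) : ℝ × ℝ)) x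
    h.differentiableAt.hasFDerivAt h1

theorem line_snd (M : ℝ × ℝ → ℝ) (x y : ℝ) (h : AnalyticAt ℝ M (x, y)) :
    HasDerivAt (fun t => M (x, t)) (fderiv ℝ M (x, y) (0, 1)) y := by
  have h1 : HasDerivAt (fun t : ℝ => ((x, t) : ℝ × ℝ)) (0, 1) y :=
    (hasDerivAt_const y x).prodMk (hasDerivAt_id y)
  exact HasFDerivAt.comp_hasDerivAt (l := M) (f := fun t : ℝ => ((x, t) : ℝ × ℝ)) y
    h.differentiableAt.hasFDerivAt h1

theorem diag_derivs (F : E5 → ℝ) (M : ℝ × ℝ → ℝ) (u0 v0 R : ℝ)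
    (hM : ∀ x y, |x - u0| < R → |y - v0| < R → AnalyticAt ℝ M (x, y) ∧ M (x, y) ≠ 0)
    (x x2 y1 y : ℝ) (hx : |x - u0| < R) (hx2 : |x2 - u0| < R) (hy1 : |y1 - v0| < R)
    (hy : |y - v0| < R)
    (hF : AnalyticAt ℝ F (x, x, ((y1, x2), y)))
    (hFM : ∀ x2 y1, |x2 - u0| < R → |y1 - v0| < R →
      F (x, x, ((y1, x2), y)) = M (x, y1) * M (x2, y) / M (x2, y1)) :
    fderiv ℝ F (x, x, ((y1, x2), y)) (0, 0, ((1, 0), 0)) =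
      M (x, y1) * M (x2, y) / M (x2, y1) *
        (fderiv ℝ M (x, y1) (0, 1) / M (x, y1) - fderiv ℝ M (x2, y1) (0, 1) / M (x2, y1)) ∧
    fderiv ℝ F (x, x, ((y1, x2), y)) (0, 0, ((0, 1), 0)) =
      M (x, y1) * M (x2, y) / M (x2, y1) *
        (fderiv ℝ M (x2, y) (1, 0) / M (x2, y) - fderiv ℝ M (x2, y1) (1, 0) / M (x2, y1)) := by
  have n1 : ∀ᶠ t in nhds y1, |t - v0| < R := by
    have : ContinuousAt (fun t : ℝ => |t - v0|) y1 := by fun_prop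
    exact this.eventually_lt_const hy1
  have n2 : ∀ᶠ t in nhds x2, |t - u0| < R := by
    have : ContinuousAt (fun t : ℝ => |t - u0|) x2 := by fun_prop
    exact this.eventually_lt_const hx2
  have c1 := (hM x y1 hx hy1).2
  have c2 := (hM x2 y1 hx2 hy1).2
  have c3 := (hM x2 y hx2 hy).2
  constructor
  · have l1 : HasDerivAt (fun t : ℝ => ((x, x, ((t, x2), y)) : E5)) (0, 0, ((1, 0), 0)) y1 :=
      (hasDerivAt_const _ _).prodMk ((hasDerivAt_const _ _).prodMk
        (((hasDerivAt_id y1).prodMk (hasDerivAt_const _ _)).prodMk (hasDerivAt_const _ _)))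
    have l2 := HasFDerivAt.comp_hasDerivAt (l := F) (f := fun t : ℝ => ((x, x, ((t, x2), y)) : E5)) y1
      hF.differentiableAt.hasFDerivAt l1
    have l3 := ((line_snd M x y1 (hM x y1 hx hy1).1).mul_const (M (x2, y))).div
      (line_snd M x2 y1 (hM x2 y1 hx2 hy1).1) c2
    have l4 := l2.unique (l3.congr_of_eventuallyEq (by
      filter_upwards [n1] with t ht
      exact hFM x2 t hx2 ht))
    rw [l4]; field_simp
  · have l1 : HasDerivAt (fun t : ℝ => ((x, x, ((y1, t), y)) : E5)) (0, 0, ((0, 1), 0)) x2 :=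
      (hasDerivAt_const _ _).prodMk ((hasDerivAt_const _ _).prodMk
        (((hasDerivAt_const _ _).prodMk (hasDerivAt_id x2)).prodMk (hasDerivAt_const _ _)))
    have l2 := HasFDerivAt.comp_hasDerivAt (l := F) (f := fun t : ℝ => ((x, x, ((y1, t), y)) : E5)) x2
      hF.differentiableAt.hasFDerivAt l1
    have l3 := ((line_fst M x2 y (hM x2 y hx2 hy).1).const_mul (M (x, y1))).div
      (line_fst M x2 y1 (hM x2 y1 hx2 hy1).1) c2
    have l4 := l2.unique (l3.congr_of_eventuallyEq (by
      filter_upwards [n2] with t ht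
      exact hFM t y1 ht hy1))
    rw [l4]; field_simp

theorem dich_alg (μ1 μ2 L1 L2 : ℝ → ℝ → ℝ) (I Jv : Set ℝ)
    (h : ∀ x ∈ I, ∀ x2 ∈ I, ∀ y ∈ Jv, ∀ y1 ∈ Jv,
      (μ2 x y1 - μ2 x2 y1) * (L1 x2 y - L1 x2 y1) = (μ1 x2 y - μ1 x2 y1) * (L2 x y1 - L2 x2 y1)) :
    (∀ x ∈ I, ∀ y ∈ Jv, ∀ y' ∈ Jv, μ1 x y = μ1 x y') ∨
    ∃ τ : ℝ, ∀ x ∈ I, ∀ x' ∈ I, ∀ y ∈ Jv, L2 x y - τ * μ2 x y = L2 x' y - τ * μ2 x' y := by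
  by_cases hc : ∀ x ∈ I, ∀ y ∈ Jv, ∀ y' ∈ Jv, μ1 x y = μ1 x y'
  · exact Or.inl hc
  · right
    push Not at hc
    obtain ⟨x2, hx2, y, hy, y', hy', hne⟩ := hc
    have hne' : μ1 x2 y - μ1 x2 y' ≠ 0 := sub_ne_zero.2 hne
    refine ⟨(L1 x2 y - L1 x2 y') / (μ1 x2 y - μ1 x2 y'), fun x hx x' hx' y1 hy1 => ?_⟩
    have e : (μ2 x y1 - μ2 x' y1) * (L1 x2 y - L1 x2 y') =
        (μ1 x2 y - μ1 x2 y') * (L2 x y1 - L2 x' y1) := by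
      linear_combination h x hx x2 hx2 y hy y1 hy1 - h x' hx' x2 hx2 y hy y1 hy1
        - h x hx x2 hx2 y' hy' y1 hy1 + h x' hx' x2 hx2 y' hy' y1 hy1
    field_simp
    linear_combination -e

/-- separation from derivative independence -/
theorem sep_of_deriv (g g' : ℝ → ℝ → ℝ) (u0 v0 R : ℝ)
    (hd : ∀ x y, |x - u0| < R → |y - v0| < R → HasDerivAt (fun t => g x t) (g' x y) y)
    (hi : ∀ x x' y, |x - u0| < R → |x' - u0| < R → |y - v0| < R → g' x y = g' x' y)
    (x y : ℝ) (hx : |x - u0| < R) (hy : |y - v0| < R) : g x y + g u0 v0 = g x v0 + g u0 y := by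
  have hR : 0 < R := (abs_nonneg _).trans_lt hx
  obtain ⟨s, hs, e⟩ := mvt_uIcc (fun t => g x t - g u0 t) (fun t => g' x t - g' u0 t) v0 y (by
    intro t ht
    have ht' : |t - v0| < R := (abs_sub_left_of_mem_uIcc ht).trans_lt hy
    exact (hd x t hx ht').sub (hd u0 t (by simpa using hR) ht'))
  have hs' : |s - v0| < R := (abs_sub_left_of_mem_uIcc hs).trans_lt hy
  simp only [hi x u0 s hx (by simpa using hR) hs'] at e
  linarith

theorem log_line_snd (M : ℝ × ℝ → ℝ) (x y : ℝ) (h : AnalyticAt ℝ M (x, y)) (h0 : M (x, y) ≠ 0) :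
    HasDerivAt (fun t => Real.log |M (x, t)|) (fderiv ℝ M (x, y) (0, 1) / M (x, y)) y := by
  simp only [Real.log_abs]
  exact (line_snd M x y h).log h0

theorem log_line_fst (M : ℝ × ℝ → ℝ) (x y : ℝ) (h : AnalyticAt ℝ M (x, y)) (h0 : M (x, y) ≠ 0) :
    HasDerivAt (fun t => Real.log |M (t, y)|) (fderiv ℝ M (x, y) (1, 0) / M (x, y)) x := by
  simp only [Real.log_abs]
  exact (line_fst M x y h).log h0

def Mf (η φh : ℝ × ℝ → ℝ) (p : ℝ × ℝ) : ℝ := fderiv ℝ η (p.1, φh p) (1, 0)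

def Af (αh φh : ℝ × ℝ → ℝ) (p : ℝ × ℝ) : ℝ := αh (p.1, φh p)

theorem inv_deriv (η ξ : ℝ × ℝ → ℝ) (u0 v0 w0 : ℝ)
    (hη : AnalyticAt ℝ η (u0, w0)) (hξ : AnalyticAt ℝ ξ (v0, w0)) (e1 : η (u0, w0) = v0)
    (h1 : ∀ᶠ p in nhds (u0, w0), ξ (η p, p.2) = p.1) :
    ∀ᶠ q in nhds (u0, w0), fderiv ℝ ξ (η q, q.2) (1, 0) * fderiv ℝ η q (1, 0) = 1 := by
  have c : ContinuousAt (fun q : ℝ × ℝ => (η q, q.2)) (u0, w0) :=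
    hη.continuousAt.prodMk continuousAt_snd
  have a2 : ∀ᶠ q in nhds (u0, w0), AnalyticAt ℝ ξ (η q, q.2) :=
    c.eventually (p := fun z => AnalyticAt ℝ ξ z) (by simpa only [e1] using hξ.eventually_analyticAt)
  filter_upwards [hη.eventually_analyticAt, a2, h1.eventually_nhds] with q k1 k2 k3
  obtain ⟨x, z⟩ := q
  have d1 := line_fst η x z k1
  have d2 := line_fst ξ (η (x, z)) z k2
  have d3 := HasDerivAt.comp (h₂ := fun t => ξ (t, z)) (h := fun t => η (t, z)) x d2 d1
  have d4 : HasDerivAt (fun t : ℝ => t) (1:ℝ) x := hasDerivAt_id x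
  have c2 : ContinuousAt (fun t : ℝ => ((t, z) : ℝ × ℝ)) x := by fun_prop
  have d5 : (fun t : ℝ => ξ (η (t, z), z)) =ᶠ[nhds x] fun t => t := c2.eventually k3
  exact d3.unique (d4.congr_of_eventuallyEq d5)

theorem Vf_deriv (η ξ φh : ℝ × ℝ → ℝ) (x x2 y1 y : ℝ)
    (hV : AnalyticAt ℝ (Vf η ξ φh) (x, x, ((y1, x2), y)))
    (g1 : AnalyticAt ℝ η (x, φh (x, y1))) (g2 : AnalyticAt ℝ ξ (y1, φh (x2, y1)))
    (g3 : AnalyticAt ℝ η (x2, φh (x2, y)))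
    (g4 : η (x, φh (x, y1)) = y1) (g5 : ξ (y1, φh (x2, y1)) = x2)
    (g6 : fderiv ℝ ξ (y1, φh (x2, y1)) (1, 0) * Mf η φh (x2, y1) = 1) :
    hV5 (Vf η ξ φh) (x, x, ((y1, x2), y)) =
      Mf η φh (x, y1) * Mf η φh (x2, y) / Mf η φh (x2, y1) := by
  have l1 : HasDerivAt (fun t : ℝ => ((t, x, ((y1, x2), y)) : E5)) (1, 0, 0) x :=
    (hasDerivAt_id x).prodMk ((hasDerivAt_const _ _).prodMk (hasDerivAt_const _ _))
  have l2 := HasFDerivAt.comp_hasDerivAt (l := Vf η ξ φh)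
    (f := fun t : ℝ => ((t, x, ((y1, x2), y)) : E5)) x hV.differentiableAt.hasFDerivAt l1
  have d1 := line_fst η x _ g1
  have d2 := line_fst ξ y1 _ g2
  have d3 := line_fst η x2 _ g3
  have e1 := HasDerivAt.comp (h₂ := fun t => ξ (t, φh (x2, y1))) (h := fun t => η (t, φh (x, y1))) x
    (by simpa only [g4] using d2) d1
  have e2 := HasDerivAt.comp (h₂ := fun t => η (t, φh (x2, y)))
    (h := fun t => ξ (η (t, φh (x, y1)), φh (x2, y1))) x
    (by simpa only [g4, g5] using d3) e1
  have e3 := l2.unique e2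
  have hne : Mf η φh (x2, y1) ≠ 0 := right_ne_zero_of_mul_eq_one g6
  have g6' : fderiv ℝ ξ (y1, φh (x2, y1)) (1, 0) = 1 / Mf η φh (x2, y1) := by
    field_simp; exact g6
  rw [show hV5 (Vf η ξ φh) (x, x, ((y1, x2), y)) =
    fderiv ℝ (Vf η ξ φh) (x, x, ((y1, x2), y)) (1, 0, 0) from rfl, e3, g6']
  simp only [Mf]
  ring

set_option maxHeartbeats 1000000 in
theorem dichotomy (η ξ φh αh : ℝ × ℝ → ℝ) (u0 v0 w0 : ℝ)
    (hη : AnalyticAt ℝ η (u0, w0)) (hξ : AnalyticAt ℝ ξ (v0, w0)) (hφ : AnalyticAt ℝ φh (u0, v0))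
    (hα : AnalyticAt ℝ αh (u0, w0)) (hα0 : αh (u0, w0) ≠ 0)
    (h1 : ∀ᶠ p in nhds (u0, w0), ξ (η p, p.2) = p.1)
    (h4 : ∀ᶠ p in nhds (u0, v0), η (p.1, φh p) = p.2)
    (e1 : η (u0, w0) = v0) (e2 : ξ (v0, w0) = u0) (e3 : φh (u0, v0) = w0)
    (hJ : ∀ᶠ w in nhds ((u0, ((v0, u0), v0)) : ℝ × ((ℝ × ℝ) × ℝ)),
      J5 (Vf η ξ φh) (ef φh αh) (w.1, w.1, w.2) = 0) :
    ∃ R > 0, (∀ x y, |x - u0| < R → |y - v0| < R →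
        AnalyticAt ℝ (Mf η φh) (x, y) ∧ Mf η φh (x, y) ≠ 0) ∧
      (∀ x y, |x - u0| < R → |y - v0| < R →
        AnalyticAt ℝ (Af αh φh) (x, y) ∧ Af αh φh (x, y) ≠ 0) ∧
      ((∀ x y, |x - u0| < R → |y - v0| < R →
        Real.log |Mf η φh (x, y)| + Real.log |Mf η φh (u0, v0)| =
        Real.log |Mf η φh (x, v0)| + Real.log |Mf η φh (u0, y)|) ∨
      ∃ τ : ℝ, ∀ x y, |x - u0| < R → |y - v0| < R →
        (Real.log |Af αh φh (x, y)| - τ * Real.log |Mf η φh (x, y)|) +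
        (Real.log |Af αh φh (u0, v0)| - τ * Real.log |Mf η φh (u0, v0)|) =
        (Real.log |Af αh φh (x, v0)| - τ * Real.log |Mf η φh (x, v0)|) +
        (Real.log |Af αh φh (u0, y)| - τ * Real.log |Mf η φh (u0, y)|)) := by
  have aP : AnalyticAt ℝ (fun p : ℝ × ℝ => ((p.1, φh p) : ℝ × ℝ)) (u0, v0) :=
    analyticAt_fst.prod hφ
  have c1 := aP.continuousAt
  have aQ : AnalyticAt ℝ (fun p : ℝ × ℝ => ((p.2, φh p) : ℝ × ℝ)) (u0, v0) :=
    analyticAt_snd.prod hφ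
  have G1 : ∀ᶠ p in nhds (u0, v0), AnalyticAt ℝ η (p.1, φh p) :=
    c1.eventually (p := fun z => AnalyticAt ℝ η z) (by simpa only [e3] using hη.eventually_analyticAt)
  have G2 : ∀ᶠ p in nhds (u0, v0), AnalyticAt ℝ ξ (p.2, φh p) :=
    aQ.continuousAt.eventually (p := fun z => AnalyticAt ℝ ξ z)
      (by simpa only [e3] using hξ.eventually_analyticAt)
  have G3 : ∀ᶠ p in nhds (u0, v0), ξ (η (p.1, φh p), φh p) = p.1 :=
    c1.eventually (p := fun z => ξ (η z, z.2) = z.1) (by simpa only [e3] using h1)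
  have G4 : ∀ᶠ p in nhds (u0, v0),
      fderiv ℝ ξ (η (p.1, φh p), φh p) (1, 0) * fderiv ℝ η (p.1, φh p) (1, 0) = 1 :=
    c1.eventually (p := fun z => fderiv ℝ ξ (η z, z.2) (1, 0) * fderiv ℝ η z (1, 0) = 1)
      (by simpa only [e3] using inv_deriv η ξ u0 v0 w0 hη hξ e1 h1)
  have aA : AnalyticAt ℝ (Af αh φh) (u0, v0) :=
    AnalyticAt.comp (g := αh) (f := fun p : ℝ × ℝ => ((p.1, φh p) : ℝ × ℝ))
      (by simpa only [e3] using hα) aP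
  have aM : AnalyticAt ℝ (Mf η φh) (u0, v0) := by
    have : AnalyticAt ℝ (fun q => fderiv ℝ η q (1, 0)) (u0, w0) :=
      ((ContinuousLinearMap.apply ℝ ℝ ((1, 0) : ℝ × ℝ)).analyticAt _).comp hη.fderiv
    exact AnalyticAt.comp (g := fun q => fderiv ℝ η q (1, 0))
      (f := fun p : ℝ × ℝ => ((p.1, φh p) : ℝ × ℝ)) (by simpa only [e3] using this) aP
  have A0 : ∀ᶠ p in nhds (u0, v0), Af αh φh p ≠ 0 :=
    aA.continuousAt.eventually_ne (by simpa only [Af, e3] using hα0)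
  have hVa : AnalyticAt ℝ (Vf η ξ φh) (u0, u0, ((v0, u0), v0)) :=
    Vf_analytic η ξ φh u0 v0 w0 hη hξ hφ e1 e2 e3
  have hea : AnalyticAt ℝ (ef φh αh) (u0, u0, ((v0, u0), v0)) :=
    ef_analytic φh αh u0 v0 w0 hφ hα hα0 e3
  have cd : ContinuousAt (fun w : ℝ × ((ℝ × ℝ) × ℝ) => ((w.1, w.1, w.2) : E5)) (u0, ((v0, u0), v0)) := by
    fun_prop
  have hVa' := cd.eventually hVa.eventually_analyticAt
  have hea' := cd.eventually hea.eventually_analyticAt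
  obtain ⟨R1, hR1, k1⟩ := Metric.eventually_nhds_iff_ball.1
    (G1.and (G2.and (G3.and (G4.and (h4.and (aA.eventually_analyticAt.and
      (aM.eventually_analyticAt.and A0)))))))
  obtain ⟨R2, hR2, k2⟩ := Metric.eventually_nhds_iff_ball.1 (hVa'.and (hea'.and hJ))
  set R := min R1 R2 with hR
  have hR0 : 0 < R := by positivity
  have kk : ∀ x y, |x - u0| < R → |y - v0| < R → AnalyticAt ℝ η (x, φh (x, y)) ∧
      AnalyticAt ℝ ξ (y, φh (x, y)) ∧ ξ (y, φh (x, y)) = x ∧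
      fderiv ℝ ξ (y, φh (x, y)) (1, 0) * Mf η φh (x, y) = 1 ∧ η (x, φh (x, y)) = y ∧
      AnalyticAt ℝ (Af αh φh) (x, y) ∧ AnalyticAt ℝ (Mf η φh) (x, y) ∧ Af αh φh (x, y) ≠ 0 := by
    intro x y hx hy
    have hm : ((x, y) : ℝ × ℝ) ∈ Metric.ball (u0, v0) R1 := by
      rw [Metric.mem_ball]
      simp only [Prod.dist_eq, Real.dist_eq, max_lt_iff]
      exact ⟨hx.trans_le (min_le_left _ _), hy.trans_le (min_le_left _ _)⟩
    obtain ⟨a1, a2, a3, a4, a5, a6, a7, a8⟩ := k1 _ hm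
    simp only at a1 a2 a3 a4 a5
    rw [a5] at a3 a4
    exact ⟨a1, a2, a3, a4, a5, a6, a7, a8⟩
  have hM : ∀ x y, |x - u0| < R → |y - v0| < R →
        AnalyticAt ℝ (Mf η φh) (x, y) ∧ Mf η φh (x, y) ≠ 0 := fun x y hx hy =>
    ⟨(kk x y hx hy).2.2.2.2.2.2.1, right_ne_zero_of_mul_eq_one (kk x y hx hy).2.2.2.1⟩
  have hA : ∀ x y, |x - u0| < R → |y - v0| < R →
        AnalyticAt ℝ (Af αh φh) (x, y) ∧ Af αh φh (x, y) ≠ 0 := fun x y hx hy =>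
    ⟨(kk x y hx hy).2.2.2.2.2.1, (kk x y hx hy).2.2.2.2.2.2.2⟩
  refine ⟨R, hR0, hM, hA, ?_⟩
  have hbig : ∀ x x2 y y1, |x - u0| < R → |x2 - u0| < R → |y - v0| < R → |y1 - v0| < R →
      AnalyticAt ℝ (Vf η ξ φh) (x, x, ((y1, x2), y)) ∧ AnalyticAt ℝ (ef φh αh) (x, x, ((y1, x2), y)) ∧
      J5 (Vf η ξ φh) (ef φh αh) (x, x, ((y1, x2), y)) = 0 := by
    intro x x2 y y1 hx hx2 hy hy1
    have hm : ((x, ((y1, x2), y)) : ℝ × ((ℝ × ℝ) × ℝ)) ∈ Metric.ball (u0, ((v0, u0), v0)) R2 := by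
      rw [Metric.mem_ball]
      simp only [Prod.dist_eq, Real.dist_eq, max_lt_iff]
      have := min_le_right R1 R2
      exact ⟨by linarith, ⟨by linarith, by linarith⟩, by linarith⟩
    exact k2 _ hm
  have hVd : ∀ x x2 y y1, |x - u0| < R → |x2 - u0| < R → |y - v0| < R → |y1 - v0| < R →
      hV5 (Vf η ξ φh) (x, x, ((y1, x2), y)) =
      Mf η φh (x, y1) * Mf η φh (x2, y) / Mf η φh (x2, y1) := by
    intro x x2 y y1 hx hx2 hy hy1
    obtain ⟨a1, a2, a3, a4, a5, -⟩ := kk x y1 hx hy1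
    obtain ⟨b1, b2, b3, b4, b5, -⟩ := kk x2 y1 hx2 hy1
    exact Vf_deriv η ξ φh x x2 y1 y (hbig x x2 y y1 hx hx2 hy hy1).1 a1 b2 (kk x2 y hx2 hy).1
      a5 b3 b4
  have rel := dich_alg (fun x y => fderiv ℝ (Mf η φh) (x, y) (1, 0) / Mf η φh (x, y))
    (fun x y => fderiv ℝ (Mf η φh) (x, y) (0, 1) / Mf η φh (x, y))
    (fun x y => fderiv ℝ (Af αh φh) (x, y) (1, 0) / Af αh φh (x, y))
    (fun x y => fderiv ℝ (Af αh φh) (x, y) (0, 1) / Af αh φh (x, y))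
    {x | |x - u0| < R} {y | |y - v0| < R} (by
      intro x hx x2 hx2 y hy y1 hy1
      simp only [mem_ofPred_eq] at hx hx2 hy hy1
      obtain ⟨v1, v2, v3⟩ := hbig x x2 y y1 hx hx2 hy hy1
      obtain ⟨p1, p2⟩ := diag_derivs (hV5 (Vf η ξ φh)) (Mf η φh) u0 v0 R hM x x2 y1 y hx hx2 hy1 hy
        (hV5_analytic _ _ v1) (fun x2 y1 q1 q2 => hVd x x2 y y1 hx q1 hy q2)
      obtain ⟨p3, p4⟩ := diag_derivs (ef φh αh) (Af αh φh) u0 v0 R hA x x2 y1 y hx hx2 hy1 hy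
        v2 (fun x2 y1 q1 q2 => rfl)
      rw [J5, p1, p2, p3, p4] at v3
      have q1 := (hM x y1 hx hy1).2
      have q2 := (hM x2 y1 hx2 hy1).2
      have q3 := (hM x2 y hx2 hy).2
      have r1 := (hA x y1 hx hy1).2
      have r2 := (hA x2 y1 hx2 hy1).2
      have r3 := (hA x2 y hx2 hy).2
      have nz : Mf η φh (x, y1) * Mf η φh (x2, y) / Mf η φh (x2, y1) *
        (Af αh φh (x, y1) * Af αh φh (x2, y) / Af αh φh (x2, y1)) ≠ 0 := by positivity
      apply mul_left_cancel₀ nz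
      linear_combination v3)
  simp only [mem_ofPred_eq] at rel
  rcases rel with rel | ⟨τ, rel⟩
  · left
    intro x y hx hy
    have := sep_of_deriv (fun y x => Real.log |Mf η φh (x, y)|)
      (fun y x => fderiv ℝ (Mf η φh) (x, y) (1, 0) / Mf η φh (x, y)) v0 u0 R
      (fun y x hy hx => log_line_fst _ x y (hM x y hx hy).1 (hM x y hx hy).2)
      (fun y y' x hy hy' hx => rel x hx y hy y' hy') y x hy hx
    linarith
  · right
    refine ⟨τ, fun x y hx hy => ?_⟩
    exact sep_of_deriv (fun x y => Real.log |Af αh φh (x, y)| - τ * Real.log |Mf η φh (x, y)|)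
      (fun x y => fderiv ℝ (Af αh φh) (x, y) (0, 1) / Af αh φh (x, y)
        - τ * (fderiv ℝ (Mf η φh) (x, y) (0, 1) / Mf η φh (x, y))) u0 v0 R
      (fun x y hx hy => (log_line_snd _ x y (hA x y hx hy).1 (hA x y hx hy).2).sub
        ((log_line_snd _ x y (hM x y hx hy).1 (hM x y hx hy).2).const_mul τ))
      (fun x x' y hx hx' hy => rel x hx x' hx' y hy) x y hx hy

abbrev E2 := EuclideanSpace ℝ (Fin 2)

theorem indep_inj (L1 L2 : E2 →L[ℝ] ℝ) (h : LinearIndependent ℝ ![L1, L2]) :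
    Function.Injective (L1.prod L2 : E2 →L[ℝ] ℝ × ℝ) := by
  have hs : Function.Surjective ((L1.prod L2 : E2 →L[ℝ] ℝ × ℝ) : E2 →ₗ[ℝ] ℝ × ℝ) := by
    rw [← LinearMap.range_eq_top]
    by_contra hne
    obtain ⟨f, hf0, hf⟩ := Submodule.exists_le_ker_of_lt_top _ (lt_top_iff_ne_top.2 hne)
    have key : f (1, 0) • L1 + f (0, 1) • L2 = 0 := by
      ext v
      have h1 : f (L1 v, L2 v) = 0 := hf ⟨v, rfl⟩
      have h2 : ((L1 v, L2 v) : ℝ × ℝ) = L1 v • ((1, 0) : ℝ × ℝ) + L2 v • ((0, 1) : ℝ × ℝ) := by simp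
      rw [h2, map_add, map_smul, map_smul] at h1
      simp only [smul_eq_mul] at h1
      simp
      linarith
    obtain ⟨k1, k2⟩ := LinearIndependent.pair_iff.1 h _ _ key
    apply hf0
    ext
    · simpa using k1
    · simpa using k2
  exact (LinearMap.injective_iff_surjective_of_finrank_eq_finrank (by simp)).2 hs

theorem chart_exists (g1 g2 : E2 → ℝ) (p0 : E2) (h1 : AnalyticAt ℝ g1 p0) (h2 : AnalyticAt ℝ g2 p0)
    (hi : LinearIndependent ℝ ![fderiv ℝ g1 p0, fderiv ℝ g2 p0]) :
    ∃ κ : ℝ × ℝ → E2, AnalyticAt ℝ κ (g1 p0, g2 p0) ∧ κ (g1 p0, g2 p0) = p0 ∧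
      (∀ᶠ p in nhds p0, κ (g1 p, g2 p) = p) ∧
      (∀ᶠ q in nhds (g1 p0, g2 p0), g1 (κ q) = q.1 ∧ g2 (κ q) = q.2) := by
  set g : E2 → ℝ × ℝ := fun p => (g1 p, g2 p) with hg
  have hga : AnalyticAt ℝ g p0 := h1.prod h2
  set L : E2 →L[ℝ] ℝ × ℝ := (fderiv ℝ g1 p0).prod (fderiv ℝ g2 p0) with hL
  have hgd : HasFDerivAt g L p0 :=
    h1.differentiableAt.hasFDerivAt.prodMk h2.differentiableAt.hasFDerivAt
  set e : E2 ≃L[ℝ] ℝ × ℝ := (LinearMap.linearEquivOfInjective (L : E2 →ₗ[ℝ] ℝ × ℝ)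
    (indep_inj _ _ hi) (by simp)).toContinuousLinearEquiv with he
  have heL : (e : E2 →L[ℝ] ℝ × ℝ) = L := by
    ext v <;> rfl
  rw [← heL] at hgd
  have hc : ContDiffAt ℝ ⊤ g p0 := hga.contDiffAt
  have hst := hc.hasStrictFDerivAt' hgd (by simp)
  refine ⟨hc.localInverse hgd (by simp), ?_, hc.localInverse_apply_image hgd (by simp), ?_, ?_⟩
  · have := hc.to_localInverse hgd (by simp)
    exact this.analyticAt
  · exact hst.eventually_left_inverse
  · filter_upwards [hst.eventually_right_inverse] with q hq
    exact Prod.ext_iff.1 hq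

structure WebLoc (gj gi gk aj ai : E2 → ℝ) (p0 : E2) (κ : ℝ × ℝ → E2) (η ξ φh αh : ℝ × ℝ → ℝ) :
    Prop where
  hη : AnalyticAt ℝ η (gj p0, gk p0)
  hξ : AnalyticAt ℝ ξ (gi p0, gk p0)
  hφ : AnalyticAt ℝ φh (gj p0, gi p0)
  hα : AnalyticAt ℝ αh (gj p0, gk p0)
  hα0 : αh (gj p0, gk p0) ≠ 0
  h1 : ∀ᶠ p in nhds (gj p0, gk p0), ξ (η p, p.2) = p.1
  h2 : ∀ᶠ p in nhds (gi p0, gk p0), η (ξ p, p.2) = p.1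
  h3 : ∀ᶠ p in nhds (gj p0, gk p0), φh (p.1, η p) = p.2
  h4 : ∀ᶠ p in nhds (gj p0, gi p0), η (p.1, φh p) = p.2
  e1 : η (gj p0, gk p0) = gi p0
  e2 : ξ (gi p0, gk p0) = gj p0
  e3 : φh (gj p0, gi p0) = gk p0
  κa : AnalyticAt ℝ κ (gj p0, gk p0)
  κ0 : κ (gj p0, gk p0) = p0
  κl : ∀ᶠ p in nhds p0, κ (gj p, gk p) = p
  κr : ∀ᶠ q in nhds (gj p0, gk p0), gj (κ q) = q.1 ∧ gk (κ q) = q.2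
  rη : ∀ᶠ p in nhds p0, η (gj p, gk p) = gi p
  rφ : ∀ᶠ p in nhds p0, φh (gj p, gi p) = gk p
  rα : ∀ᶠ p in nhds p0, αh (gj p, gk p) = -(ai p / aj p)
  ηκ : ∀ q, η q = gi (κ q)
  ακ : ∀ q, αh q = -(ai (κ q) / aj (κ q))

theorem webLoc_exists (gj gi gk aj ai : E2 → ℝ) (p0 : E2)
    (hj : AnalyticAt ℝ gj p0) (hi : AnalyticAt ℝ gi p0) (hk : AnalyticAt ℝ gk p0)
    (haj : AnalyticAt ℝ aj p0) (hai : AnalyticAt ℝ ai p0) (haj0 : aj p0 ≠ 0) (hai0 : ai p0 ≠ 0)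
    (ijk : LinearIndependent ℝ ![fderiv ℝ gj p0, fderiv ℝ gk p0])
    (iik : LinearIndependent ℝ ![fderiv ℝ gi p0, fderiv ℝ gk p0])
    (iji : LinearIndependent ℝ ![fderiv ℝ gj p0, fderiv ℝ gi p0]) :
    ∃ κ η ξ φh αh, WebLoc gj gi gk aj ai p0 κ η ξ φh αh := by
  obtain ⟨κ, a1, z1, l1, r1⟩ := chart_exists gj gk p0 hj hk ijk
  obtain ⟨κ2, a2, z2, l2, r2⟩ := chart_exists gi gk p0 hi hk iik
  obtain ⟨κ3, a3, z3, l3, r3⟩ := chart_exists gj gi p0 hj hi iji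
  have t1 : Filter.Tendsto κ (nhds (gj p0, gk p0)) (nhds p0) := by
    simpa only [ContinuousAt, z1] using a1.continuousAt
  have t2 : Filter.Tendsto κ2 (nhds (gi p0, gk p0)) (nhds p0) := by
    simpa only [ContinuousAt, z2] using a2.continuousAt
  have t3 : Filter.Tendsto κ3 (nhds (gj p0, gi p0)) (nhds p0) := by
    simpa only [ContinuousAt, z3] using a3.continuousAt
  refine ⟨κ, fun q => gi (κ q), fun q => gj (κ2 q), fun q => gk (κ3 q),
    fun q => -(ai (κ q) / aj (κ q)), ?_⟩
  constructor
  · exact AnalyticAt.comp (g := gi) (f := κ) (by rwa [z1]) a1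
  · exact AnalyticAt.comp (g := gj) (f := κ2) (by rwa [z2]) a2
  · exact AnalyticAt.comp (g := gk) (f := κ3) (by rwa [z3]) a3
  · exact ((AnalyticAt.comp (g := ai) (f := κ) (by rwa [z1]) a1).div
      (AnalyticAt.comp (g := aj) (f := κ) (by rwa [z1]) a1) (by simpa only [Function.comp, z1] using haj0)).neg
  · simp only [z1]
    exact neg_ne_zero.2 (div_ne_zero hai0 haj0)
  · filter_upwards [t1.eventually l2, r1] with q k1 k2
    rw [k2.2] at k1
    simp only [k1, k2.1]
  · filter_upwards [t2.eventually l1, r2] with q k1 k2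
    rw [k2.2] at k1
    simp only [k1, k2.1]
  · filter_upwards [t1.eventually l3, r1] with q k1 k2
    rw [k2.1] at k1
    simp only [k1, k2.2]
  · filter_upwards [t3.eventually l1, r3] with q k1 k2
    rw [k2.1] at k1
    simp only [k1, k2.2]
  · simp only [z1]
  · simp only [z2]
  · simp only [z3]
  · exact a1
  · exact z1
  · exact l1
  · exact r1
  · filter_upwards [l1] with p h
    simp only [h]
  · filter_upwards [l3] with p h
    simp only [h]
  · filter_upwards [l1] with p h
    simp only [h]
  · intro q; rfl
  · intro q; rfl

theorem inj_near (ψ f : ℝ → ℝ) (t0 : ℝ) (hd : ∀ᶠ t in nhds t0, HasDerivAt ψ (f t) t)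
    (hf : ContinuousAt f t0) (h0 : f t0 ≠ 0) : ∃ r > 0, InjOn ψ (Metric.ball t0 r) := by
  obtain ⟨r, hr, h⟩ := Metric.eventually_nhds_iff_ball.1 (hd.and (hf.eventually_ne h0))
  refine ⟨r, hr, fun a ha b hb hab => ?_⟩
  have hseg : uIcc a b ⊆ Metric.ball t0 r := by
    rw [← segment_eq_uIcc]
    exact (convex_ball t0 r).segment_subset ha hb
  obtain ⟨s, hs, e⟩ := mvt_uIcc ψ f a b (fun t ht => (h t (hseg ht)).1)
  rw [hab, sub_self] at e
  have := (mul_eq_zero.1 e.symm).resolve_left (h s (hseg hs)).2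
  linarith

theorem sign_sep (m0 m1 m2 m3 : ℝ) (h0 : m0 ≠ 0) (h1 : 0 < m0 * m1) (h2 : 0 < m0 * m2)
    (h3 : 0 < m0 * m3)
    (h : Real.log |m1| + Real.log |m0| = Real.log |m2| + Real.log |m3|) : m1 * m0 = m2 * m3 := by
  have n1 : m1 ≠ 0 := right_ne_zero_of_mul h1.ne'
  have n2 : m2 ≠ 0 := right_ne_zero_of_mul h2.ne'
  have n3 : m3 ≠ 0 := right_ne_zero_of_mul h3.ne'
  rw [← Real.log_mul (abs_ne_zero.2 n1) (abs_ne_zero.2 h0),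
    ← Real.log_mul (abs_ne_zero.2 n2) (abs_ne_zero.2 n3), ← abs_mul, ← abs_mul] at h
  have h' := Real.log_injOn_pos (abs_pos.2 (mul_ne_zero n1 h0)) (abs_pos.2 (mul_ne_zero n2 n3)) h
  rw [abs_of_pos (by linarith), abs_of_pos] at h'
  · exact h'
  · have : 0 < (m0 * m0) * (m2 * m3) := by nlinarith
    exact (mul_pos_iff_of_pos_left (mul_self_pos.2 h0)).1 this

theorem flat_sum (η φh : ℝ × ℝ → ℝ) (u0 v0 w0 R : ℝ) (hR : 0 < R)
    (hη : AnalyticAt ℝ η (u0, w0))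
    (h3 : ∀ᶠ p in nhds (u0, w0), φh (p.1, η p) = p.2)
    (e1 : η (u0, w0) = v0)
    (hM : ∀ x y, |x - u0| < R → |y - v0| < R →
        AnalyticAt ℝ (Mf η φh) (x, y) ∧ Mf η φh (x, y) ≠ 0)
    (hs : ∀ x y, |x - u0| < R → |y - v0| < R →
        Real.log |Mf η φh (x, y)| + Real.log |Mf η φh (u0, v0)| =
        Real.log |Mf η φh (x, v0)| + Real.log |Mf η φh (u0, y)|)
    (ψ1 ψ2 : ℝ → ℝ)
    (d1 : ∀ᶠ t in nhds u0, HasDerivAt ψ1 (Mf η φh (t, v0)) t)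
    (d2 : ∀ᶠ t in nhds v0, HasDerivAt ψ2 (-(Mf η φh (u0, v0) / Mf η φh (u0, t))) t) :
    ∀ᶠ q in nhds (u0, w0), ψ1 q.1 + ψ2 (η q) = ψ1 u0 + ψ2 (η (u0, q.2)) := by
  have hM0 := hM u0 v0 (by simpa using hR) (by simpa using hR)
  have cη : Filter.Tendsto η (nhds (u0, w0)) (nhds v0) := by
    simpa only [ContinuousAt, e1] using hη.continuousAt
  have pos : ∀ᶠ p in nhds (u0, v0), 0 < Mf η φh (u0, v0) * Mf η φh p := by
    have : ContinuousAt (fun p => Mf η φh (u0, v0) * Mf η φh p) (u0, v0) :=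
      continuousAt_const.mul hM0.1.continuousAt
    exact this.eventually_const_lt (mul_self_pos.2 hM0.2)
  obtain ⟨R1, hR1, k1⟩ := Metric.eventually_nhds_iff_ball.1 pos
  have cη1 : ∀ᶠ q in nhds (u0, w0), |η q - v0| < min R R1 := by
    have : ∀ᶠ y in nhds v0, |y - v0| < min R R1 := by
      have : ContinuousAt (fun t : ℝ => |t - v0|) v0 := by fun_prop
      exact this.eventually_lt_const (by simp; exact ⟨hR, hR1⟩)
    exact cη.eventually this
  have d1' : ∀ᶠ q in nhds (u0, w0), HasDerivAt ψ1 (Mf η φh (q.1, v0)) q.1 :=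
    (continuousAt_fst (p := (u0, w0))).eventually d1
  obtain ⟨R2, hR2, k2⟩ := Metric.eventually_nhds_iff_ball.1
    (hη.eventually_analyticAt.and (h3.and (cη1.and (d1'.and (cη.eventually d2)))))
  have hrr : 0 < min (min R R1) R2 := by positivity
  filter_upwards [Metric.ball_mem_nhds (u0, w0) hrr] with q hq
  obtain ⟨x, z⟩ := q
  rw [Metric.mem_ball] at hq
  simp only [Prod.dist_eq, Real.dist_eq, max_lt_iff] at hq
  obtain ⟨s, hs', e⟩ := mvt_uIcc (fun t => ψ1 t + ψ2 (η (t, z))) (fun _ => 0) u0 x (by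
    intro t ht
    have ht1 : |t - u0| < min (min R R1) R2 := (abs_sub_left_of_mem_uIcc ht).trans_lt hq.1
    have hm : ((t, z) : ℝ × ℝ) ∈ Metric.ball (u0, w0) R2 := by
      rw [Metric.mem_ball]
      simp only [Prod.dist_eq, Real.dist_eq, max_lt_iff]
      exact ⟨ht1.trans_le (min_le_right _ _), hq.2.trans_le (min_le_right _ _)⟩
    obtain ⟨b1, b2, b3, b4, b5⟩ := k2 _ hm
    simp only at b2 b4
    have tR : |t - u0| < R := ht1.trans_le ((min_le_left _ _).trans (min_le_left _ _))
    have tR1 : |t - u0| < R1 := ht1.trans_le ((min_le_left _ _).trans (min_le_right _ _))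
    have yR : |η (t, z) - v0| < R := b3.trans_le (min_le_left _ _)
    have yR1 : |η (t, z) - v0| < R1 := b3.trans_le (min_le_right _ _)
    have hb : ∀ a b, |a - u0| < R1 → |b - v0| < R1 → 0 < Mf η φh (u0, v0) * Mf η φh (a, b) := by
      intro a b h1 h2
      apply k1
      rw [Metric.mem_ball]
      simp only [Prod.dist_eq, Real.dist_eq, max_lt_iff]
      exact ⟨h1, h2⟩
    have ss := sign_sep _ _ _ _ hM0.2 (hb t (η (t, z)) tR1 yR1) (hb t v0 tR1 (by simpa using hR1))
      (hb u0 (η (t, z)) (by simpa using hR1) yR1) (hs t (η (t, z)) tR yR)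
    have dd := b4.add (HasDerivAt.comp (h₂ := ψ2) (h := fun t => η (t, z)) t b5 (line_fst η t z b1))
    refine HasDerivAt.congr_deriv dd ?_
    have hmm : fderiv ℝ η (t, z) (1, 0) = Mf η φh (t, η (t, z)) := by
      simp only [Mf, b2]
    rw [hmm]
    have := (hM u0 (η (t, z)) (by simpa using hR) yR).2
    field_simp
    linear_combination -ss)
  simp only [zero_mul] at e
  simp only
  linarith

theorem flat_lin (gj gi gk aj ai : E2 → ℝ) (p0 : E2) (κ : ℝ × ℝ → E2) (η ξ φh αh : ℝ × ℝ → ℝ)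
    (W : WebLoc gj gi gk aj ai p0 κ η ξ φh αh)
    (hj : AnalyticAt ℝ gj p0) (hi : AnalyticAt ℝ gi p0) (hk : AnalyticAt ℝ gk p0)
    (iji : LinearIndependent ℝ ![fderiv ℝ gj p0, fderiv ℝ gi p0])
    (R : ℝ) (hR : 0 < R)
    (hM : ∀ x y, |x - gj p0| < R → |y - gi p0| < R →
        AnalyticAt ℝ (Mf η φh) (x, y) ∧ Mf η φh (x, y) ≠ 0)
    (hs : ∀ x y, |x - gj p0| < R → |y - gi p0| < R →
        Real.log |Mf η φh (x, y)| + Real.log |Mf η φh (gj p0, gi p0)| =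
        Real.log |Mf η φh (x, gi p0)| + Real.log |Mf η φh (gj p0, y)|) :
    ∃ O : Set E2, IsOpen O ∧ p0 ∈ O ∧ ∃ ψ1 ψ2 ψ3 : ℝ → ℝ,
      (AnalyticOnNhd ℝ ψ1 (gj '' O) ∧ InjOn ψ1 (gj '' O)) ∧
      (AnalyticOnNhd ℝ ψ2 (gi '' O) ∧ InjOn ψ2 (gi '' O)) ∧
      (AnalyticOnNhd ℝ ψ3 (gk '' O) ∧ InjOn ψ3 (gk '' O)) ∧
      ∃ g : E2 → ℝ × ℝ, AnalyticOnNhd ℝ g O ∧ InjOn g O ∧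
        (∀ V ⊆ O, IsOpen V → IsOpen (g '' V)) ∧
        ∀ p ∈ O, ψ1 (gj p) = (g p).1 ∧ ψ2 (gi p) = (g p).2 ∧ ψ3 (gk p) = (g p).1 + (g p).2 := by
  have hM0 := hM (gj p0) (gi p0) (by simpa using hR) (by simpa using hR)
  have aη := W.hη
  have f1a : AnalyticAt ℝ (fun t => Mf η φh (t, gi p0)) (gj p0) :=
    AnalyticAt.comp (g := Mf η φh) (f := fun t : ℝ => ((t, gi p0) : ℝ × ℝ)) hM0.1 (by fun_prop)
  have f2a : AnalyticAt ℝ (fun t => -(Mf η φh (gj p0, gi p0) / Mf η φh (gj p0, t))) (gi p0) :=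
    (analyticAt_const.div (AnalyticAt.comp (g := Mf η φh) (f := fun t : ℝ => ((gj p0, t) : ℝ × ℝ))
      hM0.1 (by fun_prop)) hM0.2).neg
  obtain ⟨ψ1, a1, d1⟩ := primitive _ _ f1a
  obtain ⟨ψ2, a2, d2⟩ := primitive _ _ f2a
  have hsum := flat_sum η φh (gj p0) (gi p0) (gk p0) R hR W.hη W.h3 W.e1 hM hs ψ1 ψ2 d1 d2
  have n2 : -(Mf η φh (gj p0, gi p0) / Mf η φh (gj p0, gi p0)) ≠ 0 := by
    rw [div_self hM0.2]; norm_num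
  obtain ⟨r1, hr1, i1⟩ := inj_near ψ1 _ _ d1 f1a.continuousAt hM0.2
  obtain ⟨r2, hr2, i2⟩ := inj_near ψ2 _ _ d2 f2a.continuousAt n2
  have aη0 : AnalyticAt ℝ (fun z => η (gj p0, z)) (gk p0) :=
    AnalyticAt.comp (g := η) (f := fun t : ℝ => ((gj p0, t) : ℝ × ℝ)) W.hη (by fun_prop)
  set ψ3 : ℝ → ℝ := fun z => ψ1 (gj p0) + ψ2 (η (gj p0, z)) with hψ3
  have a3 : AnalyticAt ℝ ψ3 (gk p0) :=
    analyticAt_const.add (AnalyticAt.comp (g := ψ2) (f := fun z => η (gj p0, z))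
      (by simpa only [W.e1] using a2) aη0)
  -- injectivity of ψ3
  have tη0 : Filter.Tendsto (fun z => η (gj p0, z)) (nhds (gk p0)) (nhds (gi p0)) := by
    simpa only [ContinuousAt, W.e1] using aη0.continuousAt
  have h30 : ∀ᶠ z in nhds (gk p0), φh (gj p0, η (gj p0, z)) = z := by
    have c : ContinuousAt (fun t : ℝ => ((gj p0, t) : ℝ × ℝ)) (gk p0) := by fun_prop
    exact c.eventually W.h3
  -- chart
  have D1 : HasFDerivAt (fun p => ψ1 (gj p)) (Mf η φh (gj p0, gi p0) • fderiv ℝ gj p0) p0 :=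
    HasDerivAt.comp_hasFDerivAt (h₂ := ψ1) (f := gj) p0 d1.self_of_nhds hj.differentiableAt.hasFDerivAt
  have D2 : HasFDerivAt (fun p => ψ2 (gi p))
      ((-(Mf η φh (gj p0, gi p0) / Mf η φh (gj p0, gi p0))) • fderiv ℝ gi p0) p0 :=
    HasDerivAt.comp_hasFDerivAt (h₂ := ψ2) (f := gi) p0 d2.self_of_nhds hi.differentiableAt.hasFDerivAt
  have A1 : AnalyticAt ℝ (fun p => ψ1 (gj p)) p0 := AnalyticAt.comp (g := ψ1) (f := gj) a1 hj
  have A2 : AnalyticAt ℝ (fun p => ψ2 (gi p)) p0 := AnalyticAt.comp (g := ψ2) (f := gi) a2 hi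
  obtain ⟨κ', ka, k0, kl, kr⟩ := chart_exists _ _ p0 A1 A2 (by
    rw [D1.fderiv, D2.fderiv]
    rw [LinearIndependent.pair_iff] at iji ⊢
    intro s t hst
    rw [smul_smul, smul_smul] at hst
    obtain ⟨q1, q2⟩ := iji _ _ hst
    exact ⟨(mul_eq_zero.1 q1).resolve_right hM0.2, (mul_eq_zero.1 q2).resolve_right n2⟩)
  set g : E2 → ℝ × ℝ := fun p => (ψ1 (gj p), ψ2 (gi p)) with hg
  have Ag : AnalyticAt ℝ g p0 := A1.prod A2
  obtain ⟨B', hB', oB', mB'⟩ := mem_nhds_iff.1 (kr.and ka.eventually_analyticAt)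
  have ev : ∀ᶠ p in nhds p0, AnalyticAt ℝ ψ1 (gj p) ∧ AnalyticAt ℝ ψ2 (gi p) ∧
      AnalyticAt ℝ ψ3 (gk p) ∧ gj p ∈ Metric.ball (gj p0) r1 ∧ gi p ∈ Metric.ball (gi p0) r2 ∧
      (η (gj p0, gk p) ∈ Metric.ball (gi p0) r2 ∧ φh (gj p0, η (gj p0, gk p)) = gk p) ∧
      AnalyticAt ℝ g p ∧ κ' (g p) = p ∧ g p ∈ B' ∧
      ψ1 (gj p) + ψ2 (η (gj p, gk p)) = ψ3 (gk p) ∧ η (gj p, gk p) = gi p := by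
    refine (hj.continuousAt.eventually a1.eventually_analyticAt).and
      ((hi.continuousAt.eventually a2.eventually_analyticAt).and
      ((hk.continuousAt.eventually a3.eventually_analyticAt).and
      ((hj.continuousAt.eventually (Metric.ball_mem_nhds _ hr1)).and
      ((hi.continuousAt.eventually (Metric.ball_mem_nhds _ hr2)).and
      ((hk.continuousAt.eventually ((tη0.eventually (Metric.ball_mem_nhds _ hr2)).and h30)).and
      (Ag.eventually_analyticAt.and (kl.and ((Ag.continuousAt.eventually (oB'.mem_nhds mB')).and
      (((hj.continuousAt.prodMk hk.continuousAt).eventually hsum).and W.rη)))))))))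
  obtain ⟨O, hO, oO, mO⟩ := mem_nhds_iff.1 ev
  refine ⟨O, oO, mO, ψ1, ψ2, ψ3, ⟨?_, ?_⟩, ⟨?_, ?_⟩, ⟨?_, ?_⟩, g, ?_, ?_, ?_, ?_⟩
  · rintro _ ⟨p, hp, rfl⟩; exact (hO hp).1
  · rintro _ ⟨p, hp, rfl⟩ _ ⟨q, hq, rfl⟩ h
    exact i1 (hO hp).2.2.2.1 (hO hq).2.2.2.1 h
  · rintro _ ⟨p, hp, rfl⟩; exact (hO hp).2.1
  · rintro _ ⟨p, hp, rfl⟩ _ ⟨q, hq, rfl⟩ h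
    exact i2 (hO hp).2.2.2.2.1 (hO hq).2.2.2.2.1 h
  · rintro _ ⟨p, hp, rfl⟩; exact (hO hp).2.2.1
  · rintro _ ⟨p, hp, rfl⟩ _ ⟨q, hq, rfl⟩ h
    obtain ⟨b1, b2⟩ := (hO hp).2.2.2.2.2.1
    obtain ⟨c1, c2⟩ := (hO hq).2.2.2.2.2.1
    have h' : ψ2 (η (gj p0, gk p)) = ψ2 (η (gj p0, gk q)) := by
      simp only [hψ3] at h; linarith
    have := i2 b1 c1 h'
    rw [← b2, ← c2, this]
  · intro p hp; exact (hO hp).2.2.2.2.2.2.1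
  · intro p hp q hq h
    rw [← (hO hp).2.2.2.2.2.2.2.1, ← (hO hq).2.2.2.2.2.2.2.1, h]
  · intro V hV oV
    have : g '' V = B' ∩ κ' ⁻¹' V := by
      ext q
      constructor
      · rintro ⟨p, hp, rfl⟩
        refine ⟨(hO (hV hp)).2.2.2.2.2.2.2.2.1, ?_⟩
        rw [mem_preimage, (hO (hV hp)).2.2.2.2.2.2.2.1]
        exact hp
      · rintro ⟨h1, h2⟩
        exact ⟨κ' q, h2, Prod.ext (hB' h1).1.1 (hB' h1).1.2⟩
    rw [this]
    apply ContinuousOn.isOpen_inter_preimage _ oB' oV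
    intro q hq
    exact (hB' hq).2.continuousAt.continuousWithinAt
  · intro p hp
    obtain ⟨-, -, -, -, -, -, -, -, -, s1, s2⟩ := hO hp
    refine ⟨rfl, rfl, ?_⟩
    rw [← s1, s2]

theorem analytic_log_abs (f : ℝ → ℝ) (t0 : ℝ) (hf : AnalyticAt ℝ f t0) (h0 : f t0 ≠ 0) :
    AnalyticAt ℝ (fun t => Real.log |f t|) t0 := by
  rcases lt_or_gt_of_ne h0 with h | h
  · have e : (fun t => Real.log |f t|) = fun t => Real.log (-f t) := by
      funext t; rw [Real.log_abs, Real.log_neg_eq_log]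
    rw [e]
    exact hf.neg.log (by simpa using h)
  · have e : (fun t => Real.log |f t|) = fun t => Real.log (f t) := by
      funext t; rw [Real.log_abs]
    rw [e]
    exact hf.log h

theorem sep_rel (gj gi gk aj ai : E2 → ℝ) (p0 : E2) (κ : ℝ × ℝ → E2) (η ξ φh αh : ℝ × ℝ → ℝ)
    (W : WebLoc gj gi gk aj ai p0 κ η ξ φh αh)
    (hj : AnalyticAt ℝ gj p0) (hi : AnalyticAt ℝ gi p0) (hk : AnalyticAt ℝ gk p0)
    (haj : AnalyticAt ℝ aj p0) (haj0 : aj p0 ≠ 0)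
    (R : ℝ) (hR : 0 < R)
    (hM : ∀ x y, |x - gj p0| < R → |y - gi p0| < R →
        AnalyticAt ℝ (Mf η φh) (x, y) ∧ Mf η φh (x, y) ≠ 0)
    (hA : ∀ x y, |x - gj p0| < R → |y - gi p0| < R →
        AnalyticAt ℝ (Af αh φh) (x, y) ∧ Af αh φh (x, y) ≠ 0)
    (τ : ℝ) (hs : ∀ x y, |x - gj p0| < R → |y - gi p0| < R →
        (Real.log |Af αh φh (x, y)| - τ * Real.log |Mf η φh (x, y)|) +
        (Real.log |Af αh φh (gj p0, gi p0)| - τ * Real.log |Mf η φh (gj p0, gi p0)|) =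
        (Real.log |Af αh φh (x, gi p0)| - τ * Real.log |Mf η φh (x, gi p0)|) +
        (Real.log |Af αh φh (gj p0, y)| - τ * Real.log |Mf η φh (gj p0, y)|)) :
    ∃ O : Set E2, IsOpen O ∧ p0 ∈ O ∧ ∃ G1 G2 : ℝ → ℝ,
      AnalyticOnNhd ℝ G1 (gj '' O) ∧ AnalyticOnNhd ℝ G2 (gi '' O) ∧ (∀ y, G2 y ≠ 0) ∧
      ∀ p ∈ O, ∀ w : E2, fderiv ℝ gk p w = 0 →
        aj p * |fderiv ℝ gj p w| ^ (-τ) * G1 (gj p) + ai p * |fderiv ℝ gi p w| ^ (-τ) * G2 (gi p) = 0 := by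
  have hM0 := hM (gj p0) (gi p0) (by simpa using hR) (by simpa using hR)
  have hA0 := hA (gj p0) (gi p0) (by simpa using hR) (by simpa using hR)
  set u0 := gj p0 with hu0
  set v0 := gi p0 with hv0
  set sA : ℝ := Af αh φh (u0, v0) / |Af αh φh (u0, v0)| with hsA
  set u : ℝ → ℝ := fun x => Real.log |Af αh φh (x, v0)| - τ * Real.log |Mf η φh (x, v0)| with hu
  set v : ℝ → ℝ := fun y => (Real.log |Af αh φh (u0, y)| - τ * Real.log |Mf η φh (u0, y)|)
    - (Real.log |Af αh φh (u0, v0)| - τ * Real.log |Mf η φh (u0, v0)|) with hv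
  have ua : AnalyticAt ℝ u u0 :=
    (analytic_log_abs (fun x => Af αh φh (x, v0)) u0 (AnalyticAt.comp (g := Af αh φh)
      (f := fun t : ℝ => ((t, v0) : ℝ × ℝ)) hA0.1 (by fun_prop)) hA0.2).sub
    (analyticAt_const.mul (analytic_log_abs (fun x => Mf η φh (x, v0)) u0 (AnalyticAt.comp
      (g := Mf η φh) (f := fun t : ℝ => ((t, v0) : ℝ × ℝ)) hM0.1 (by fun_prop)) hM0.2))
  have va : AnalyticAt ℝ v v0 :=
    ((analytic_log_abs (fun x => Af αh φh (u0, x)) v0 (AnalyticAt.comp (g := Af αh φh)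
      (f := fun t : ℝ => ((u0, t) : ℝ × ℝ)) hA0.1 (by fun_prop)) hA0.2).sub
    (analyticAt_const.mul (analytic_log_abs (fun x => Mf η φh (u0, x)) v0 (AnalyticAt.comp
      (g := Mf η φh) (f := fun t : ℝ => ((u0, t) : ℝ × ℝ)) hM0.1 (by fun_prop)) hM0.2))).sub
      analyticAt_const
  have G1a : AnalyticAt ℝ (fun x => sA * Real.exp (u x)) u0 := analyticAt_const.mul ua.rexp
  have G2a : AnalyticAt ℝ (fun y => Real.exp (-v y)) v0 := va.neg.rexp
  have pos : ∀ᶠ p in nhds (u0, v0), 0 < Af αh φh (u0, v0) * Af αh φh p := by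
    have : ContinuousAt (fun p => Af αh φh (u0, v0) * Af αh φh p) (u0, v0) :=
      continuousAt_const.mul hA0.1.continuousAt
    exact this.eventually_const_lt (mul_self_pos.2 hA0.2)
  have nx : ∀ᶠ x in nhds u0, |x - u0| < R := by
    have : ContinuousAt (fun t : ℝ => |t - u0|) u0 := by fun_prop
    exact this.eventually_lt_const (by simpa using hR)
  have ny : ∀ᶠ x in nhds v0, |x - v0| < R := by
    have : ContinuousAt (fun t : ℝ => |t - v0|) v0 := by fun_prop
    exact this.eventually_lt_const (by simpa using hR)
  have ev : ∀ᶠ p in nhds p0, (AnalyticAt ℝ (fun x => sA * Real.exp (u x)) (gj p)) ∧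
      (AnalyticAt ℝ (fun y => Real.exp (-v y)) (gi p)) ∧
      0 < Af αh φh (u0, v0) * Af αh φh (gj p, gi p) ∧ |gj p - u0| < R ∧ |gi p - v0| < R ∧
      (∀ᶠ q in nhds p, η (gj q, gk q) = gi q) ∧ φh (gj p, gi p) = gk p ∧
      αh (gj p, gk p) = -(ai p / aj p) ∧ aj p ≠ 0 ∧ AnalyticAt ℝ gj p ∧ AnalyticAt ℝ gk p ∧
      AnalyticAt ℝ η (gj p, gk p) :=
    (hj.continuousAt.eventually G1a.eventually_analyticAt).and
    ((hi.continuousAt.eventually G2a.eventually_analyticAt).and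
    (((hj.continuousAt.prodMk hi.continuousAt).eventually pos).and
    ((hj.continuousAt.eventually nx).and ((hi.continuousAt.eventually ny).and
    (W.rη.eventually_nhds.and (W.rφ.and (W.rα.and ((haj.continuousAt.eventually_ne haj0).and
    (hj.eventually_analyticAt.and (hk.eventually_analyticAt.and
    ((hj.continuousAt.prodMk hk.continuousAt).eventually W.hη.eventually_analyticAt)))))))))))
  obtain ⟨O, hO, oO, mO⟩ := mem_nhds_iff.1 ev
  refine ⟨O, oO, mO, fun x => sA * Real.exp (u x), fun y => Real.exp (-v y), ?_, ?_,
    fun y => (Real.exp_pos _).ne', ?_⟩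
  · rintro _ ⟨p, hp, rfl⟩; exact (hO hp).1
  · rintro _ ⟨p, hp, rfl⟩; exact (hO hp).2.1
  · intro p hp w hw
    obtain ⟨-, -, b3, b4, b5, b6, b7, b8, b9, b10, b11, b12⟩ := hO hp
    have hfd : fderiv ℝ gi p = (fderiv ℝ η (gj p, gk p)).comp
        ((fderiv ℝ gj p).prod (fderiv ℝ gk p)) := by
      have h1 : HasFDerivAt (fun q => η (gj q, gk q)) ((fderiv ℝ η (gj p, gk p)).comp
        ((fderiv ℝ gj p).prod (fderiv ℝ gk p))) p :=
        HasFDerivAt.comp (g := η) (f := fun q => (gj q, gk q)) p b12.differentiableAt.hasFDerivAt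
          (b10.differentiableAt.hasFDerivAt.prodMk b11.differentiableAt.hasFDerivAt)
      have h2 : gi =ᶠ[nhds p] (fun q => η (gj q, gk q)) := by
        filter_upwards [b6] with q hq
        exact hq.symm
      exact (h1.congr_of_eventuallyEq h2).fderiv
    have hdi : fderiv ℝ gi p w = fderiv ℝ gj p w * Mf η φh (gj p, gi p) := by
      rw [hfd]
      simp only [ContinuousLinearMap.comp_apply, ContinuousLinearMap.prod_apply, hw, Mf, b7]
      have : ((fderiv ℝ gj p w, 0) : ℝ × ℝ) = fderiv ℝ gj p w • ((1, 0) : ℝ × ℝ) := by simp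
      rw [this, map_smul, smul_eq_mul]
    have hAe : Af αh φh (gj p, gi p) = -(ai p / aj p) := by
      simp only [Af, b7, b8]
    have hMp := (hM _ _ b4 b5).2
    have hAp := (hA _ _ b4 b5).2
    have hs' := hs _ _ b4 b5
    set Ap := Af αh φh (gj p, gi p) with hApd
    set Mp := Mf η φh (gj p, gi p) with hMpd
    have hsign : Ap = sA * |Ap| := by
      rw [hsA]
      rcases lt_or_gt_of_ne hA0.2 with h | h
      · have : Ap < 0 := by
          by_contra hn
          nlinarith [not_lt.1 hn]
        rw [abs_of_neg h, abs_of_neg this]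
        have := hA0.2
        field_simp
      · have : 0 < Ap := (pos_iff_pos_of_mul_pos b3).1 h
        rw [abs_of_pos h, abs_of_pos this]
        field_simp
    have hai : ai p = -(Ap * aj p) := by
      rw [hAe]; field_simp
    have hexp : |Ap| * |Mp| ^ (-τ) = Real.exp (u (gj p) + v (gi p)) := by
      have : u (gj p) + v (gi p) = Real.log |Ap| - τ * Real.log |Mp| := by
        simp only [hu, hv]; linarith
      rw [this, sub_eq_add_neg, Real.exp_add, Real.exp_log (abs_pos.2 hAp),
        Real.rpow_def_of_pos (abs_pos.2 hMp)]
      congr 2; ring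
    rw [hdi, abs_mul, Real.mul_rpow (abs_nonneg _) (abs_nonneg _)]
    have e2 : Real.exp (u (gj p) + v (gi p)) * Real.exp (-v (gi p)) = Real.exp (u (gj p)) := by
      rw [← Real.exp_add]; congr 1; ring
    rw [← hexp] at e2
    rw [hai]
    calc _ = aj p * |fderiv ℝ gj p w| ^ (-τ) * (sA * Real.exp (u (gj p))
          - Ap * |Mp| ^ (-τ) * Real.exp (-v (gi p))) := by ring
      _ = aj p * |fderiv ℝ gj p w| ^ (-τ) * (sA * Real.exp (u (gj p))
          - (sA * |Ap|) * |Mp| ^ (-τ) * Real.exp (-v (gi p))) := by rw [← hsign]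
      _ = aj p * |fderiv ℝ gj p w| ^ (-τ) * sA * (Real.exp (u (gj p))
          - (|Ap| * |Mp| ^ (-τ) * Real.exp (-v (gi p)))) := by ring
      _ = 0 := by rw [e2]; ring

theorem nondeg
    (x₀ : EuclideanSpace ℝ (Fin 2)) (r : ℝ) (hr : 0 < r)
    (Bt : Set (EuclideanSpace ℝ (Fin 2)))
    (hBBt : Metric.closedBall x₀ r ⊆ Bt)
    (a φ : Fin 3 → EuclideanSpace ℝ (Fin 2) → ℝ)
    (ha : ∀ j, AnalyticOnNhd ℝ (a j) Bt)
    (hφ : ∀ j, AnalyticOnNhd ℝ (φ j) Bt)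
    (haNz : ∀ j, ∀ x ∈ Bt, a j x ≠ 0)
    (hInd : ∀ i j : Fin 3, i ≠ j → ∀ x ∈ Bt,
      LinearIndependent ℝ ![fderiv ℝ (φ i) x, fderiv ℝ (φ j) x])
    (hcurv : ¬ ∃ V : Set (EuclideanSpace ℝ (Fin 2)),
      V ⊆ Metric.closedBall x₀ r ∧ IsOpen V ∧ V.Nonempty ∧ IsConnected V ∧
      ∃ (Φ : EuclideanSpace ℝ (Fin 2) → EuclideanSpace ℝ (Fin 2)) (ψ : Fin 3 → ℝ → ℝ)
        (L : Fin 3 → (EuclideanSpace ℝ (Fin 2) →L[ℝ] ℝ)) (c : Fin 3 → ℝ),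
        AnalyticOnNhd ℝ Φ V ∧ Set.InjOn Φ V ∧ IsOpen (Φ '' V) ∧
        (∀ j, AnalyticOnNhd ℝ (ψ j) (φ j '' V) ∧ Set.InjOn (ψ j) (φ j '' V)) ∧
        ∀ j, ∀ x ∈ V, ψ j (φ j x) = L j (Φ x) + c j)
    (W : Fin 3 → EuclideanSpace ℝ (Fin 2) → EuclideanSpace ℝ (Fin 2))
    (hWφ : ∀ j, ∀ x ∈ Bt, fderiv ℝ (φ j) x (W j x) = 0)
    (hAux : ∀ k : Fin 3, ∀ U : Set (EuclideanSpace ℝ (Fin 2)),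
      U ⊆ Metric.closedBall x₀ r → IsOpen U → U.Nonempty → ∀ τ : ℝ,
      ∀ g : Fin 3 → ℝ → ℝ, (∀ i, i ≠ k → AnalyticOnNhd ℝ (g i) (φ i '' U)) →
      (∀ x ∈ U, ∑ i ∈ Finset.univ.filter (fun i => i ≠ k),
          a i x * |fderiv ℝ (φ i) x (W k x)| ^ τ * g i (φ i x) = 0) →
      ∀ i, i ≠ k → ∀ y ∈ φ i '' U, g i y = 0)
    (p0 : E2) (hp0 : p0 ∈ Metric.closedBall x₀ r) (j i k : Fin 3) (hji : j ≠ i) (hjk : j ≠ k)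
    (hik : i ≠ k) (κ : ℝ × ℝ → E2) (η ξ φh αh : ℝ × ℝ → ℝ)
    (Wl : WebLoc (φ j) (φ i) (φ k) (a j) (a i) p0 κ η ξ φh αh) :
    ¬ ∀ᶠ w in nhds ((φ j p0, ((φ i p0, φ j p0), φ i p0)) : ℝ × ((ℝ × ℝ) × ℝ)),
      J5 (Vf η ξ φh) (ef φh αh) (w.1, w.1, w.2) = 0 := by
  intro hJ
  have hpB := hBBt hp0
  have hcases : ∀ m : Fin 3, m = j ∨ m = i ∨ m = k := by
    intro m; omega
  have hcl : p0 ∈ closure (Metric.ball x₀ r) := by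
    rw [closure_ball x₀ hr.ne']; exact hp0
  obtain ⟨R, hR, hM, hA, hd⟩ := dichotomy η ξ φh αh _ _ _ Wl.hη Wl.hξ Wl.hφ Wl.hα Wl.hα0 Wl.h1 Wl.h4
    Wl.e1 Wl.e2 Wl.e3 hJ
  rcases hd with hs | ⟨τ, hs⟩
  · obtain ⟨O, oO, mO, ψ1, ψ2, ψ3, P1, P2, P3, g, ga, gi, go, gr⟩ :=
      flat_lin _ _ _ _ _ p0 κ η ξ φh αh Wl (hφ j p0 hpB) (hφ i p0 hpB) (hφ k p0 hpB)
        (hInd j i hji p0 hpB) R hR hM hs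
    apply hcurv
    obtain ⟨p1, hp1⟩ := mem_closure_iff.1 hcl O oO mO
    obtain ⟨ρ, hρ, hV⟩ := Metric.isOpen_iff.1 (oO.inter Metric.isOpen_ball) p1 hp1
    set V := Metric.ball p1 ρ with hVd
    have hVO : V ⊆ O := fun p hp => (hV hp).1
    set T : (ℝ × ℝ) ≃L[ℝ] E2 := ContinuousLinearEquiv.ofFinrankEq (by simp) with hT
    refine ⟨V, fun p hp => Metric.ball_subset_closedBall (hV hp).2, Metric.isOpen_ball,
      ⟨p1, Metric.mem_ball_self hρ⟩,
      ⟨⟨p1, Metric.mem_ball_self hρ⟩, (convex_ball p1 ρ).isPreconnected⟩,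
      fun p => T (g p), fun m => if m = j then ψ1 else if m = i then ψ2 else ψ3,
      fun m => if m = j then (ContinuousLinearMap.fst ℝ ℝ ℝ).comp (T.symm : E2 →L[ℝ] ℝ × ℝ)
        else if m = i then (ContinuousLinearMap.snd ℝ ℝ ℝ).comp (T.symm : E2 →L[ℝ] ℝ × ℝ)
        else (ContinuousLinearMap.fst ℝ ℝ ℝ + ContinuousLinearMap.snd ℝ ℝ ℝ).comp
          (T.symm : E2 →L[ℝ] ℝ × ℝ), fun _ => 0, ?_, ?_, ?_, ?_, ?_⟩
    · intro p hp
      exact ((T : ℝ × ℝ →L[ℝ] E2).analyticAt _).comp (ga p (hVO hp))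
    · intro p hp q hq h
      exact gi (hVO hp) (hVO hq) (T.injective h)
    · have : (fun p => T (g p)) '' V = T '' (g '' V) := by rw [image_image]
      rw [this]
      exact T.toHomeomorph.isOpenMap _ (go V hVO Metric.isOpen_ball)
    · intro m
      rcases hcases m with rfl | rfl | rfl
      · simp only [if_true]
        exact ⟨P1.1.mono (image_mono hVO), P1.2.mono (image_mono hVO)⟩
      · simp only [if_neg hji.symm, if_true]
        exact ⟨P2.1.mono (image_mono hVO), P2.2.mono (image_mono hVO)⟩
      · simp only [if_neg hjk.symm, if_neg hik.symm]
        exact ⟨P3.1.mono (image_mono hVO), P3.2.mono (image_mono hVO)⟩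
    · intro m p hp
      obtain ⟨q1, q2, q3⟩ := gr p (hVO hp)
      rcases hcases m with rfl | rfl | rfl
      · simp [q1]
      · simp [if_neg hji.symm, q2]
      · simp [if_neg hjk.symm, if_neg hik.symm, q3]
  · obtain ⟨O, oO, mO, G1, G2, g1, g2, gnz, hrel⟩ :=
      sep_rel _ _ _ _ _ p0 κ η ξ φh αh Wl (hφ j p0 hpB) (hφ i p0 hpB) (hφ k p0 hpB)
        (ha j p0 hpB) (haNz j p0 hpB) R hR hM hA τ hs
    obtain ⟨p1, hp1⟩ := mem_closure_iff.1 hcl O oO mO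
    have hfil : Finset.univ.filter (fun m => m ≠ k) = {j, i} := by
      ext m
      simp only [Finset.mem_filter, Finset.mem_univ, true_and, Finset.mem_insert,
        Finset.mem_singleton]
      constructor
      · intro h
        rcases hcases m with h1 | h1 | h1
        · exact Or.inl h1
        · exact Or.inr h1
        · exact absurd h1 h
      · rintro (rfl | rfl)
        · exact hjk
        · exact hik
    have hUB : O ∩ Metric.ball x₀ r ⊆ Metric.closedBall x₀ r :=
      fun p hp => Metric.ball_subset_closedBall hp.2
    have := hAux k (O ∩ Metric.ball x₀ r) hUB
      (oO.inter Metric.isOpen_ball) ⟨p1, hp1⟩ (-τ) (fun m => if m = j then G1 else G2)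
      (by
        intro m hm
        rcases hcases m with rfl | rfl | rfl
        · simp only [if_true]
          exact g1.mono (image_mono inter_subset_left)
        · simp only [if_neg hji.symm]
          exact g2.mono (image_mono inter_subset_left)
        · exact absurd rfl hm)
      (by
        intro p hp
        rw [hfil, Finset.sum_pair hji]
        simp only [if_true, if_neg hji.symm]
        exact hrel p hp.1 _ (hWφ k p (hBBt (hUB hp))))
      i hik (φ i p1) ⟨p1, hp1, rfl⟩
    simp only [if_neg hji.symm] at this
    exact gnz _ this

theorem edge_alg (bj bi bj' bi' fj fi fj' fi' fk ε A A2 L3 L4 : ℝ) (h0 : bj ≠ 0)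
    (h1 : |bj * fj + bi * fi + fk| ≤ A * ε) (h2 : |bj' * fj' + bi' * fi' + fk| ≤ A * ε)
    (h3 : |bj' - bj| ≤ L3 * ε) (h4 : |bi' - bi| ≤ L4 * ε) (f1 : |fj'| ≤ 2) (f2 : |fi'| ≤ 2)
    (hA2 : |1 / bj| ≤ A2) :
    |(fj' - fj) + bi / bj * (fi' - fi)| ≤ A2 * (2 * A + 2 * L3 + 2 * L4) * ε := by
  have e : (fj' - fj) + bi / bj * (fi' - fi) = (1 / bj) *
      ((bj' * fj' + bi' * fi' + fk) - (bj * fj + bi * fi + fk) - (bj' - bj) * fj' - (bi' - bi) * fi') := by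
    field_simp
    ring
  have g3 : |(bj' - bj) * fj'| ≤ L3 * ε * 2 := by
    rw [abs_mul]
    exact mul_le_mul h3 f1 (abs_nonneg _) ((abs_nonneg _).trans h3)
  have g4 : |(bi' - bi) * fi'| ≤ L4 * ε * 2 := by
    rw [abs_mul]
    exact mul_le_mul h4 f2 (abs_nonneg _) ((abs_nonneg _).trans h4)
  have g : |(bj' * fj' + bi' * fi' + fk) - (bj * fj + bi * fi + fk) - (bj' - bj) * fj'
      - (bi' - bi) * fi'| ≤ (2 * A + 2 * L3 + 2 * L4) * ε := by
    rw [abs_le] at *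
    constructor <;> linarith [h1.1, h1.2, h2.1, h2.2, g3.1, g3.2, g4.1, g4.2]
  rw [e, abs_mul, mul_assoc]
  exact mul_le_mul hA2 g (abs_nonneg _) ((abs_nonneg _).trans hA2)

theorem lip_near {E F : Type*} [NormedAddCommGroup E] [NormedSpace ℝ E]
    [NormedAddCommGroup F] [NormedSpace ℝ F] (f : E → F) (p : E) (hf : ContDiffAt ℝ 1 f p) :
    ∃ K : ℝ, 0 < K ∧ ∃ O, IsOpen O ∧ p ∈ O ∧ LipschitzOnWith (K.toNNReal) f O ∧
      ∀ x ∈ O, ∀ y ∈ O, dist (f x) (f y) ≤ K * dist x y := by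
  obtain ⟨K, t, ht, h⟩ := hf.exists_lipschitzOnWith
  obtain ⟨O, hO, o, pO⟩ := mem_nhds_iff.1 ht
  have hl : LipschitzOnWith ((K + 1 : ℝ).toNNReal) f O := by
    refine (h.mono hO).weaken ?_
    rw [← NNReal.coe_le_coe, Real.coe_toNNReal _ (by positivity)]
    linarith
  refine ⟨K + 1, by positivity, O, o, pO, hl, fun x hx y hy => ?_⟩
  have := hl.dist_le_mul x hx y hy
  rwa [Real.coe_toNNReal _ (by positivity)] at this

set_option maxHeartbeats 1600000 in
theorem key_local (gj gi gk aj ai ak : E2 → ℝ) (p0 : E2)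
    (hj : AnalyticAt ℝ gj p0) (hk : AnalyticAt ℝ gk p0)
    (haj : AnalyticAt ℝ aj p0) (hai : AnalyticAt ℝ ai p0) (hak : AnalyticAt ℝ ak p0)
    (haj0 : aj p0 ≠ 0) (hak0 : ak p0 ≠ 0)
    (κ : ℝ × ℝ → E2) (η ξ φh αh : ℝ × ℝ → ℝ) (Wl : WebLoc gj gi gk aj ai p0 κ η ξ φh αh)
    (hJ : ¬∀ᶠ w in nhds ((gj p0,((gi p0,gj p0),gi p0)):ℝ×((ℝ×ℝ)×ℝ)),
      J5 (Vf η ξ φh) (ef φh αh) (w.1,w.1,w.2)=0) :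
    ∃ N, IsOpen N ∧ p0 ∈ N ∧ ∃ c0 > 0, ∃ C0 > 0, ∃ n : ℕ, ∀ ε : ℝ, 0 < ε → ε ≤ 1 →
      ∀ (fj fi fk : ℝ → ℝ) (S : Set E2), MeasurableSet S → S ⊆ N →
      (∀ p ∈ S, |aj p * fj (gj p) + ai p * fi (gi p) + ak p * fk (gk p)| < ε) →
      (∀ p ∈ S, |fj (gj p)| ≤ 2 ∧ |fi (gi p)| ≤ 2) →
      ∀ δ : ℝ, 0 < δ → ENNReal.ofReal δ ≤ volume S → ε ≤ c0 * δ ^ n →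
      ∃ (fstar : ℝ → ℝ) (S' : Set E2), ConstOnIntervals fstar ε ∧ MeasurableSet S' ∧ S' ⊆ S ∧
        ENNReal.ofReal (c0 * δ ^ n) ≤ volume S' ∧
        ∀ x ∈ S', |fstar (gj x) - fj (gj x)| ≤ C0 * ε / δ ^ n := by
  obtain ⟨r, hr, hmod⟩ := model η ξ φh αh (gj p0) (gi p0) (gk p0) Wl.hη Wl.hξ Wl.hφ Wl.hα Wl.hα0
    Wl.h1 Wl.h2 Wl.h3 Wl.h4 Wl.e1 Wl.e2 Wl.e3 hJ
  set g : E2 → ℝ × ℝ := fun p => (gj p, gk p) with hg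
  have hga : AnalyticAt ℝ g p0 := hj.prod hk
  obtain ⟨K1, hK1, t1, o1, m1, L1, l1⟩ := lip_near κ _ Wl.κa.contDiffAt
  obtain ⟨K2, hK2, t2, o2, m2, L2, l2⟩ := lip_near g p0 hga.contDiffAt
  obtain ⟨K3, hK3, t3, o3, m3, L3, l3⟩ := lip_near (fun p => aj p / ak p) p0 (haj.div hak hak0).contDiffAt
  obtain ⟨K4, hK4, t4, o4, m4, L4, l4⟩ := lip_near (fun p => ai p / ak p) p0 (hai.div hak hak0).contDiffAt
  set A := |1 / ak p0| + 1 with hA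
  set A2 := |1 / (aj p0 / ak p0)| + 1 with hA2
  have b1 : ∀ᶠ p in nhds p0, |1 / ak p| < A :=
    (continuousAt_const.div hak.continuousAt hak0).abs.eventually_lt_const (lt_add_one |1 / ak p0|)
  have b2 : ∀ᶠ p in nhds p0, |1 / (aj p / ak p)| < A2 :=
    (continuousAt_const.div (haj.continuousAt.div hak.continuousAt hak0)
      (div_ne_zero haj0 hak0)).abs.eventually_lt_const (lt_add_one |1 / (aj p0 / ak p0)|)
  have b3 : ∀ᶠ p in nhds p0, aj p ≠ 0 := haj.continuousAt.eventually_ne haj0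
  have b4 : ∀ᶠ p in nhds p0, ak p ≠ 0 := hak.continuousAt.eventually_ne hak0
  have b5 : ∀ᶠ p in nhds p0, |gj p - gj p0| < r :=
    (hj.continuousAt.sub continuousAt_const).abs.eventually_lt_const (by simpa using hr)
  have b6 : ∀ᶠ p in nhds p0, |gk p - gk p0| < r :=
    (hk.continuousAt.sub continuousAt_const).abs.eventually_lt_const (by simpa using hr)
  have b7 : ∀ᶠ p in nhds p0, g p ∈ t1 := hga.continuousAt.eventually (o1.mem_nhds m1)
  have b8 := hj.eventually_analyticAt
  have b12 : ∀ᶠ p in nhds p0, p ∈ t2 := o2.mem_nhds m2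
  have b13 : ∀ᶠ p in nhds p0, p ∈ t3 := o3.mem_nhds m3
  have b14 : ∀ᶠ p in nhds p0, p ∈ t4 := o4.mem_nhds m4
  have ball := b1.and (b2.and (b3.and (b4.and (b5.and (b6.and (b7.and (b8.and
    (Wl.κl.and (Wl.rη.and (Wl.rα.and (b12.and (b13.and b14))))))))))))
  obtain ⟨N, hN, oN, pN⟩ := mem_nhds_iff.1 ball
  have hd1 : Module.finrank ℝ (ℝ × ℝ) = Module.finrank ℝ E2 := by simp [E2]
  have hd2 : Module.finrank ℝ E2 = 2 := by simp [E2]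
  obtain ⟨Cκ, hCκ, mκ⟩ := lip_measure (volume : Measure (ℝ × ℝ)) (volume : Measure E2) hd1
  obtain ⟨Cg, hCg, mg⟩ := lip_measure (volume : Measure E2) (volume : Measure (ℝ × ℝ)) hd1.symm
  set K0 := A2 * (2 * A + 2 * (K3 * K1) + 2 * (K4 * K1)) with hK0
  have hApos : 0 < A := by positivity
  have hA2pos : 0 < A2 := by positivity
  obtain ⟨c, hc, C, hC, n, hmod⟩ := hmod K0 (by positivity)
  set M := Cκ * K1 ^ 2 with hM
  set M' := Cg * K2 ^ 2 with hM'
  have hMp : 0 < M := by positivity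
  have hMp' : 0 < M' := by positivity
  refine ⟨N, oN, pN, c / (M ^ n * (1 + M')), by positivity, C * M ^ n, by positivity, n, ?_⟩
  intro ε hε hε1 fj fi fk S hS hSN hEq hbd δ hδ hδS hεδ
  have hgc : ContinuousOn g N := L2.continuousOn.mono (fun p hp => (hN hp).2.2.2.2.2.2.2.2.2.2.2.1)
  have hgl : ∀ p ∈ N, κ (g p) = p := fun p hp => (hN hp).2.2.2.2.2.2.2.2.1
  have hginj : InjOn g N := fun p hp q hq h => by rw [← hgl p hp, ← hgl q hq, h]
  set T := g '' S with hT
  have hTm : MeasurableSet T := hS.image_of_continuousOn_injOn (hgc.mono hSN) (hginj.mono hSN)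
  have hκT : κ '' T = S := by
    rw [hT, image_image]
    ext p
    constructor
    · rintro ⟨q, hq, rfl⟩
      simpa only [hgl q (hSN hq)] using hq
    · exact fun hp => ⟨p, hp, hgl p (hSN hp)⟩
  have hT1 : T ⊆ t1 := by
    rintro _ ⟨p, hp, rfl⟩
    exact (hN (hSN hp)).2.2.2.2.2.2.1
  have v1 : volume S ≤ ENNReal.ofReal M * volume T := by
    have := mκ _ κ T (L1.mono hT1)
    rwa [hκT, hd1, hd2, Real.coe_toNNReal _ hK1.le] at this
  have v2 : ENNReal.ofReal (δ / M) ≤ volume T := by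
    have h := hδS.trans v1
    rw [show δ = M * (δ / M) by field_simp, ENNReal.ofReal_mul hMp.le] at h
    exact (ENNReal.mul_le_mul_iff_right (by simpa using hMp) ENNReal.ofReal_ne_top).1 h
  have hTr : ∀ p ∈ T, |p.1 - gj p0| ≤ r ∧ |p.2 - gk p0| ≤ r := by
    rintro _ ⟨p, hp, rfl⟩
    exact ⟨(hN (hSN hp)).2.2.2.2.1.le, (hN (hSN hp)).2.2.2.2.2.1.le⟩
  have hnorm : ∀ p ∈ S, |aj p / ak p * fj (gj p) + ai p / ak p * fi (gi p) + fk (gk p)| ≤ A * ε := by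
    intro p hp
    have hk0 := (hN (hSN hp)).2.2.2.1
    have e : aj p / ak p * fj (gj p) + ai p / ak p * fi (gi p) + fk (gk p) =
      (1 / ak p) * (aj p * fj (gj p) + ai p * fi (gi p) + ak p * fk (gk p)) := by
      field_simp
    rw [e, abs_mul]
    exact mul_le_mul (hN (hSN hp)).1.le (hEq p hp).le (abs_nonneg _) hApos.le
  have hedge : ∀ x x' z : ℝ, (x, z) ∈ T → (x', z) ∈ T → |x - x'| ≤ ε →
      |fj x' - fj x - αh (x, z) * (fi (η (x', z)) - fi (η (x, z)))| ≤ K0 * ε := by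
    rintro x x' z ⟨p, hp, hpe⟩ ⟨p', hp', hpe'⟩ hxx
    obtain ⟨rfl, rfl⟩ := Prod.mk.inj hpe
    obtain ⟨rfl, hkk⟩ := Prod.mk.inj hpe'
    have hn := hN (hSN hp)
    have hn' := hN (hSN hp')
    have hd : dist p' p ≤ K1 * ε := by
      have := l1 (g p') hn'.2.2.2.2.2.2.1 (g p) hn.2.2.2.2.2.2.1
      rw [hgl _ (hSN hp), hgl _ (hSN hp')] at this
      refine this.trans (mul_le_mul_of_nonneg_left ?_ hK1.le)
      rw [Prod.dist_eq]
      simp only [hg, hkk, dist_self]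
      rw [Real.dist_eq, abs_sub_comm]
      exact max_le hxx hε.le
    have r1 : η (gj p, gk p) = gi p := hn.2.2.2.2.2.2.2.2.2.1
    have r2 : η (gj p', gk p) = gi p' := by rw [← hkk]; exact hn'.2.2.2.2.2.2.2.2.2.1
    have r3 : αh (gj p, gk p) = -(ai p / aj p) := hn.2.2.2.2.2.2.2.2.2.2.1
    have q1 := hnorm p hp
    have q2 := hnorm p' hp'
    rw [hkk] at q2
    have q3 := l3 p' hn'.2.2.2.2.2.2.2.2.2.2.2.2.1 p hn.2.2.2.2.2.2.2.2.2.2.2.2.1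
    have q4 := l4 p' hn'.2.2.2.2.2.2.2.2.2.2.2.2.2 p hn.2.2.2.2.2.2.2.2.2.2.2.2.2
    rw [Real.dist_eq] at q3 q4
    have q3' : |aj p' / ak p' - aj p / ak p| ≤ (K3 * K1) * ε := by
      refine q3.trans ?_
      rw [mul_assoc]; exact mul_le_mul_of_nonneg_left hd hK3.le
    have q4' : |ai p' / ak p' - ai p / ak p| ≤ (K4 * K1) * ε := by
      refine q4.trans ?_
      rw [mul_assoc]; exact mul_le_mul_of_nonneg_left hd hK4.le
    have := edge_alg _ _ _ _ _ _ _ _ _ ε A A2 _ _ (div_ne_zero hn.2.2.1 hn.2.2.2.1) q1 q2 q3' q4'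
      (hbd p' hp').1 (hbd p' hp').2 hn.2.1.le
    rw [r1, r2, r3]
    convert this using 2
    have := hn.2.2.1
    have := hn.2.2.2.1
    field_simp
    ring
  have hlast : ε ≤ c * (δ / M) ^ n := by
    refine hεδ.trans ?_
    rw [div_pow, show c / (M ^ n * (1 + M')) * δ ^ n = c * (δ ^ n / M ^ n) / (1 + M') by field_simp]
    exact div_le_self (by positivity) (by linarith)
  obtain ⟨fstar, E1, hfs, hE1, hE2, hE3⟩ := hmod ε hε hε1 fj fi T hTm hTr hedge (δ / M) (by positivity) v2 hlast
  · refine ⟨fstar, S ∩ gj ⁻¹' E1, hfs, ?_, inter_subset_left, ?_, ?_⟩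
    · have hjm : ContinuousOn gj N := fun p hp => (hN hp).2.2.2.2.2.2.2.1.continuousAt.continuousWithinAt
      have hm : MeasurableSet (N ∩ gj ⁻¹' E1) := by
        have hr' : Measurable (N.domRestrict gj) := (continuousOn_iff_continuous_domRestrict.1 hjm).measurable
        have h3 := oN.measurableSet.subtype_image (hr' hE1)
        convert h3 using 1
        ext p
        constructor
        · rintro ⟨h, h'⟩
          exact ⟨⟨p, h⟩, h', rfl⟩
        · rintro ⟨⟨q, h⟩, h', rfl⟩
          exact ⟨h, h'⟩
      have : S ∩ gj ⁻¹' E1 = S ∩ (N ∩ gj ⁻¹' E1) := by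
        rw [← inter_assoc, inter_eq_left.2 hSN]
      rw [this]
      exact hS.inter hm
    · have hsub : T ∩ E1 ×ˢ univ ⊆ g '' (S ∩ gj ⁻¹' E1) := by
        rintro _ ⟨⟨p, hp, rfl⟩, h⟩
        exact ⟨p, ⟨hp, h.1⟩, rfl⟩
      have h1 := mg _ g (S ∩ gj ⁻¹' E1) (L2.mono (fun p hp => (hN (hSN hp.1)).2.2.2.2.2.2.2.2.2.2.2.1))
      rw [hd2, Real.coe_toNNReal _ hK2.le] at h1
      have h2 := hE2.trans ((measure_mono hsub).trans h1)
      rw [show c * (δ / M) ^ n = M' * (c * (δ / M) ^ n / M') by field_simp, ENNReal.ofReal_mul hMp'.le] at h2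
      refine le_trans (ENNReal.ofReal_le_ofReal ?_)
        ((ENNReal.mul_le_mul_iff_right (by simpa using hMp') ENNReal.ofReal_ne_top).1 h2)
      rw [div_pow, show c / (M ^ n * (1 + M')) * δ ^ n = c * (δ ^ n / M ^ n) / (1 + M') by field_simp]
      gcongr
      linarith
    · intro x hx
      have := hE3 _ hx.2
      convert this using 1
      rw [div_pow]
      field_simp

/-- Microscale property for a single function index `j` on the set `s`. -/
def KeyP (a φ : Fin 3 → E2 → ℝ) (s : Set E2) (j : Fin 3) (c C : ℝ) (n : ℕ) : Prop :=
  ∀ ε : ℝ, 0 < ε → ε ≤ 1 → ∀ f : Fin 3 → ℝ → ℝ, ∀ S : Set E2, MeasurableSet S → S ⊆ s →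
    (∀ x ∈ S, |∑ j, a j x * f j (φ j x)| < ε) → (∀ x ∈ S, ∀ j, |f j (φ j x)| ≤ 2) →
    ∀ δ : ℝ, 0 < δ → δ ≤ 1 → ENNReal.ofReal δ ≤ volume S → ε ≤ c * δ ^ n →
    ∃ (fstar : ℝ → ℝ) (S' : Set E2), ConstOnIntervals fstar ε ∧ MeasurableSet S' ∧ S' ⊆ S ∧
      ENNReal.ofReal (c * δ ^ n) ≤ volume S' ∧
      ∀ x ∈ S', |fstar (φ j x) - f j (φ j x)| ≤ C * ε / δ ^ n

/-- Microscale property for all indices on the set `s`. -/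
def GoodP (a φ : Fin 3 → E2 → ℝ) (s : Set E2) (c C : ℝ) (n : ℕ) : Prop :=
  ∀ ε : ℝ, 0 < ε → ε ≤ 1 → ∀ f : Fin 3 → ℝ → ℝ,
    (∀ j, ∀ᵐ y ∂(volume : Measure ℝ), |f j y| ≤ 2) → ∀ S : Set E2, MeasurableSet S → S ⊆ s →
    (∀ x ∈ S, |∑ j, a j x * f j (φ j x)| < ε) →
    ∀ δ : ℝ, 0 < δ → δ ≤ 1 → ENNReal.ofReal δ ≤ volume S → ε ≤ c * δ ^ n →
    ∃ (fstar : Fin 3 → ℝ → ℝ) (S' : Set E2), (∀ j, ConstOnIntervals (fstar j) ε) ∧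
      MeasurableSet S' ∧ S' ⊆ S ∧ ENNReal.ofReal (c * δ ^ n) ≤ volume S' ∧
      ∀ x ∈ S', ∀ j, |fstar j (φ j x) - f j (φ j x)| ≤ C * ε / δ ^ n

theorem KeyP.mono {a φ : Fin 3 → E2 → ℝ} {s s' : Set E2} {j : Fin 3} {c C c' C' : ℝ} {n n' : ℕ}
    (h : KeyP a φ s j c C n) (hs : s' ⊆ s) (hc' : 0 < c') (hc : c' ≤ c) (hC0 : 0 < C) (hC : C ≤ C')
    (hn : n ≤ n') : KeyP a φ s' j c' C' n' := by
  intro ε hε hε1 f S hS hSs hE hb δ hδ hδ1 hδS hεδ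
  have hp : δ ^ n' ≤ δ ^ n := pow_le_pow_of_le_one hδ.le hδ1 hn
  have hcp : c' * δ ^ n' ≤ c * δ ^ n := mul_le_mul hc hp (by positivity) (hc'.le.trans hc)
  obtain ⟨fs, S', h1, h2, h3, h4, h5⟩ := h ε hε hε1 f S hS (hSs.trans hs) hE hb δ hδ hδ1 hδS
    (hεδ.trans hcp)
  refine ⟨fs, S', h1, h2, h3, (ENNReal.ofReal_le_ofReal hcp).trans h4, fun x hx => (h5 x hx).trans ?_⟩
  have hC'0 : 0 < C' := hC0.trans_le hC
  gcongr

theorem GoodP.mono {a φ : Fin 3 → E2 → ℝ} {s s' : Set E2} {c C c' C' : ℝ} {n n' : ℕ}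
    (h : GoodP a φ s c C n) (hs : s' ⊆ s) (hc' : 0 < c') (hc : c' ≤ c) (hC0 : 0 < C) (hC : C ≤ C')
    (hn : n ≤ n') : GoodP a φ s' c' C' n' := by
  intro ε hε hε1 f hb S hS hSs hE δ hδ hδ1 hδS hεδ
  have hp : δ ^ n' ≤ δ ^ n := pow_le_pow_of_le_one hδ.le hδ1 hn
  have hcp : c' * δ ^ n' ≤ c * δ ^ n := mul_le_mul hc hp (by positivity) (hc'.le.trans hc)
  obtain ⟨fs, S', h1, h2, h3, h4, h5⟩ := h ε hε hε1 f hb S hS (hSs.trans hs) hE δ hδ hδ1 hδS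
    (hεδ.trans hcp)
  refine ⟨fs, S', h1, h2, h3, (ENNReal.ofReal_le_ofReal hcp).trans h4,
    fun x hx j => (h5 x hx j).trans ?_⟩
  have hC'0 : 0 < C' := hC0.trans_le hC
  gcongr

theorem good_of_key {a φ : Fin 3 → E2 → ℝ} {s : Set E2} {c C : ℝ} {n : ℕ} (hc : 0 < c)
    (hc1 : c ≤ 1) (hC : 0 < C) (hn : 1 ≤ n) (h : ∀ j, KeyP a φ s j c C n)
    (hnull : ∀ j (Z : Set ℝ), volume Z = 0 → volume (s ∩ φ j ⁻¹' Z) = 0) :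
    ∃ c' C' : ℝ, ∃ n' : ℕ, 0 < c' ∧ 0 < C' ∧ GoodP a φ s c' C' n' := by
  refine ⟨c ^ (1 + n + n ^ 2), C / c ^ (1 + n + n ^ 2), n ^ 3, by positivity, by positivity, ?_⟩
  intro ε hε hε1 f hb S hS hSs hE δ hδ hδ1 hδS hεδ
  set Z : Fin 3 → Set ℝ := fun j => {y | ¬ |f j y| ≤ 2} with hZ
  have hZ0 : ∀ j, volume (Z j) = 0 := fun j => ae_iff.1 (hb j)
  set bad := ⋃ j, (s ∩ φ j ⁻¹' Z j) with hbad
  have hbad0 : volume bad = 0 := measure_iUnion_null fun j => hnull j _ (hZ0 j)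
  set S0 := S \ toMeasurable volume bad with hS0
  have hS0m : MeasurableSet S0 := hS.diff (measurableSet_toMeasurable _ _)
  have hS0v : volume S0 = volume S := by
    apply measure_sdiff_null
    rw [measure_toMeasurable, hbad0]
  have hS0S : S0 ⊆ S := sdiff_subset
  have hbd : ∀ x ∈ S0, ∀ j, |f j (φ j x)| ≤ 2 := by
    intro x hx j
    by_contra hcon
    exact hx.2 (subset_toMeasurable _ _ (mem_iUnion.2 ⟨j, hSs hx.1, hcon⟩))
  have step : ∀ d : ℝ, 0 < d → d ≤ 1 → 0 < c * d ^ n ∧ c * d ^ n ≤ d ∧ c * d ^ n ≤ 1 := by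
    intro d hd hd1
    have h1 : d ^ n ≤ d ^ 1 := pow_le_pow_of_le_one hd.le hd1 hn
    have h2 : c * d ^ n ≤ 1 * d ^ 1 := mul_le_mul hc1 h1 (by positivity) (by norm_num)
    refine ⟨by positivity, by linarith, by linarith⟩
  set δ1 := c * δ ^ n with hδ1'
  set δ2 := c * δ1 ^ n with hδ2'
  set δ3 := c * δ2 ^ n with hδ3'
  obtain ⟨p1, q1, r1⟩ := step δ hδ hδ1
  obtain ⟨p2, q2, r2⟩ := step δ1 p1 r1
  obtain ⟨p3, q3, r3⟩ := step δ2 p2 r2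
  have e3 : c ^ (1 + n + n ^ 2) * δ ^ (n ^ 3) = δ3 := by
    rw [hδ3', hδ2', hδ1']
    simp only [mul_pow, ← pow_mul]
    ring
  rw [e3] at hεδ
  have hfin : ∀ d : ℝ, 0 < d → d ≤ 1 → δ3 ≤ c * d ^ n →
      C * ε / d ^ n ≤ C / c ^ (1 + n + n ^ 2) * ε / δ ^ (n ^ 3) := by
    intro d hd hd1 h
    rw [show C / c ^ (1 + n + n ^ 2) * ε / δ ^ (n ^ 3) = C * ε / δ3 by
      rw [← e3]; field_simp]
    have : δ3 ≤ d ^ n := h.trans (mul_le_of_le_one_left (by positivity) hc1)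
    gcongr
  obtain ⟨f0, S1, a1, a2, a3, a4, a5⟩ := h 0 ε hε hε1 f S0 hS0m (hS0S.trans hSs)
    (fun x hx => hE x (hS0S hx)) hbd δ hδ hδ1 (hS0v ▸ hδS) (by linarith)
  obtain ⟨f1, S2, b1, b2, b3, b4, b5⟩ := h 1 ε hε hε1 f S1 a2 (a3.trans (hS0S.trans hSs))
    (fun x hx => hE x (hS0S (a3 hx))) (fun x hx => hbd x (a3 hx)) δ1 p1 r1 a4 (by linarith)
  obtain ⟨f2, S3, d1, d2, d3, d4, d5⟩ := h 2 ε hε hε1 f S2 b2 (b3.trans (a3.trans (hS0S.trans hSs)))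
    (fun x hx => hE x (hS0S (a3 (b3 hx)))) (fun x hx => hbd x (a3 (b3 hx))) δ2 p2 r2 b4 (by linarith)
  refine ⟨![f0, f1, f2], S3, ?_, d2, d3.trans (b3.trans (a3.trans hS0S)), ?_, ?_⟩
  · intro j
    fin_cases j
    exacts [a1, b1, d1]
  · rw [e3]; exact d4
  · intro x hx j
    fin_cases j
    · exact (a5 x (b3 (d3 hx))).trans (hfin δ hδ hδ1 (by linarith))
    · exact (b5 x (d3 hx)).trans (hfin δ1 p1 r1 (by linarith))
    · exact (d5 x hx).trans (hfin δ2 p2 r2 (by linarith))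

theorem good_union {a φ : Fin 3 → E2 → ℝ} {s t : Set E2} (os : IsOpen s) (ot : IsOpen t)
    {c C : ℝ} {n : ℕ} (hc : 0 < c) (hC : 0 < C)
    (hs : GoodP a φ s c C n) (ht : GoodP a φ t c C n) :
    GoodP a φ (s ∪ t) (c / 2 ^ n) (C * 2 ^ n) n := by
  intro ε hε hε1 f hb S hS hSs hE δ hδ hδ1 hδS hεδ
  have e1 : c / 2 ^ n * δ ^ n = c * (δ / 2) ^ n := by rw [div_pow]; field_simp
  have e2 : C * 2 ^ n * ε / δ ^ n = C * ε / (δ / 2) ^ n := by rw [div_pow]; field_simp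
  rw [e1] at hεδ
  rw [e1, e2]
  have hor : ENNReal.ofReal (δ / 2) ≤ volume (S ∩ s) ∨ ENNReal.ofReal (δ / 2) ≤ volume (S ∩ t) := by
    by_contra hcon
    push Not at hcon
    have h1 : volume S ≤ volume (S ∩ s) + volume (S ∩ t) := by
      refine (measure_mono ?_).trans (measure_union_le _ _)
      rw [← inter_union_distrib_left]
      exact subset_inter subset_rfl hSs
    have h2 : volume S < ENNReal.ofReal (δ / 2) + ENNReal.ofReal (δ / 2) :=
      h1.trans_lt (ENNReal.add_lt_add hcon.1 hcon.2)
    rw [← ENNReal.ofReal_add (by positivity) (by positivity), add_halves] at h2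
    exact absurd hδS (not_le.2 h2)
  rcases hor with h | h
  · obtain ⟨fs, S', h1, h2, h3, h4, h5⟩ := hs ε hε hε1 f hb (S ∩ s) (hS.inter os.measurableSet)
      inter_subset_right (fun x hx => hE x hx.1) (δ / 2) (by positivity) (by linarith) h hεδ
    exact ⟨fs, S', h1, h2, h3.trans inter_subset_left, h4, h5⟩
  · obtain ⟨fs, S', h1, h2, h3, h4, h5⟩ := ht ε hε hε1 f hb (S ∩ t) (hS.inter ot.measurableSet)
      inter_subset_right (fun x hx => hE x hx.1) (δ / 2) (by positivity) (by linarith) h hεδ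
    exact ⟨fs, S', h1, h2, h3.trans inter_subset_left, h4, h5⟩

theorem good_compact {a φ : Fin 3 → E2 → ℝ} {B : Set E2} (hB : IsCompact B)
    (hloc : ∀ p ∈ B, ∃ N, IsOpen N ∧ p ∈ N ∧ ∃ c C : ℝ, ∃ n : ℕ, 0 < c ∧ 0 < C ∧ GoodP a φ N c C n) :
    ∃ N, B ⊆ N ∧ ∃ c C : ℝ, ∃ n : ℕ, 0 < c ∧ 0 < C ∧ GoodP a φ N c C n := by
  have : ∃ N, IsOpen N ∧ B ⊆ N ∧ ∃ c C : ℝ, ∃ n : ℕ, 0 < c ∧ 0 < C ∧ GoodP a φ N c C n := by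
    refine hB.induction_on (p := fun s => ∃ N, IsOpen N ∧ s ⊆ N ∧ ∃ c C : ℝ, ∃ n : ℕ, 0 < c ∧
      0 < C ∧ GoodP a φ N c C n) ?_ ?_ ?_ ?_
    · refine ⟨∅, isOpen_empty, subset_rfl, 1, 1, 0, by norm_num, by norm_num, ?_⟩
      intro ε hε hε1 f hb S hS hSs hE δ hδ hδ1 hδS
      rw [subset_empty_iff.1 hSs, measure_empty, nonpos_iff_eq_zero, ENNReal.ofReal_eq_zero] at hδS
      exact absurd hδ (not_lt.2 hδS)
    · rintro s t hst ⟨N, oN, h, r⟩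
      exact ⟨N, oN, hst.trans h, r⟩
    · rintro s t ⟨N, oN, h, c, C, n, hc, hC, hG⟩ ⟨N', oN', h', c', C', n', hc', hC', hG'⟩
      refine ⟨N ∪ N', oN.union oN', union_subset_union h h', _, _, _, ?_, ?_, good_union oN oN'
        (c := min c c') (C := max C C') (n := max n n') ?_ ?_
        (hG.mono subset_rfl (lt_min hc hc') (min_le_left _ _) hC (le_max_left _ _) (le_max_left _ _))
        (hG'.mono subset_rfl (lt_min hc hc') (min_le_right _ _) hC' (le_max_right _ _) (le_max_right _ _))⟩
      all_goals positivity
    · intro p hp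
      obtain ⟨N, oN, pN, r⟩ := hloc p hp
      exact ⟨N, mem_nhdsWithin_of_mem_nhds (oN.mem_nhds pN), N, oN, subset_rfl, r⟩
  obtain ⟨N, -, h⟩ := this
  exact ⟨N, h⟩

theorem null_local (gj gk : E2 → ℝ) (p0 : E2) (hj : AnalyticAt ℝ gj p0) (hk : AnalyticAt ℝ gk p0)
    (ijk : LinearIndependent ℝ ![fderiv ℝ gj p0, fderiv ℝ gk p0]) :
    ∃ N, IsOpen N ∧ p0 ∈ N ∧ ∀ Z : Set ℝ, volume Z = 0 → volume (N ∩ gj ⁻¹' Z) = 0 := by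
  obtain ⟨κ, a1, z1, l1, r1⟩ := chart_exists gj gk p0 hj hk ijk
  obtain ⟨K1, hK1, t1, o1, m1, L1, -⟩ := lip_near κ _ a1.contDiffAt
  have b7 : ∀ᶠ p in nhds p0, (gj p, gk p) ∈ t1 :=
    (hj.prod hk).continuousAt.eventually (o1.mem_nhds m1)
  obtain ⟨N, hN, oN, pN⟩ := mem_nhds_iff.1 (l1.and b7)
  refine ⟨N, oN, pN, fun Z hZ => ?_⟩
  have hd1 : Module.finrank ℝ (ℝ × ℝ) = Module.finrank ℝ E2 := by simp [E2]
  obtain ⟨Cκ, hCκ, mκ⟩ := lip_measure (volume : Measure (ℝ × ℝ)) (volume : Measure E2) hd1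
  have h1 := mκ _ κ (t1 ∩ Z ×ˢ univ) (L1.mono inter_subset_left)
  have h0 : volume (t1 ∩ Z ×ˢ (univ : Set ℝ)) = 0 := by
    refine measure_mono_null inter_subset_right ?_
    rw [Measure.volume_eq_prod, Measure.prod_prod, hZ, zero_mul]
  rw [h0, mul_zero, nonpos_iff_eq_zero] at h1
  refine measure_mono_null ?_ h1
  rintro p ⟨hp, hz⟩
  exact ⟨(gj p, gk p), ⟨(hN hp).2, hz, mem_univ _⟩, (hN hp).1⟩

theorem key_of_local (a φ : Fin 3 → E2 → ℝ) (p0 : E2) (j i k : Fin 3)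
    (hji : j ≠ i) (hjk : j ≠ k) (hik : i ≠ k)
    (hφ : ∀ j, AnalyticAt ℝ (φ j) p0) (ha : ∀ j, AnalyticAt ℝ (a j) p0) (ha0 : ∀ j, a j p0 ≠ 0)
    (κ : ℝ × ℝ → E2) (η ξ φh αh : ℝ × ℝ → ℝ)
    (Wl : WebLoc (φ j) (φ i) (φ k) (a j) (a i) p0 κ η ξ φh αh)
    (hJ : ¬∀ᶠ w in nhds ((φ j p0,((φ i p0,φ j p0),φ i p0)):ℝ×((ℝ×ℝ)×ℝ)),
      J5 (Vf η ξ φh) (ef φh αh) (w.1,w.1,w.2)=0) :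
    ∃ N, IsOpen N ∧ p0 ∈ N ∧ ∃ c C : ℝ, ∃ n : ℕ, 0 < c ∧ 0 < C ∧ KeyP a φ N j c C n := by
  obtain ⟨N, oN, pN, c, hc, C, hC, n, h⟩ := key_local (φ j) (φ i) (φ k) (a j) (a i) (a k) p0
    (hφ j) (hφ k) (ha j) (ha i) (ha k) (ha0 j) (ha0 k) κ η ξ φh αh Wl hJ
  refine ⟨N, oN, pN, c, C, n, hc, hC, ?_⟩
  intro ε hε hε1 f S hS hSs hE hb δ hδ hδ1 hδS hεδ
  have hu : (Finset.univ : Finset (Fin 3)) = {j, i, k} := by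
    symm
    apply Finset.eq_univ_of_card
    rw [Finset.card_eq_three.2 ⟨j, i, k, hji, hjk, hik, rfl⟩]
    rfl
  refine h ε hε hε1 (f j) (f i) (f k) S hS hSs (fun p hp => ?_) (fun p hp => ⟨hb p hp j, hb p hp i⟩)
    δ hδ hδS hεδ
  have := hE p hp
  rw [hu, Finset.sum_insert (by simp [hji, hjk]), Finset.sum_insert (by simpa using hik),
    Finset.sum_singleton, ← add_assoc] at this
  exact this

theorem good_local (a φ : Fin 3 → E2 → ℝ) (p0 : E2) (hφ : ∀ j, AnalyticAt ℝ (φ j) p0)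
    (hInd : ∀ i j : Fin 3, i ≠ j → LinearIndependent ℝ ![fderiv ℝ (φ i) p0, fderiv ℝ (φ j) p0])
    (hk : ∀ j, ∃ N, IsOpen N ∧ p0 ∈ N ∧ ∃ c C : ℝ, ∃ n : ℕ, 0 < c ∧ 0 < C ∧ KeyP a φ N j c C n) :
    ∃ N, IsOpen N ∧ p0 ∈ N ∧ ∃ c C : ℝ, ∃ n : ℕ, 0 < c ∧ 0 < C ∧ GoodP a φ N c C n := by
  choose N oN pN c C n hc hC hK using hk
  have hz : ∀ j, ∃ M, IsOpen M ∧ p0 ∈ M ∧ ∀ Z : Set ℝ, volume Z = 0 → volume (M ∩ φ j ⁻¹' Z) = 0 := by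
    intro j
    obtain ⟨k, hk⟩ : ∃ k : Fin 3, j ≠ k := by
      fin_cases j
      exacts [⟨1, by decide⟩, ⟨0, by decide⟩, ⟨0, by decide⟩]
    exact null_local (φ j) (φ k) p0 (hφ j) (hφ k) (hInd j k hk)
  choose M oM pM hM using hz
  set Q := ⋂ j, (N j ∩ M j) with hQ
  have oQ : IsOpen Q := isOpen_iInter_of_finite fun j => (oN j).inter (oM j)
  have pQ : p0 ∈ Q := mem_iInter.2 fun j => ⟨pN j, pM j⟩
  have hQN : ∀ j, Q ⊆ N j := fun j x hx => (mem_iInter.1 hx j).1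
  have hQM : ∀ j, Q ⊆ M j := fun j x hx => (mem_iInter.1 hx j).2
  set c' := min 1 (min (c 0) (min (c 1) (c 2))) with hc'
  have hc'0 : 0 < c' := lt_min one_pos (lt_min (hc 0) (lt_min (hc 1) (hc 2)))
  have hc'le : ∀ j, c' ≤ c j := by
    intro j
    have h0 : c' ≤ min (c 0) (min (c 1) (c 2)) := min_le_right _ _
    fin_cases j
    · exact h0.trans (min_le_left _ _)
    · exact h0.trans ((min_le_right _ _).trans (min_le_left _ _))
    · exact h0.trans ((min_le_right _ _).trans (min_le_right _ _))
  have hCle : ∀ j, C j ≤ ∑ j, C j := fun j =>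
    Finset.single_le_sum (f := C) (fun i _ => (hC i).le) (Finset.mem_univ j)
  have hnle : ∀ j, n j ≤ 1 + ∑ j, n j := fun j =>
    (Finset.single_le_sum (f := n) (fun i _ => Nat.zero_le _) (Finset.mem_univ j)).trans (by omega)
  refine ⟨Q, oQ, pQ, good_of_key hc'0 (min_le_left _ _) ((hC 0).trans_le (hCle 0))
    (n := 1 + ∑ j, n j) (by omega)
    (fun j => (hK j).mono (hQN j) hc'0 (hc'le j) (hC j) (hCle j) (hnle j)) ?_⟩
  intro j Z hZ
  exact measure_mono_null (inter_subset_inter_left _ (hQM j)) (hM j Z hZ)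

/-- Choice of exponents. -/
theorem final_num (c1 C1 D σ : ℝ) (n : ℕ) (hc1 : 0 < c1) (hc1' : c1 ≤ 1) (hC1 : 0 < C1) (hD : 1 ≤ D)
    (hσ : 0 < σ) (hn : 1 ≤ n) :
    ∃ c C : ℝ, 0 < c ∧ 0 < C ∧ ∀ ε v : ℝ, 0 < ε → ε ≤ 1 → v ≤ D → C * ε ^ c < v →
      0 < v / D ∧ v / D ≤ 1 ∧ ε ≤ c1 * (v / D) ^ n ∧ c * v ^ C ≤ c1 * (v / D) ^ n ∧
      C1 * ε / (v / D) ^ n ≤ C * ε ^ (1 - σ) := by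
  have hD0 : 0 < D := by linarith
  have hn0 : (0 : ℝ) < n := by exact_mod_cast hn
  set C := C1 + D / c1 + n with hC
  have hC0 : 0 < C := by positivity
  set c := min (1 / (n : ℝ)) (min (σ / n) (c1 / D ^ C)) with hc
  have hc0 : 0 < c := by
    refine lt_min (by positivity) (lt_min (by positivity) (by positivity))
  have k1 : c * n ≤ 1 := by
    have : c ≤ 1 / (n : ℝ) := min_le_left _ _
    rwa [le_div_iff₀ hn0] at this
  have k2 : c * n ≤ σ := by
    have : c ≤ σ / (n : ℝ) := (min_le_right _ _).trans (min_le_left _ _)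
    rwa [le_div_iff₀ hn0] at this
  have k3 : c ≤ c1 / D ^ C := (min_le_right _ _).trans (min_le_right _ _)
  have k4 : D / c1 ≤ C := by rw [hC]; linarith
  have k5 : 1 ≤ 1 / c1 := by rw [le_div_iff₀ hc1]; linarith
  refine ⟨c, C, hc0, hC0, fun ε v hε hε1 hv hCv => ?_⟩
  have hεc : 0 < ε ^ c := Real.rpow_pos_of_pos hε c
  have hv0 : 0 < v := lt_trans (by positivity) hCv
  have hvD : 0 < v / D := by positivity
  have hlow : (1 / c1) * ε ^ c ≤ v / D := by
    rw [le_div_iff₀ hD0]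
    calc 1 / c1 * ε ^ c * D = (D / c1) * ε ^ c := by field_simp
      _ ≤ C * ε ^ c := by gcongr
      _ ≤ v := hCv.le
  have hpow : (1 / c1) * ε ^ (c * n) ≤ (v / D) ^ n := by
    calc (1 / c1) * ε ^ (c * n) ≤ (1 / c1) ^ n * ε ^ (c * n) := by
          gcongr
          exact le_self_pow₀ k5 (by omega)
      _ = ((1 / c1) * ε ^ c) ^ n := by rw [mul_pow, Real.rpow_mul hε.le, Real.rpow_natCast]
      _ ≤ (v / D) ^ n := by gcongr
  have hpow' : ε ^ (c * n) ≤ (v / D) ^ n := by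
    refine le_trans ?_ hpow
    exact le_mul_of_one_le_left (by positivity) k5
  refine ⟨hvD, by rw [div_le_one hD0]; exact hv, ?_, ?_, ?_⟩
  · have h1 : ε ^ (1 : ℝ) ≤ ε ^ (c * n) := Real.rpow_le_rpow_of_exponent_ge hε hε1 k1
    rw [Real.rpow_one] at h1
    have h2 := mul_le_mul_of_nonneg_left hpow hc1.le
    rw [← mul_assoc, mul_one_div_cancel hc1.ne', one_mul] at h2
    linarith
  · have h1 : v ^ C ≤ v ^ n * D ^ C / D ^ n := by
      have hCn : 0 ≤ C - n := by
        have : 0 ≤ C1 + D / c1 := by positivity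
        rw [hC]; linarith
      have e1 : v ^ C = v ^ n * v ^ (C - n) := by
        rw [← Real.rpow_natCast v n, ← Real.rpow_add hv0]; congr 1; ring
      have e2 : D ^ C / D ^ n = D ^ (C - n) := by
        rw [← Real.rpow_natCast D n, ← Real.rpow_sub hD0]
      rw [e1, mul_div_assoc, e2]
      gcongr
    calc c * v ^ C ≤ c1 / D ^ C * (v ^ n * D ^ C / D ^ n) := by gcongr
      _ = c1 * (v / D) ^ n := by
        have : D ^ C ≠ 0 := by positivity
        rw [div_pow]; field_simp
  · have h1 : ε ^ (1 - c * n) ≤ ε ^ (1 - σ) := Real.rpow_le_rpow_of_exponent_ge hε hε1 (by linarith)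
    calc C1 * ε / (v / D) ^ n ≤ C1 * ε / ε ^ (c * n) := by gcongr
      _ = C1 * ε ^ (1 - c * n) := by rw [Real.rpow_sub hε, Real.rpow_one]; ring
      _ ≤ C * ε ^ (1 - σ) := by
        have : C1 ≤ C := by
          have : 0 ≤ D / c1 + n := by positivity
          rw [hC]; linarith
        gcongr

theorem final_assembly (x₀ : E2) (r : ℝ) (a φ : Fin 3 → E2 → ℝ)
    (ha : ∀ j, ContinuousOn (a j) (Metric.closedBall x₀ r))
    (hφ : ∀ j, ContinuousOn (φ j) (Metric.closedBall x₀ r))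
    (N : Set E2) (hN : Metric.closedBall x₀ r ⊆ N) (c1 C1 : ℝ) (n : ℕ) (hc1 : 0 < c1) (hC1 : 0 < C1)
    (hG : GoodP a φ N c1 C1 n) :
    ∀ σ : ℝ, 0 < σ → ∃ c C : ℝ, 0 < c ∧ 0 < C ∧
      ∀ ε : ℝ, 0 < ε → ε ≤ 1 → ∀ f : Fin 3 → ℝ → ℝ,
        (∀ j, Measurable (f j)) → (∀ j, ∀ᵐ y ∂(volume : Measure ℝ), |f j y| ≤ 2) →
        volume {x ∈ Metric.closedBall x₀ r | |∑ j, a j x * f j (φ j x)| < ε} ≤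
            ENNReal.ofReal (C * ε ^ c) ∨
        ∃ (fstar : Fin 3 → ℝ → ℝ) (S : Set (EuclideanSpace ℝ (Fin 2))),
          (∀ j, ConstOnIntervals (fstar j) ε) ∧ MeasurableSet S ∧
          S ⊆ {x ∈ Metric.closedBall x₀ r | |∑ j, a j x * f j (φ j x)| < ε} ∧
          ENNReal.ofReal c *
              volume {x ∈ Metric.closedBall x₀ r | |∑ j, a j x * f j (φ j x)| < ε} ^ C ≤
            volume S ∧
          ∀ x ∈ S, ∀ j, |fstar j (φ j x) - f j (φ j x)| ≤ C * ε ^ (1 - σ) := by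
  intro σ hσ
  set B := Metric.closedBall x₀ r with hB
  have hBfin : volume B ≠ ⊤ := (isCompact_closedBall x₀ r).measure_ne_top
  have hG' := hG.mono subset_rfl (lt_min one_pos hc1) (min_le_right _ _) hC1 le_rfl
    (show n ≤ 1 + n by omega)
  obtain ⟨c, C, hc, hC, hnum⟩ := final_num (min 1 c1) C1 ((volume B).toReal + 1) σ (1 + n)
    (lt_min one_pos hc1) (min_le_left _ _) hC1 (by simp) hσ (by omega)
  refine ⟨c, C, hc, hC, fun ε hε hε1 f hf hb => ?_⟩
  set X := {x ∈ B | |∑ j, a j x * f j (φ j x)| < ε} with hX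
  have hXB : X ⊆ B := sep_subset _ _
  have hXm : MeasurableSet X := by
    have hm : Measurable (fun x : B => |∑ j, a j x * f j (φ j x)|) := by
      refine (Finset.measurable_fun_sum _ fun j _ => ?_).abs
      exact (continuousOn_iff_continuous_domRestrict.1 (ha j)).measurable.mul
        ((hf j).comp (continuousOn_iff_continuous_domRestrict.1 (hφ j)).measurable)
    have h3 := (Metric.isClosed_closedBall (x := x₀) (ε := r)).measurableSet.subtype_image
      (hm (measurableSet_Iio (a := ε)))
    convert h3 using 1
    ext p
    constructor
    · rintro ⟨h, h'⟩
      exact ⟨⟨p, h⟩, h', rfl⟩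
    · rintro ⟨⟨q, h⟩, h', rfl⟩
      exact ⟨h, h'⟩
  have hXfin : volume X ≠ ⊤ := measure_ne_top_of_subset hXB hBfin
  set v := (volume X).toReal with hv
  have hvX : ENNReal.ofReal v = volume X := ENNReal.ofReal_toReal hXfin
  by_cases hle : v ≤ C * ε ^ c
  · left
    rw [← hvX]
    exact ENNReal.ofReal_le_ofReal hle
  right
  push Not at hle
  have hvB : v ≤ (volume B).toReal := ENNReal.toReal_mono hBfin (measure_mono hXB)
  have hv0 : 0 ≤ v := ENNReal.toReal_nonneg
  obtain ⟨n1, n2, n3, n4, n5⟩ := hnum ε v hε hε1 (by linarith) hle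
  obtain ⟨fs, S', h1, h2, h3, h4, h5⟩ := hG' ε hε hε1 f hb X hXm (hXB.trans hN) (fun x hx => hx.2)
    _ n1 n2 (by
      rw [← hvX]
      apply ENNReal.ofReal_le_ofReal
      exact div_le_self hv0 (by linarith)) n3
  refine ⟨fs, S', h1, h2, h3, ?_, fun x hx j => (h5 x hx j).trans n5⟩
  refine le_trans ?_ h4
  rw [← hvX, ENNReal.ofReal_rpow_of_nonneg hv0 hC.le, ← ENNReal.ofReal_mul hc.le]
  exact ENNReal.ofReal_le_ofReal n4

/-- Proposition 6.2 (Microscale): under nondegeneracy, nonvanishing web curvature and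
the auxiliary hypothesis, either `|S(f,ε)| ≲ ε^c`, or all three functions `fⱼ` agree to
within `C ε^{1-σ}`, on a subset of `S(f,ε)` of measure `≳ |S(f,ε)|^C`, with functions
constant on intervals of length `ε`. -/
theorem microscale_proposition
    (x₀ : EuclideanSpace ℝ (Fin 2)) (r : ℝ) (hr : 0 < r)
    (Bt : Set (EuclideanSpace ℝ (Fin 2))) (hBtOpen : IsOpen Bt) (hBtConn : IsConnected Bt)
    (hBBt : Metric.closedBall x₀ r ⊆ Bt)
    (a φ : Fin 3 → EuclideanSpace ℝ (Fin 2) → ℝ)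
    (ha : ∀ j, AnalyticOnNhd ℝ (a j) Bt)
    (hφ : ∀ j, AnalyticOnNhd ℝ (φ j) Bt)
    -- nondegeneracy
    (haNz : ∀ j, ∀ x ∈ Bt, a j x ≠ 0)
    (hInd : ∀ i j : Fin 3, i ≠ j → ∀ x ∈ Bt,
      LinearIndependent ℝ ![fderiv ℝ (φ i) x, fderiv ℝ (φ j) x])
    -- the curvature of the web defined by Φ does not vanish identically
    (hcurv : ¬ ∃ V : Set (EuclideanSpace ℝ (Fin 2)),
      V ⊆ Metric.closedBall x₀ r ∧ IsOpen V ∧ V.Nonempty ∧ IsConnected V ∧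
      ∃ (Φ : EuclideanSpace ℝ (Fin 2) → EuclideanSpace ℝ (Fin 2)) (ψ : Fin 3 → ℝ → ℝ)
        (L : Fin 3 → (EuclideanSpace ℝ (Fin 2) →L[ℝ] ℝ)) (c : Fin 3 → ℝ),
        AnalyticOnNhd ℝ Φ V ∧ Set.InjOn Φ V ∧ IsOpen (Φ '' V) ∧
        (∀ j, AnalyticOnNhd ℝ (ψ j) (φ j '' V) ∧ Set.InjOn (ψ j) (φ j '' V)) ∧
        ∀ j, ∀ x ∈ V, ψ j (φ j x) = L j (Φ x) + c j)
    -- the vector fields Wⱼ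
    (W : Fin 3 → EuclideanSpace ℝ (Fin 2) → EuclideanSpace ℝ (Fin 2))
    (hWanalytic : ∀ j, AnalyticOnNhd ℝ (W j) Bt)
    (hWnz : ∀ j, ∃ x ∈ Bt, W j x ≠ 0)
    (hWφ : ∀ j, ∀ x ∈ Bt, fderiv ℝ (φ j) x (W j x) = 0)
    -- auxiliary hypothesis
    (hAux : ∀ k : Fin 3, ∀ U : Set (EuclideanSpace ℝ (Fin 2)),
      U ⊆ Metric.closedBall x₀ r → IsOpen U → U.Nonempty → ∀ τ : ℝ,
      ∀ g : Fin 3 → ℝ → ℝ, (∀ i, i ≠ k → AnalyticOnNhd ℝ (g i) (φ i '' U)) →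
      (∀ x ∈ U, ∑ i ∈ Finset.univ.filter (fun i => i ≠ k),
          a i x * |fderiv ℝ (φ i) x (W k x)| ^ τ * g i (φ i x) = 0) →
      ∀ i, i ≠ k → ∀ y ∈ φ i '' U, g i y = 0) :
    ∀ σ : ℝ, 0 < σ → ∃ c C : ℝ, 0 < c ∧ 0 < C ∧
      ∀ ε : ℝ, 0 < ε → ε ≤ 1 → ∀ f : Fin 3 → ℝ → ℝ,
        (∀ j, Measurable (f j)) → (∀ j, ∀ᵐ y ∂(volume : Measure ℝ), |f j y| ≤ 2) →
        volume {x ∈ Metric.closedBall x₀ r | |∑ j, a j x * f j (φ j x)| < ε} ≤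
            ENNReal.ofReal (C * ε ^ c) ∨
        ∃ (fstar : Fin 3 → ℝ → ℝ) (S : Set (EuclideanSpace ℝ (Fin 2))),
          (∀ j, ConstOnIntervals (fstar j) ε) ∧ MeasurableSet S ∧
          S ⊆ {x ∈ Metric.closedBall x₀ r | |∑ j, a j x * f j (φ j x)| < ε} ∧
          ENNReal.ofReal c *
              volume {x ∈ Metric.closedBall x₀ r | |∑ j, a j x * f j (φ j x)| < ε} ^ C ≤
            volume S ∧
          ∀ x ∈ S, ∀ j, |fstar j (φ j x) - f j (φ j x)| ≤ C * ε ^ (1 - σ) := by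
  have hloc : ∀ p ∈ Metric.closedBall x₀ r, ∃ N, IsOpen N ∧ p ∈ N ∧ ∃ c C : ℝ, ∃ n : ℕ,
      0 < c ∧ 0 < C ∧ GoodP a φ N c C n := by
    intro p0 hp0
    have hb := hBBt hp0
    refine good_local a φ p0 (fun j => hφ j p0 hb) (fun i j hij => hInd i j hij p0 hb) (fun j => ?_)
    obtain ⟨i, k, hji, hjk, hik⟩ : ∃ i k : Fin 3, j ≠ i ∧ j ≠ k ∧ i ≠ k := by
      fin_cases j
      exacts [⟨1, 2, by decide, by decide, by decide⟩, ⟨0, 2, by decide, by decide, by decide⟩,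
        ⟨0, 1, by decide, by decide, by decide⟩]
    obtain ⟨κ, η, ξ, φh, αh, Wl⟩ := webLoc_exists (φ j) (φ i) (φ k) (a j) (a i) p0
      (hφ j p0 hb) (hφ i p0 hb) (hφ k p0 hb) (ha j p0 hb) (ha i p0 hb) (haNz j p0 hb) (haNz i p0 hb)
      (hInd j k hjk p0 hb) (hInd i k hik p0 hb) (hInd j i hji p0 hb)
    exact key_of_local a φ p0 j i k hji hjk hik (fun j => hφ j p0 hb) (fun j => ha j p0 hb)
      (fun j => haNz j p0 hb) κ η ξ φh αh Wl
      (nondeg x₀ r hr Bt hBBt a φ ha hφ haNz hInd hcurv W hWφ hAux p0 hp0 j i k hji hjk hik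
        κ η ξ φh αh Wl)
  obtain ⟨N, hN, c, C, n, hc, hC, hG⟩ := good_compact (isCompact_closedBall x₀ r) hloc
  exact final_assembly x₀ r a φ (fun j => (ha j).continuousOn.mono hBBt)
    (fun j => (hφ j).continuousOn.mono hBBt) N hN c C n hc hC hG
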